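/- For every integer t ≥ 1 there exists a constant c₀ > 0 such that for every natural number n there is a number field l with exactly t complex places, [l : ℚ] ≥ n, and root discriminant |Δ_l|^{1/[l:ℚ]} ≤ c₀. -/

import Mathlib

set_option linter.style.haveILetI false
open NumberField IsDedekindDomain
namespace T10
abbrev Pr (K : Type) [Field K] [NumberField K] := HeightOneSpectrum (𝓞 K)
section Ord
variable {K : Type} [Field K] [NumberField K]
noncomputable def ord (P : Pr K) (x : K) : ℤ := - WithZero.log (P.valuation K x)
lemma val_ne (P : Pr K) {x : K} (hx : x ≠ 0) : P.valuation K x ≠ 0 := by simpa using hx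
lemma ord_mul (P : Pr K) {x y : K} (hx : x ≠ 0) (hy : y ≠ 0) :
    ord P (x * y) = ord P x + ord P y := by
  unfold ord; rw [map_mul, WithZero.log_mul (val_ne P hx) (val_ne P hy)]; ring
lemma ord_one (P : Pr K) : ord P (1 : K) = 0 := by simp [ord]
lemma ord_inv (P : Pr K) (x : K) : ord P x⁻¹ = - ord P x := by
  unfold ord; rw [map_inv₀, WithZero.log_inv]
lemma ord_div (P : Pr K) {x y : K} (hx : x ≠ 0) (hy : y ≠ 0) :
    ord P (x / y) = ord P x - ord P y := by
  rw [div_eq_mul_inv, ord_mul P hx (inv_ne_zero hy), ord_inv]; ring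
lemma ord_pow (P : Pr K) (x : K) (n : ℕ) : ord P (x ^ n) = n * ord P x := by
  unfold ord; rw [map_pow, WithZero.log_pow]; simp
lemma ord_neg (P : Pr K) (x : K) : ord P (-x) = ord P x := by
  unfold ord; rw [Valuation.map_neg]
lemma ord_nonneg_iff (P : Pr K) {x : K} (hx : x ≠ 0) : 0 ≤ ord P x ↔ P.valuation K x ≤ 1 := by
  unfold ord; rw [neg_nonneg, WithZero.log_le_iff_le_exp (val_ne P hx)]; simp
lemma ord_pos_iff (P : Pr K) {x : K} (hx : x ≠ 0) : 0 < ord P x ↔ P.valuation K x < 1 := by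
  unfold ord; rw [Left.neg_pos_iff, WithZero.log_lt_iff_lt_exp (val_ne P hx)]; simp
lemma ord_int_nonneg (P : Pr K) (x : 𝓞 K) : 0 ≤ ord P (x : K) := by
  by_cases hx : x = 0
  · simp [hx, ord]
  · exact (ord_nonneg_iff P (by simpa using hx)).2 (P.valuation_le_one x)
lemma ord_int_pos (P : Pr K) {x : 𝓞 K} (hx : x ≠ 0) : 0 < ord P (x : K) ↔ x ∈ P.asIdeal := by
  rw [ord_pos_iff P (by simpa using hx)]; exact P.valuation_lt_one_iff_mem x
lemma ord_int_zero (P : Pr K) {x : 𝓞 K} (hx : x ∉ P.asIdeal) : ord P (x : K) = 0 := by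
  have h0 : x ≠ 0 := by rintro rfl; exact hx (zero_mem _)
  have := (ord_int_pos P h0).not.2 hx
  have := ord_int_nonneg P x
  omega
lemma ord_ge_iff (P : Pr K) {x : 𝓞 K} (hx : x ≠ 0) (n : ℕ) :
    (n : ℤ) ≤ ord P (x : K) ↔ x ∈ P.asIdeal ^ n := by
  rw [← P.intValuation_le_pow_iff_mem, ← P.valuation_of_algebraMap (K := K), ord,
    ← WithZero.log_le_iff_le_exp (val_ne P (by simpa using hx))]
  constructor <;> intro h <;> linarith
lemma int_of_ord {x : K} (h : ∀ P : Pr K, 0 ≤ ord P x) : ∃ y : 𝓞 K, (y : K) = x := by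
  by_cases hx : x = 0
  · exact ⟨0, by simp [hx]⟩
  obtain ⟨y, hy⟩ := HeightOneSpectrum.mem_integers_of_valuation_le_one (R := 𝓞 K) K x
    (fun P => (ord_nonneg_iff P hx).1 (h P))
  exact ⟨y, hy⟩
lemma exists_frac (P : Pr K) {x : K} (h : 0 ≤ ord P x) :
    ∃ n d : 𝓞 K, d ∉ P.asIdeal ∧ x * (d : K) = n := by
  by_cases hx : x = 0
  · exact ⟨0, 1, (Ideal.ne_top_iff_one _).1 P.isPrime.ne_top, by simp [hx]⟩
  obtain ⟨n, d, hd⟩ := P.exists_primeCompl_mul_eq_of_integer x ((ord_nonneg_iff P hx).1 h)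
  exact ⟨n, d, d.2, hd⟩
lemma ord_finite {x : K} (hx : x ≠ 0) : {P : Pr K | ord P x ≠ 0}.Finite := by
  have h1 := HeightOneSpectrum.Support.finite (𝓞 K) x
  have h2 := HeightOneSpectrum.Support.finite (𝓞 K) x⁻¹
  refine (h1.union h2).subset fun P hP => ?_
  rcases lt_or_gt_of_ne hP with h | h
  · left
    have := (ord_nonneg_iff P hx).not.1 (not_le.2 h)
    simpa [HeightOneSpectrum.Support] using this
  · right
    have := (ord_nonneg_iff P (inv_ne_zero hx)).not.1 (by rw [ord_inv]; omega)
    simpa [HeightOneSpectrum.Support] using this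
lemma exists_unif (P : Pr K) : ∃ x : K, x ≠ 0 ∧ ord P x = 1 := by
  obtain ⟨π, h⟩ := P.valuation_exists_uniformizer K
  refine ⟨π, ?_, by simp [ord, h]⟩
  rintro rfl
  rw [map_zero] at h
  exact WithZero.exp_ne_zero h.symm
lemma finite_over {x : 𝓞 K} (hx : x ≠ 0) : {P : Pr K | x ∈ P.asIdeal}.Finite := by
  refine (ord_finite (x := (x : K)) (by simpa using hx)).subset fun P hP => ?_
  have := (ord_int_pos P hx).2 hP
  simp only [Set.mem_ofPred_eq]; omega
/-- integral approximation -/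
lemma approx_int (S : Finset (Pr K)) (f : Pr K → ℕ) :
    ∃ x : 𝓞 K, x ≠ 0 ∧ ∀ P ∈ S, ord P (x : K) = f P := by
  classical
  have hex : ∀ P : Pr K, ∃ y : 𝓞 K, y ∈ P.asIdeal ^ (f P) ∧ y ∉ P.asIdeal ^ (f P + 1) := by
    intro P
    have := Ideal.pow_right_strictAnti P.asIdeal P.ne_bot P.isPrime.ne_top (Nat.lt_succ_self (f P))
    exact SetLike.exists_of_lt this
  choose y hy1 hy2 using hex
  by_cases hS : S.Nonempty
  swap
  · rw [Finset.not_nonempty_iff_eq_empty] at hS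
    exact ⟨1, one_ne_zero, by simp [hS]⟩
  obtain ⟨x, hx⟩ := IsDedekindDomain.exists_forall_sub_mem_ideal (s := S) (fun P => P.asIdeal)
    (fun P => f P + 1) (fun P _ => P.prime)
    (fun P _ Q _ h h' => h (HeightOneSpectrum.ext h')) (fun P => y P.1)
  have key : ∀ P ∈ S, x ∈ P.asIdeal ^ (f P) ∧ x ∉ P.asIdeal ^ (f P + 1) := by
    intro P hP
    have h1 := hx P hP
    have h2 := Ideal.pow_le_pow_right (I := P.asIdeal) (Nat.le_succ (f P)) h1
    constructor
    · simpa using add_mem h2 (hy1 P)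
    · intro h3; exact hy2 P (by simpa using sub_mem h3 h1)
  have hx0 : x ≠ 0 := by
    obtain ⟨P, hP⟩ := hS
    rintro rfl
    exact (key P hP).2 (zero_mem _)
  refine ⟨x, hx0, fun P hP => ?_⟩
  have h1 := (ord_ge_iff P hx0 (f P)).2 (key P hP).1
  have h2 := (ord_ge_iff P hx0 (f P + 1)).not.2 (key P hP).2
  push_cast at h2; omega
lemma approx (S : Finset (Pr K)) (f : Pr K → ℤ) :
    ∃ x : K, x ≠ 0 ∧ ∀ P ∈ S, ord P x = f P := by
  obtain ⟨a, ha, ha'⟩ := approx_int S (fun P => (f P).toNat)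
  obtain ⟨b, hb, hb'⟩ := approx_int S (fun P => (-f P).toNat)
  have ha0 : (a : K) ≠ 0 := by simpa using ha
  have hb0 : (b : K) ≠ 0 := by simpa using hb
  refine ⟨a / b, div_ne_zero ha0 hb0, fun P hP => ?_⟩
  rw [ord_div P ha0 hb0, ha' P hP, hb' P hP]
  omega
end Ord
section Gal
variable {K L : Type} [Field K] [NumberField K] [Field L] [NumberField L]
/-- action of field isomorphisms on primes -/
noncomputable def gact (σ : K ≃+* L) : Pr K ≃ Pr L :=
  HeightOneSpectrum.equivOfRingEquiv (RingOfIntegers.mapRingEquiv σ)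
lemma mem_gact (σ : K ≃+* L) (P : Pr K) (x : 𝓞 L) :
    x ∈ (gact σ P).asIdeal ↔ (RingOfIntegers.mapRingEquiv σ).symm x ∈ P.asIdeal := Iff.rfl
lemma gact_asIdeal (σ : K ≃+* L) (P : Pr K) :
    (gact σ P).asIdeal = P.asIdeal.map (RingOfIntegers.mapRingEquiv σ) := by
  rw [← Ideal.comap_symm]; rfl
lemma ord_gact_int (σ : K ≃+* L) (P : Pr K) {x : 𝓞 K} (hx : x ≠ 0) :
    ord (gact σ P) (σ (x : K)) = ord P (x : K) := by
  have e : σ (x : K) = ((RingOfIntegers.mapRingEquiv σ x : 𝓞 L) : L) := rfl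
  have hx' : RingOfIntegers.mapRingEquiv σ x ≠ 0 := by simpa using hx
  have key : ∀ n : ℕ, (n : ℤ) ≤ ord (gact σ P) (σ (x : K)) ↔ (n : ℤ) ≤ ord P (x : K) := by
    intro n
    rw [e, ord_ge_iff _ hx', ord_ge_iff _ hx, gact_asIdeal, ← Ideal.map_pow, ← Ideal.comap_symm,
      Ideal.mem_comap]
    simp
  have h1 : 0 ≤ ord (gact σ P) (σ (x : K)) := by rw [e]; exact ord_int_nonneg _ _
  have h2 := ord_int_nonneg P x
  apply le_antisymm
  · have := (key (ord (gact σ P) (σ (x : K))).toNat).1 (by omega)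
    omega
  · have := (key (ord P (x : K)).toNat).2 (by omega)
    omega
lemma ord_gact (σ : K ≃+* L) (P : Pr K) (x : K) :
    ord (gact σ P) (σ x) = ord P x := by
  by_cases hx : x = 0
  · simp [hx, ord]
  obtain ⟨a, b, hb, rfl⟩ := IsFractionRing.div_surjective (A := 𝓞 K) x
  have hb0 : b ≠ 0 := nonZeroDivisors.ne_zero hb
  have ha0 : a ≠ 0 := by rintro rfl; simp at hx
  have hb1 : (b : K) ≠ 0 := by simpa using hb0
  have ha1 : (a : K) ≠ 0 := by simpa using ha0
  have h3 : σ (a : K) ≠ 0 := by simpa using ha0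
  have h4 : σ (b : K) ≠ 0 := by simpa using hb0
  change ord (gact σ P) (σ ((a : K) / (b : K))) = ord P ((a : K) / (b : K))
  rw [map_div₀, ord_div _ h3 h4, ord_div _ ha1 hb1, ord_gact_int _ _ ha0, ord_gact_int _ _ hb0]
lemma gact_gact {M : Type} [Field M] [NumberField M] (σ : K ≃+* L) (τ : L ≃+* M) (P : Pr K) :
    gact τ (gact σ P) = gact (σ.trans τ) P := by
  ext x; rfl
lemma gact_refl (P : Pr K) : gact (RingEquiv.refl K) P = P := by
  ext x; rfl
end Gal
section Over
variable {K L : Type} [Field K] [NumberField K] [Field L] [NumberField L] [Algebra K L]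
noncomputable def under (K : Type) {L : Type} [Field K] [NumberField K] [Field L] [NumberField L]
    [Algebra K L] (P : Pr L) : Pr K where
  asIdeal := P.asIdeal.under (𝓞 K)
  isPrime := inferInstance
  ne_bot := by
    have := P.isPrime
    exact mt Ideal.eq_bot_of_comap_eq_bot P.ne_bot
lemma mem_under (P : Pr L) (x : 𝓞 K) :
    x ∈ (under K P).asIdeal ↔ algebraMap (𝓞 K) (𝓞 L) x ∈ P.asIdeal := Iff.rfl
noncomputable def ram (K : Type) {L : Type} [Field K] [NumberField K] [Field L] [NumberField L]
    [Algebra K L] (P : Pr L) : ℕ := (under K P).asIdeal.ramificationIdx' P.asIdeal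
instance (P : Pr L) : P.asIdeal.LiesOver (under K P).asIdeal := ⟨rfl⟩
lemma ord_algebraMap (P : Pr L) (x : K) :
    ord P (algebraMap K L x) = ram K P * ord (under K P) x := by
  have := HeightOneSpectrum.valuation_liesOver (K := K) L (under K P) P x
  unfold ord ram
  rw [← this, WithZero.log_pow]
  simp
lemma exists_over (p : Pr K) : ∃ P : Pr L, under K P = p := by
  have := p.isPrime
  have : p.asIdeal.IsMaximal := p.isMaximal
  obtain ⟨Q, hQ1, hQ2⟩ := Ideal.exists_maximal_ideal_liesOver_of_isIntegral (S := 𝓞 L) p.asIdeal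
  refine ⟨⟨Q, hQ1.isPrime, ?_⟩, ?_⟩
  · rintro rfl
    apply p.ne_bot
    have := hQ2.over
    rw [this]
    exact Ideal.comap_bot_of_injective _ (FaithfulSMul.algebraMap_injective _ _)
  · ext1
    exact hQ2.over.symm
lemma ram_pos (P : Pr L) : 0 < ram K P := by
  unfold ram
  exact Nat.pos_of_ne_zero (Ideal.IsDedekindDomain.ramificationIdx'_ne_zero_of_liesOver P.asIdeal (under K P).ne_bot)
lemma under_gact (σ : L ≃ₐ[K] L) (P : Pr L) : under K (gact σ.toRingEquiv P) = under K P := by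
  ext x
  rw [mem_under, mem_under, mem_gact]
  have : (RingOfIntegers.mapRingEquiv σ.toRingEquiv).symm (algebraMap (𝓞 K) (𝓞 L) x)
      = algebraMap (𝓞 K) (𝓞 L) x := by
    apply RingOfIntegers.ext
    exact σ.symm.commutes (x : K)
  rw [this]
lemma exists_gact [IsGalois K L] (P Q : Pr L) (h : under K P = under K Q) :
    ∃ σ : L ≃ₐ[K] L, gact σ.toRingEquiv P = Q := by
  have := P.isPrime
  have := Q.isPrime
  have : P.asIdeal.LiesOver (under K P).asIdeal := inferInstance
  have : Q.asIdeal.LiesOver (under K P).asIdeal := by rw [h]; infer_instance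
  obtain ⟨σ, hσ⟩ := Ideal.exists_smul_eq_of_isGaloisGroup (under K P).asIdeal P.asIdeal Q.asIdeal
    (L ≃ₐ[K] L)
  refine ⟨σ, ?_⟩
  ext1
  rw [← hσ, gact_asIdeal]
  rfl
/-- Unramified in the strong elementary sense. -/
def Unr (K L : Type) [Field K] [NumberField K] [Field L] [NumberField L] [Algebra K L] : Prop :=
  ∀ P : Pr L, ∃ x : K, x ≠ 0 ∧ ord P (algebraMap K L x) = 1
lemma Unr.ram (h : Unr K L) (P : Pr L) : ram K P = 1 := by
  obtain ⟨x, hx, h1⟩ := h P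
  rw [ord_algebraMap] at h1
  have := Int.eq_one_or_neg_one_of_mul_eq_one h1
  omega
lemma unr_of_ram (h : ∀ P : Pr L, T10.ram K P = 1) : Unr K L := by
  intro P
  obtain ⟨x, hx, h1⟩ := exists_unif (under K P)
  exact ⟨x, hx, by rw [ord_algebraMap, h, h1]; simp⟩
end Over
end T10
open Subgroup
namespace T10
section Idx
variable {G G' : Type*} [CommGroup G] [CommGroup G']
lemma idxR (f : G →* G') {B X : Subgroup G} (h : B ≤ X) :
    B.relIndex X = (B.map f).relIndex (X.map f) * (B ⊓ f.ker).relIndex (X ⊓ f.ker) := by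
  rw [relIndex_map_map]
  have e1 : (B ⊔ f.ker).relIndex (X ⊔ f.ker) = (B ⊔ (f.ker ⊓ X)).relIndex X := by
    rw [← sup_inf_assoc_of_le _ h, inf_relIndex_right]
    rw [← relIndex_sup_right (K := B ⊔ f.ker) (H := X)]
    congr 1
    apply le_antisymm
    · exact sup_le le_sup_left (le_sup_of_le_right le_sup_right)
    · exact sup_le le_sup_left (sup_le (le_sup_of_le_left h) le_sup_right)
  have e2 : (B ⊓ f.ker).relIndex (X ⊓ f.ker) = B.relIndex (B ⊔ (f.ker ⊓ X)) := by
    rw [relIndex_sup_left, inf_comm X, ← inf_relIndex_right B (f.ker ⊓ X),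
      ← inf_relIndex_right (B ⊓ f.ker)]
    congr 1
    ext x; simp only [mem_inf]; tauto
  rw [e1, e2, mul_comm, relIndex_mul_relIndex _ _ _ le_sup_left (sup_le h inf_le_right)]
lemma relIndex_le_card {α : Type*} [Finite α] (H X : Subgroup G) (f : G → α)
    (h : ∀ x ∈ X, ∀ y ∈ X, f x = f y → x / y ∈ H) :
    H.relIndex X ≠ 0 ∧ H.relIndex X ≤ Nat.card α := by
  have hinj : Function.Injective (fun q : X ⧸ H.subgroupOf X => f (q.out : X)) := by
    intro a b hab
    have := h _ (a.out).2 _ (b.out).2 hab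
    rw [← Quotient.out_eq a, ← Quotient.out_eq b]
    apply Quotient.sound
    refine QuotientGroup.leftRel_apply.2 ?_
    rw [mem_subgroupOf]
    have := inv_mem this
    simpa [div_eq_inv_mul, mul_comm] using this
  have := Finite.of_injective _ hinj
  refine ⟨?_, Nat.card_le_card_of_injective _ hinj⟩
  rw [relIndex, Subgroup.index]
  exact Nat.card_pos.ne'
def nm (s : G →* G) : G →* G := MonoidHom.id G * s
def dm (s : G →* G) : G →* G := MonoidHom.id G / s
@[simp] lemma nm_apply (s : G →* G) (x : G) : nm s x = x * s x := rfl
@[simp] lemma dm_apply (s : G →* G) (x : G) : dm s x = x / s x := rfl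
lemma mem_fix {s : G →* G} {x : G} : x ∈ (dm s).ker ↔ s x = x := by
  rw [MonoidHom.mem_ker, dm_apply, div_eq_one]; exact eq_comm
end Idx
lemma herbrand_fin {I : Type*} [CommGroup I] (P : Subgroup I) (hP : P.index ≠ 0) (m n : I →* I)
    (hm : m.range ≤ P.comap n) (hn : n.range ≤ P.comap m)
    (hPm : P ≤ P.comap m) (hPn : P ≤ P.comap n) :
    (P ⊔ m.range).relIndex (P.comap n) = (P ⊔ n.range).relIndex (P.comap m) := by
  have key : ∀ m : I →* I, (P.comap m).index = P.relIndex (P ⊔ m.range) := by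
    intro m
    rw [relIndex_sup_left, MonoidHom.range_eq_map m, ← relIndex_top_right, relIndex_comap]
  have h1 := relIndex_mul_index (H := P) (K := P ⊔ m.range) le_sup_left
  have h2 := relIndex_mul_index (H := P ⊔ m.range) (K := P.comap n) (sup_le hPn hm)
  have h3 := relIndex_mul_index (H := P) (K := P ⊔ n.range) le_sup_left
  have h4 := relIndex_mul_index (H := P ⊔ n.range) (K := P.comap m) (sup_le hPm hn)
  rw [← h2, key n] at h1
  rw [← h4, key m] at h3
  have h5 : P.relIndex (P ⊔ m.range) ≠ 0 := by intro h; rw [h] at h1; simp at h1; exact hP h1.symm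
  have h6 : P.relIndex (P ⊔ n.range) ≠ 0 := by intro h; rw [h] at h3; simp at h3; exact hP h3.symm
  rw [← h3] at h1
  have h7 : P.relIndex (P ⊔ m.range) * P.relIndex (P ⊔ n.range) ≠ 0 := mul_ne_zero h5 h6
  apply Nat.eq_of_mul_eq_mul_left (Nat.pos_of_ne_zero h7)
  linarith
/-- the abstract index identity -/
theorem star {A I : Type*} [CommGroup A] [CommGroup I] (s : A →* A) (S : I →* I) (d : A →* I)
    (hs : ∀ a, s (s a) = a) (hS : ∀ a, S (S a) = a) (hd : ∀ a, d (s a) = S (d a))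
    (hA : ∀ a, a * s a = 1 → ∃ b, a = b / s b) (hI : ∀ a, a * S a = 1 → ∃ b, a = b / S b)
    (hfin : d.range.index ≠ 0) :
    ((nm S).range ⊔ ((dm s).ker).map d).relIndex (dm S).ker
      * (d.ker.map (nm s)).relIndex (d.ker ⊓ (dm s).ker)
    = (nm s).range.relIndex ((nm S).range.comap d ⊓ (dm s).ker)
      * (d.ker.map (dm s)).relIndex (d.ker ⊓ (nm s).ker) := by
  set P := d.range with hPdef
  set n := nm S with hn
  set m := dm S with hm
  set NI := n.range with hNI
  set E := d.ker with hE
  set fixA := (dm s).ker with hfixA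
  have hdn : ∀ a, d (nm s a) = n (d a) := by intro a; simp [hn, hd]
  have hdm : ∀ a, d (dm s a) = m (d a) := by intro a; simp [hm, hd]
  have hmn : ∀ x, m (n x) = 1 := by intro x; simp [hm, hn, hS, mul_comm]
  have hnm : ∀ x, n (m x) = 1 := by intro x; simp [hm, hn, hS]
  have hNIfix : NI ≤ m.ker := by rintro _ ⟨x, rfl⟩; exact hmn x
  have hkern : n.ker = m.range := by
    apply le_antisymm
    · intro x hx
      obtain ⟨b, hb⟩ := hI x hx
      exact ⟨b, by simp [hm, hb]⟩
    · rintro _ ⟨x, rfl⟩; exact hnm x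
  have hkerA : (nm s).ker = (dm s).range := by
    apply le_antisymm
    · intro x hx
      obtain ⟨b, hb⟩ := hA x hx
      exact ⟨b, by simp [hb]⟩
    · rintro _ ⟨x, rfl⟩; simp [MonoidHom.mem_ker, hs]
  have hNA : (nm s).range ≤ fixA := by
    rintro _ ⟨x, rfl⟩; simp [hfixA, MonoidHom.mem_ker, hs, mul_comm]
  have hPm : P ≤ P.comap m := by rintro _ ⟨a, rfl⟩; exact ⟨dm s a, hdm a⟩
  have hPn : P ≤ P.comap n := by rintro _ ⟨a, rfl⟩; exact ⟨nm s a, hdn a⟩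
  have hdAfix : fixA.map d ≤ P ⊓ m.ker := by
    rintro _ ⟨a, ha, rfl⟩
    refine ⟨⟨a, rfl⟩, ?_⟩
    change m (d a) = 1
    rw [← hdm, MonoidHom.mem_ker.1 ha, map_one]
  set Q := NI ⊓ P with hQ
  have h1 : (NI ⊔ fixA.map d).relIndex m.ker
      = (P ⊓ m.ker ⊔ NI).relIndex m.ker * (fixA.map d ⊔ Q).relIndex (P ⊓ m.ker) := by
    have e : (fixA.map d ⊔ Q).relIndex (P ⊓ m.ker) =
        (NI ⊔ fixA.map d).relIndex (P ⊓ m.ker ⊔ NI) := by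
      have e1 : fixA.map d ⊔ Q = (fixA.map d ⊔ NI) ⊓ (P ⊓ m.ker) := by
        rw [sup_inf_assoc_of_le _ hdAfix]
        congr 1
        ext x; simp only [hQ, mem_inf]
        constructor
        · rintro ⟨h1, h2⟩; exact ⟨h1, h2, hNIfix h1⟩
        · rintro ⟨h1, h2, _⟩; exact ⟨h1, h2⟩
      rw [e1, inf_relIndex_right, ← relIndex_sup_right (K := fixA.map d ⊔ NI), sup_comm NI]
      congr 1
      rw [← sup_assoc, sup_eq_left.2 hdAfix]
    rw [e, mul_comm, relIndex_mul_relIndex _ _ _ _ (sup_le inf_le_right hNIfix)]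
    exact sup_le le_sup_right (hdAfix.trans le_sup_left)
  set Y := NI.comap d ⊓ fixA with hY
  have hdY : Y.map d = fixA.map d ⊓ Q := by
    ext x; constructor
    · rintro ⟨a, ⟨h1, h2⟩, rfl⟩
      exact ⟨⟨a, h2, rfl⟩, h1, ⟨a, rfl⟩⟩
    · rintro ⟨⟨a, ha, rfl⟩, h1, _⟩
      exact ⟨a, ⟨h1, ha⟩, rfl⟩
  have hQfix : Q ≤ P ⊓ m.ker := fun x hx => ⟨hx.2, hNIfix hx.1⟩
  have h3 : (fixA.map d).relIndex (P ⊓ m.ker) =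
      (Y.map d).relIndex Q * (fixA.map d ⊔ Q).relIndex (P ⊓ m.ker) := by
    rw [hdY, inf_relIndex_right, ← relIndex_sup_left (K := fixA.map d) (H := Q),
      relIndex_mul_relIndex _ _ _ le_sup_left (sup_le hdAfix hQfix)]
  have h4 : (E.map (dm s)).relIndex (E ⊓ (nm s).ker) = (fixA.map d).relIndex (P ⊓ m.ker) := by
    set X := m.ker.comap d with hX
    have e1 : X.map (dm s) = E ⊓ (nm s).ker := by
      ext x; constructor
      · rintro ⟨a, ha, rfl⟩
        refine ⟨?_, ?_⟩
        · change d (dm s a) = 1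
          rw [hdm]; exact ha
        · rw [hkerA]; exact ⟨a, rfl⟩
      · rintro ⟨h1, h2⟩
        rw [hkerA] at h2
        obtain ⟨a, rfl⟩ := h2
        refine ⟨a, ?_, rfl⟩
        have : d (dm s a) = 1 := h1
        rw [hdm] at this; exact this
    have e2 : X.map d = P ⊓ m.ker := by
      rw [hX, Subgroup.map_comap_eq]
    have hfX : fixA ≤ X := fun a ha => (hdAfix ⟨a, ha, rfl⟩).2
    have hEX : E ≤ X := fun a ha => by
      rw [hX, mem_comap, MonoidHom.mem_ker.1 ha]; exact one_mem _
    rw [← e1, ← e2, relIndex_map_map, relIndex_map_map, sup_eq_left.2 hfX, sup_eq_left.2 hEX,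
      sup_comm]
  have hNY : (nm s).range ≤ Y := by
    rintro _ ⟨a, rfl⟩
    exact ⟨⟨d a, (hdn a).symm⟩, hNA ⟨a, rfl⟩⟩
  have hNP : (nm s).range.map d = P.map n := by
    rw [MonoidHom.map_range, hPdef, MonoidHom.map_range]
    congr 1
    ext a; exact hdn a
  have h5 : (nm s).range.relIndex Y = (P.map n).relIndex (Y.map d) *
      ((nm s).range ⊓ E).relIndex (E ⊓ fixA) := by
    rw [idxR d hNY, hNP]
    congr 2
    ext x; constructor
    · rintro ⟨h1, h2⟩; exact ⟨h2, h1.2⟩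
    · rintro ⟨h1, h2⟩
      refine ⟨⟨?_, h2⟩, h1⟩
      change d x ∈ NI
      rw [MonoidHom.mem_ker.1 h1]; exact one_mem _
  have h6 : (P.map n).relIndex Q = (P.map n).relIndex (Y.map d) * (Y.map d).relIndex Q := by
    rw [relIndex_mul_relIndex]
    · rw [← hNP]; exact Subgroup.map_mono hNY
    · rw [hdY]; exact inf_le_right
  have h7 : (E.map (nm s)).relIndex (E ⊓ fixA) =
      (E.map (nm s)).relIndex ((nm s).range ⊓ E) * ((nm s).range ⊓ E).relIndex (E ⊓ fixA) := by
    rw [relIndex_mul_relIndex]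
    · rintro _ ⟨a, ha, rfl⟩
      refine ⟨⟨a, rfl⟩, ?_⟩
      have : d a = 1 := ha
      change d (nm s a) = 1
      rw [hdn, this, map_one]
    · intro x hx; exact ⟨hx.2, hNA hx.1⟩
  have h8 : (P.map n).relIndex Q = (P ⊔ m.range).relIndex (P.comap n) := by
    have : Q = (P.comap n).map n := by rw [Subgroup.map_comap_eq]
    rw [this, relIndex_map_map, hkern]
    congr 1
    rw [sup_eq_left, ← hkern]
    intro x hx
    rw [mem_comap, MonoidHom.mem_ker.1 hx]; exact one_mem _
  have h9 : (E.map (nm s)).relIndex ((nm s).range ⊓ E) = (P.map m).relIndex (P ⊓ n.ker) := by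
    have e1 : (E.comap (nm s)).map (nm s) = (nm s).range ⊓ E := by rw [Subgroup.map_comap_eq]
    have e2 : (E.comap (nm s)).map d = P ⊓ n.ker := by
      ext x; constructor
      · rintro ⟨a, ha, rfl⟩
        refine ⟨⟨a, rfl⟩, ?_⟩
        change n (d a) = 1
        rw [← hdn]; exact ha
      · rintro ⟨⟨a, rfl⟩, h⟩
        refine ⟨a, ?_, rfl⟩
        change d (nm s a) = 1
        rw [hdn]; exact h
    have e3 : ((nm s).ker).map d = P.map m := by
      rw [hkerA, MonoidHom.map_range, hPdef, MonoidHom.map_range]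
      congr 1
      ext a; exact hdm a
    have hkX : (nm s).ker ≤ E.comap (nm s) := fun a ha => by
      rw [mem_comap, MonoidHom.mem_ker.1 ha]; exact one_mem _
    have hEX : E ≤ E.comap (nm s) := fun a ha => by
      change d (nm s a) = 1
      rw [hdn, MonoidHom.mem_ker.1 ha, map_one]
    rw [← e1, ← e2, ← e3, relIndex_map_map, relIndex_map_map, sup_eq_left.2 hkX,
      sup_eq_left.2 hEX, sup_comm]
  have h10 : (P ⊔ NI).relIndex (P.comap m) =
      (P ⊓ m.ker ⊔ NI).relIndex m.ker * (P.map m).relIndex (P ⊓ n.ker) := by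
    have e1 : (P ⊓ m.ker ⊔ NI).relIndex m.ker = (P ⊔ NI).relIndex (P ⊔ m.ker) := by
      have e : P ⊓ m.ker ⊔ NI = (NI ⊔ P) ⊓ m.ker := by
        rw [sup_inf_assoc_of_le _ hNIfix, sup_comm]
      rw [e, inf_relIndex_right, ← relIndex_sup_right (K := NI ⊔ P), sup_comm NI]
      congr 1
      rw [sup_comm P NI, ← sup_assoc, sup_eq_left.2 hNIfix, sup_comm]
    have e2 : P ⊓ n.ker = (P.comap m).map m := by rw [Subgroup.map_comap_eq, hkern, inf_comm]
    have e3 : m.ker ≤ P.comap m := fun x hx => by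
      rw [mem_comap, MonoidHom.mem_ker.1 hx]; exact one_mem _
    rw [e1, e2, relIndex_map_map, sup_eq_left.2 e3, relIndex_mul_relIndex]
    · exact sup_le le_sup_left (hNIfix.trans le_sup_right)
    · exact sup_le hPm e3
  have h11 := herbrand_fin P hfin m n
    (by rintro _ ⟨x, rfl⟩; rw [mem_comap, hnm]; exact one_mem _)
    (by rintro _ ⟨x, rfl⟩; rw [mem_comap, hmn]; exact one_mem _) hPm hPn
  rw [h1, h7, h5, h4, h3, h9]
  rw [← h8, h6, h10] at h11
  calc _ = (((P ⊓ m.ker ⊔ NI).relIndex m.ker) * ((P.map m).relIndex (P ⊓ n.ker))) *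
      ((fixA.map d ⊔ Q).relIndex (P ⊓ m.ker) * ((nm s).range ⊓ E).relIndex (E ⊓ fixA)) := by ring
    _ = _ := by rw [← h11]; ring
end T10
open Subgroup NumberField
namespace T10
/-- abstract Herbrand quotient of units -/
theorem unit_herbrand {A : Type*} [CommGroup A] (s : A →* A) (hs : ∀ a, s (s a) = a)
    (E : Subgroup A) (hE : ∀ a ∈ E, s a ∈ E) (n : ℕ) (ε : A) (hεE : ε ∈ E) (hε1 : ε ≠ 1)
    (hε2 : ε ^ 2 = 1) (hεs : s ε = ε) (hε : ∀ x : A, x ^ 2 = 1 → x = 1 ∨ x = ε)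
    (h2n : (E.map (powMonoidHom 2)).relIndex E = 2 ^ (2 * n))
    (hn : ((E ⊓ (dm s).ker).map (powMonoidHom 2)).relIndex (E ⊓ (dm s).ker) = 2 ^ n) :
    (E.map (dm s)).relIndex (E ⊓ (nm s).ker) = 2 * (E.map (nm s)).relIndex (E ⊓ (dm s).ker) ∧
    (E.map (nm s)).relIndex (E ⊓ (dm s).ker) ≠ 0 := by
  set sq : A →* A := powMonoidHom 2 with hsq
  have sq_app : ∀ x, sq x = x ^ 2 := fun x => rfl
  set F := E ⊓ (dm s).ker with hF
  set M := E ⊓ (nm s).ker with hM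
  set D := E.map (dm s) with hD
  have memF : ∀ {x}, x ∈ F ↔ x ∈ E ∧ s x = x := by
    intro x; rw [hF, mem_inf, mem_fix]
  have memM : ∀ {x}, x ∈ M ↔ x ∈ E ∧ x * s x = 1 := by
    intro x; rw [hM, mem_inf, MonoidHom.mem_ker, nm_apply]
  have hDM : D ≤ M := by
    rintro _ ⟨x, hx, rfl⟩
    rw [memM]
    exact ⟨div_mem hx (hE x hx), by simp [hs]⟩
  have hker : ∀ {x}, x ∈ sq.ker ↔ x = 1 ∨ x = ε := by
    intro x; rw [MonoidHom.mem_ker, sq_app]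
    constructor
    · exact hε x
    · rintro (rfl | rfl); exacts [one_pow 2, hε2]
  have hεF : ε ∈ F := memF.2 ⟨hεE, hεs⟩
  have hkF : sq.ker ≤ F := by
    intro x hx; rcases hker.1 hx with rfl | rfl; exacts [one_mem _, hεF]
  have hkM : sq.ker ≤ M := by
    intro x hx; rcases hker.1 hx with rfl | rfl
    exacts [one_mem _, memM.2 ⟨hεE, by rw [hεs, ← pow_two, hε2]⟩]
  have hcard : Nat.card sq.ker = 2 := by
    have : (sq.ker : Set A) = {1, ε} := by
      ext x; simpa using hker
    change Nat.card (sq.ker : Set A) = 2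
    rw [Nat.card_coe_set_eq, this]
    exact Set.ncard_pair hε1.symm
  have sqle : ∀ H : Subgroup A, H.map sq ≤ H := by
    rintro H _ ⟨x, hx, rfl⟩; exact pow_mem hx 2
  have mapsq : ∀ (f : A →* A) (H : Subgroup A), (H.map sq).map f = (H.map f).map sq := by
    intro f H
    rw [Subgroup.map_map, Subgroup.map_map]
    congr 1
    ext x; simp [sq_app]
  have ha : (E.map sq).relIndex E = (D.map sq).relIndex D * (E.map sq ⊓ F).relIndex F := by
    rw [idxR (dm s) (sqle E), mapsq]
    congr 1
    rw [hF, ← inf_assoc, inf_eq_left.2 (sqle E)]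
  have hFsq : F.map sq ≤ E.map sq ⊓ F :=
    le_inf (Subgroup.map_mono inf_le_left) (sqle F)
  have hb : (F.map sq).relIndex F = (F.map sq).relIndex (E.map sq ⊓ F) * (E.map sq ⊓ F).relIndex F :=
    (relIndex_mul_relIndex _ _ _ hFsq inf_le_right).symm
  have hc : Nat.card (D ⊓ sq.ker : Subgroup A) = (F.map sq).relIndex (E.map sq ⊓ F) := by
    set U := E ⊓ F.comap sq with hU
    have hFU : F ≤ U := fun x hx => ⟨hx.1, pow_mem hx 2⟩
    have e1 : U.map sq = E.map sq ⊓ F := by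
      ext x; constructor
      · rintro ⟨y, hy, rfl⟩; exact ⟨⟨y, hy.1, rfl⟩, hy.2⟩
      · rintro ⟨⟨y, hy, rfl⟩, h⟩; exact ⟨y, ⟨hy, h⟩, rfl⟩
    have e2 : U.map (dm s) = D ⊓ sq.ker := by
      ext x; constructor
      · rintro ⟨y, hy, rfl⟩
        refine ⟨⟨y, hy.1, rfl⟩, ?_⟩
        have := (memF.1 hy.2).2
        simp only [sq_app, map_pow] at this
        change (y / s y) ^ 2 = 1
        rw [div_pow, this, div_self']
      · rintro ⟨⟨y, hy, rfl⟩, h⟩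
        refine ⟨y, ⟨hy, ?_⟩, rfl⟩
        have h' : (y / s y) ^ 2 = 1 := h
        rw [div_pow, div_eq_one] at h'
        exact memF.2 ⟨pow_mem hy 2, by rw [sq_app, map_pow, h']⟩
    have e3 := idxR sq hFU
    have e4 : (U ⊓ sq.ker) = F ⊓ sq.ker :=
      le_antisymm (fun x hx => ⟨hkF hx.2, hx.2⟩) (inf_le_inf_right _ hFU)
    rw [e4, relIndex_self, mul_one, e1] at e3
    have e5 := idxR (dm s) hFU
    have e6 : F ⊓ (dm s).ker = U ⊓ (dm s).ker := by
      apply le_antisymm (inf_le_inf_right _ hFU)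
      intro x hx; exact ⟨⟨hx.1.1, hx.2⟩, hx.2⟩
    have e7 : F.map (dm s) = ⊥ := by
      rw [eq_bot_iff]; rintro _ ⟨x, hx, rfl⟩; exact hx.2
    rw [e6, relIndex_self, mul_one, e2, e7, relIndex_bot_left] at e5
    rw [← e5, e3]
  have hd : D.relIndex M = (D.map sq).relIndex (M.map sq) * (D ⊓ sq.ker).relIndex sq.ker := by
    rw [idxR sq hDM, inf_eq_right.2 hkM]
  have hd' : Nat.card (D ⊓ sq.ker : Subgroup A) * (D ⊓ sq.ker).relIndex sq.ker = 2 := by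
    rw [← hcard, ← relIndex_bot_left, ← relIndex_bot_left,
      relIndex_mul_relIndex _ _ _ bot_le inf_le_right]
  have he : D.relIndex M * (D.map sq).relIndex D = (M.map sq).relIndex M *
      (D.map sq).relIndex (M.map sq) := by
    rw [mul_comm, relIndex_mul_relIndex _ _ _ (sqle D) hDM, mul_comm,
      relIndex_mul_relIndex _ _ _ (Subgroup.map_mono hDM) (sqle M)]
  have hFME : F ⊔ M ≤ E := sup_le inf_le_left inf_le_left
  have hfn : ∀ x ∈ F, nm s x = x ^ 2 := by
    intro x hx; rw [nm_apply, (memF.1 hx).2, pow_two]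
  have hfd : ∀ x ∈ M, dm s x = x ^ 2 := by
    intro x hx
    have := (memM.1 hx).2
    rw [dm_apply, div_eq_mul_inv, inv_eq_of_mul_eq_one_left this, pow_two]
  have mapcongr : ∀ (f g : A →* A) (H : Subgroup A), (∀ x ∈ H, f x = g x) → H.map f = H.map g := by
    intro f g H h
    ext x; constructor
    · rintro ⟨y, hy, rfl⟩; exact ⟨y, hy, (h y hy).symm⟩
    · rintro ⟨y, hy, rfl⟩; exact ⟨y, hy, (h y hy)⟩
  have hf : (F ⊔ M).relIndex E = (F.map sq).relIndex (E.map (nm s)) := by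
    rw [idxR (nm s) hFME, Subgroup.map_sup, mapcongr (nm s) sq F hfn]
    have e1 : M.map (nm s) = ⊥ := by
      rw [eq_bot_iff]; rintro _ ⟨x, hx, rfl⟩; exact hx.2
    have e2 : (F ⊔ M) ⊓ (nm s).ker = E ⊓ (nm s).ker :=
      le_antisymm (inf_le_inf_right _ hFME) (fun x hx => ⟨le_sup_right (a := F) hx, hx.2⟩)
    rw [e1, e2, relIndex_self, mul_one, sup_bot_eq]
  have hg : (F ⊔ M).relIndex E = (M.map sq).relIndex D := by
    rw [idxR (dm s) hFME, Subgroup.map_sup, mapcongr (dm s) sq M hfd]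
    have e1 : F.map (dm s) = ⊥ := by
      rw [eq_bot_iff]; rintro _ ⟨x, hx, rfl⟩; exact hx.2
    have e2 : (F ⊔ M) ⊓ (dm s).ker = E ⊓ (dm s).ker :=
      le_antisymm (inf_le_inf_right _ hFME) (fun x hx => ⟨le_sup_left (b := M) hx, hx.2⟩)
    rw [e1, e2, relIndex_self, mul_one, bot_sup_eq]
  have hMD : M.map sq ≤ D := by
    rw [← mapcongr (dm s) sq M hfd]; exact Subgroup.map_mono inf_le_left
  have hFN : F.map sq ≤ E.map (nm s) := by
    rw [← mapcongr (nm s) sq F hfn]; exact Subgroup.map_mono inf_le_left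
  have hNF : E.map (nm s) ≤ F := by
    rintro _ ⟨x, hx, rfl⟩
    exact memF.2 ⟨mul_mem hx (hE x hx), by simp [hs, mul_comm]⟩
  have hh1 : (F.map sq).relIndex (E.map (nm s)) * (E.map (nm s)).relIndex F = 2 ^ n := by
    rw [relIndex_mul_relIndex _ _ _ hFN hNF, hn]
  have hh2 : (M.map sq).relIndex D * D.relIndex M = (M.map sq).relIndex M :=
    relIndex_mul_relIndex _ _ _ hMD hDM
  have hgdd : (D.map sq).relIndex (M.map sq) * (M.map sq).relIndex D = (D.map sq).relIndex D :=
    relIndex_mul_relIndex _ _ _ (Subgroup.map_mono hDM) hMD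
  rw [← hf, hg] at hh1
  rw [h2n] at ha
  rw [hn, ← hc] at hb
  generalize D.relIndex M = h1 at *
  generalize (E.map (nm s)).relIndex F = h0 at *
  generalize (M.map sq).relIndex D = i at *
  generalize (M.map sq).relIndex M = em at *
  generalize (D.map sq).relIndex (M.map sq) = g at *
  generalize (D.map sq).relIndex D = dd at *
  generalize (E.map sq ⊓ F).relIndex F = f at *
  generalize Nat.card (D ⊓ sq.ker : Subgroup A) = c at *
  generalize (D ⊓ sq.ker).relIndex sq.ker = j at *
  have p1 : 0 < 2 ^ n := by positivity
  have p2 : 0 < 2 ^ (2 * n) := by positivity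
  have q1 : h0 ≠ 0 := by rintro rfl; simp at hh1; omega
  have q2 : 0 < i := Nat.pos_of_ne_zero (by rintro rfl; simp at hh1; omega)
  have q3 : 0 < dd := Nat.pos_of_ne_zero (by rintro rfl; simp at ha)
  have q4 : 0 < g := Nat.pos_of_ne_zero (by rintro rfl; simp at hgdd; omega)
  refine ⟨?_, q1⟩
  have r1 : j * dd = em := by
    apply Nat.eq_of_mul_eq_mul_left q4
    rw [← mul_assoc, ← hd, he, mul_comm]
  have r2 : em * 2 ^ n = 2 * 2 ^ (2 * n) := by
    rw [← r1, hb, ha, ← hd']; ring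
  have r3 : em = 2 * 2 ^ n := by
    apply Nat.eq_of_mul_eq_mul_right p1
    rw [r2]; ring
  apply Nat.eq_of_mul_eq_mul_left q2
  rw [hh2, r3, ← hh1]; ring
section
variable (K : Type) [Field K] [NumberField K]
lemma torsion_tr [IsTotallyReal K] (x : (𝓞 K)ˣ) (hx : x ∈ Units.torsion K) : x = 1 ∨ x = -1 := by
  have h := (Units.mem_torsion K).1 hx
  obtain ⟨φ⟩ : Nonempty (K →+* ℂ) := inferInstance
  have hr := IsTotallyReal.complexEmbedding_isReal φ
  have h1 := h (InfinitePlace.mk φ)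
  rw [InfinitePlace.apply] at h1
  have h2 : φ (x : K) = ((φ (x : K)).re : ℂ) := by
    apply Complex.ext <;> simp
    have := RingHom.congr_fun hr (x : K)
    rw [ComplexEmbedding.conjugate_coe_eq] at this
    exact Complex.conj_eq_iff_im.1 this
  rw [h2, Complex.norm_real, Real.norm_eq_abs, abs_eq zero_le_one] at h1
  rcases h1 with h1 | h1
  · left
    rw [h1] at h2
    apply Units.ext; apply RingOfIntegers.ext
    apply φ.injective; simp [h2]
  · right
    rw [h1] at h2
    apply Units.ext; apply RingOfIntegers.ext
    apply φ.injective; simp [h2]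
lemma sq_index_aux {G : Type*} [CommGroup G] (r : ℕ) (ε : G) (hε1 : ε ≠ 1) (hε2 : ε ^ 2 = 1)
    (f : G → (Fin r → ℤ)) (hf : ∀ x y, f (x * y) = f x + f y) (hfs : Function.Surjective f)
    (hf0 : ∀ x, f x = 0 → x = 1 ∨ x = ε) :
    ((⊤ : Subgroup G).map (powMonoidHom 2)).relIndex ⊤ = 2 ^ r * 2 := by
  have h1 : f 1 = 0 := by have := hf 1 1; simpa using this
  have h2 : ∀ x, f (x ^ 2) = 2 • f x := by intro x; rw [pow_two, hf, two_nsmul]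
  have hε0 : f ε = 0 := by
    have := h2 ε; rw [hε2, h1] at this
    exact (smul_eq_zero.1 this.symm).resolve_left (by norm_num)
  let g : G →* Multiplicative (Fin r → ZMod 2) :=
    { toFun := fun x => Multiplicative.ofAdd (fun i => (f x i : ZMod 2))
      map_one' := by rw [h1]; ext i; simp
      map_mul' := fun x y => by
        rw [hf, ← ofAdd_add]; congr 1; ext i; simp }
  have hg : Function.Surjective g := by
    intro y
    obtain ⟨x, hx⟩ := hfs (fun i => (Multiplicative.toAdd y i).cast)
    refine ⟨x, ?_⟩
    change Multiplicative.ofAdd (fun i => (f x i : ZMod 2)) = y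
    rw [hx]; simp
  set Q := (⊤ : Subgroup G).map (powMonoidHom 2)
  set T := Subgroup.zpowers ε
  have hT : ∀ x, x ∈ T ↔ x = 1 ∨ x = ε := by
    intro x; constructor
    · rintro ⟨k, rfl⟩
      apply hf0
      have hk : ∀ m : ℕ, f (ε ^ m) = 0 := by
        intro m; induction m with
        | zero => simpa using h1
        | succ m ih => rw [pow_succ, hf, ih, hε0, add_zero]
      have hinv : ε⁻¹ = ε := inv_eq_of_mul_eq_one_left (by rw [← pow_two, hε2])
      rcases k.eq_nat_or_neg with ⟨m, rfl | rfl⟩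
      · simpa using hk m
      · have := hk m
        simpa [← inv_pow, hinv] using this
    · rintro (rfl | rfl)
      exacts [one_mem _, Subgroup.mem_zpowers _]
  have hker : g.ker = Q ⊔ T := by
    apply le_antisymm
    · intro x hx
      have hx' : ∀ i, (f x i : ZMod 2) = 0 := fun i => congrFun (congrArg Multiplicative.toAdd hx) i
      have : ∀ i, ∃ c, f x i = 2 * c := fun i =>
        (ZMod.intCast_zmod_eq_zero_iff_dvd _ 2).1 (hx' i)
      choose c hc using this
      obtain ⟨y, hy⟩ := hfs c
      rw [Subgroup.mem_sup]
      refine ⟨y ^ 2, ⟨y, trivial, rfl⟩, x / y ^ 2, ?_, by simp⟩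
      rw [hT]; apply hf0
      have := hf (x / y ^ 2) (y ^ 2)
      rw [div_mul_cancel, h2, hy] at this
      have h3 : f x = 2 • c := by ext i; simp [hc]
      rw [h3] at this
      simpa using this.symm
    · rw [sup_le_iff]; constructor
      · rintro _ ⟨x, -, rfl⟩
        change Multiplicative.ofAdd (fun i => (f (x ^ 2) i : ZMod 2)) = 1
        rw [h2]
        ext i; simp; left; rfl
      · intro x hx
        have : f x = 0 := by rcases (hT x).1 hx with rfl | rfl; exacts [h1, hε0]
        change Multiplicative.ofAdd (fun i => (f x i : ZMod 2)) = 1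
        rw [this]; ext i; simp
  rw [← Subgroup.relIndex_mul_relIndex Q (Q ⊔ T) ⊤ le_sup_left le_top, ← hker, relIndex_top_right,
    Subgroup.index_ker, MonoidHom.range_eq_top.2 hg, hker, relIndex_sup_left, mul_comm]
  congr 1
  · simp [Nat.card_eq_fintype_card]
  · rw [← inf_relIndex_right]
    have e : Q ⊓ T = ⊥ := by
      rw [eq_bot_iff]
      rintro _ ⟨⟨x, -, rfl⟩, h⟩
      have hx : f (x ^ 2) = 0 := by
        have := (hT _).1 h
        simp only [powMonoidHom_apply] at this
        rcases this with h | h <;> rw [h]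
        exacts [h1, hε0]
      rw [h2] at hx
      have := hf0 x ((smul_eq_zero.1 hx).resolve_left (by norm_num))
      rw [Subgroup.mem_bot]
      rcases this with rfl | rfl
      · simp
      · simpa using hε2
    rw [e, relIndex_bot_left, Nat.card_zpowers]
    exact orderOf_eq_prime hε2 hε1
set_option maxSynthPendingDepth 3 in
lemma unit_sq_index [IsTotallyReal K] :
    ((⊤ : Subgroup (𝓞 K)ˣ).map (powMonoidHom 2)).relIndex ⊤ = 2 ^ (Module.finrank ℚ K) := by
  let b := Units.basisModTorsion K
  let e := b.equivFun
  have hneg : (-1 : (𝓞 K)ˣ) ≠ 1 := by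
    intro h
    have := congrArg (fun u : (𝓞 K)ˣ => ((u : 𝓞 K) : K)) h
    norm_num at this
  rw [sq_index_aux (Units.rank K) (-1) hneg (by simp)
    (fun x => e (Additive.ofMul (QuotientGroup.mk x)))]
  · rw [← pow_succ]
    congr 1
    have h1 : Fintype.card (InfinitePlace K) = Module.finrank ℚ K := by
      rw [InfinitePlace.card_eq_nrRealPlaces_add_nrComplexPlaces, IsTotallyReal.nrComplexPlaces_eq_zero, add_zero, IsTotallyReal.finrank]
    rw [Units.rank, h1]
    have := Module.finrank_pos (R := ℚ) (M := K)
    omega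
  · intro x y
    rw [← map_add]; rfl
  · intro y
    obtain ⟨z, hz⟩ := e.surjective y
    obtain ⟨x, hx⟩ := QuotientGroup.mk_surjective (Additive.toMul z)
    exact ⟨x, by rw [← hz]; simp only [hx]; rfl⟩
  · intro x hx
    have : (Additive.ofMul (QuotientGroup.mk (s := Units.torsion K) x)) = 0 := by
      simpa using hx
    exact torsion_tr K x ((QuotientGroup.eq_one_iff x).1 this)
end
end T10
set_option maxSynthPendingDepth 3
open NumberField IsDedekindDomain Subgroup
open scoped nonZeroDivisors
namespace T10
abbrev DivM (K : Type) [Field K] [NumberField K] := Multiplicative (Pr K →₀ ℤ)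
section
variable {K : Type} [Field K] [NumberField K]
def ev (P : Pr K) (D : DivM K) : ℤ := Multiplicative.toAdd D P
@[simp] lemma ev_mul (P : Pr K) (D E : DivM K) : ev P (D * E) = ev P D + ev P E := rfl
@[simp] lemma ev_one (P : Pr K) : ev P (1 : DivM K) = 0 := rfl
@[simp] lemma ev_inv (P : Pr K) (D : DivM K) : ev P D⁻¹ = - ev P D := rfl
@[simp] lemma ev_div (P : Pr K) (D E : DivM K) : ev P (D / E) = ev P D - ev P E := by
  rw [div_eq_mul_inv]; simp [sub_eq_add_neg]
@[simp] lemma ev_pow (P : Pr K) (D : DivM K) (n : ℕ) : ev P (D ^ n) = n * ev P D := by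
  induction n with
  | zero => simp
  | succ n ih => rw [pow_succ, ev_mul, ih]; push_cast; ring
lemma div_ext {D E : DivM K} (h : ∀ P, ev P D = ev P E) : D = E :=
  Multiplicative.toAdd.injective (Finsupp.ext h)
lemma ev_finite (D : DivM K) : {P | ev P D ≠ 0}.Finite :=
  (Multiplicative.toAdd D).hasFiniteSupport
noncomputable def mkD (f : Pr K → ℤ) (h : {P | f P ≠ 0}.Finite) : DivM K :=
  Multiplicative.ofAdd (Finsupp.ofSupportFinite f h)
@[simp] lemma ev_mkD (f : Pr K → ℤ) (h : {P | f P ≠ 0}.Finite) (P : Pr K) : ev P (mkD f h) = f P := rfl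
noncomputable def dv : Kˣ →* DivM K where
  toFun x := mkD (fun P => ord P (x : K)) (ord_finite x.ne_zero)
  map_one' := div_ext fun P => by simp [ord_one]
  map_mul' x y := div_ext fun P => by simp [ord_mul]
@[simp] lemma ev_dv (P : Pr K) (x : Kˣ) : ev P (dv x) = ord P (x : K) := rfl
lemma count_int (P : Pr K) {a : 𝓞 K} (ha : a ≠ 0) :
    FractionalIdeal.count K P (FractionalIdeal.spanSingleton (𝓞 K)⁰ (a : K)) = ord P (a : K) := by
  have h0 : (Ideal.span {a} : Ideal (𝓞 K)) ≠ 0 := by simpa using ha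
  rw [← FractionalIdeal.coeIdeal_span_singleton, FractionalIdeal.count_coe K P h0, ord]
  rw [HeightOneSpectrum.valuation_of_algebraMap, HeightOneSpectrum.intValuation_if_neg _ ha]
  simp
lemma count_span (P : Pr K) (x : Kˣ) :
    FractionalIdeal.count K P (FractionalIdeal.spanSingleton (𝓞 K)⁰ (x : K)) = ord P (x : K) := by
  obtain ⟨a, b, hb, hx⟩ := IsFractionRing.div_surjective (A := 𝓞 K) (x : K)
  have hb0 : b ≠ 0 := nonZeroDivisors.ne_zero hb
  have hbK : (b : K) ≠ 0 := by simpa using hb0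
  have hxb : (x : K) * (b : K) = (a : K) := by rw [← hx]; exact div_mul_cancel₀ _ hbK
  have ha0 : a ≠ 0 := by
    rintro rfl
    apply mul_ne_zero x.ne_zero hbK; rw [hxb]; simp
  have h1 := count_int P ha0
  rw [← hxb, ← FractionalIdeal.spanSingleton_mul_spanSingleton, FractionalIdeal.count_mul,
    count_int P hb0, ord_mul P x.ne_zero hbK] at h1
  · linarith
  · exact FractionalIdeal.spanSingleton_ne_zero_iff.2 x.ne_zero
  · exact FractionalIdeal.spanSingleton_ne_zero_iff.2 hbK
noncomputable def cnt : (FractionalIdeal (𝓞 K)⁰ K)ˣ →* DivM K where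
  toFun I := mkD (fun P => FractionalIdeal.count K P (I : FractionalIdeal (𝓞 K)⁰ K))
    (FractionalIdeal.finite_factors _)
  map_one' := div_ext fun P => by simp [FractionalIdeal.count_one]
  map_mul' x y := div_ext fun P => FractionalIdeal.count_mul K P x.ne_zero y.ne_zero
lemma cnt_surj : Function.Surjective (cnt (K := K)) := by
  intro D
  let I : FractionalIdeal (𝓞 K)⁰ K :=
    (Multiplicative.toAdd D).prod (fun v n => (v.asIdeal : FractionalIdeal (𝓞 K)⁰ K) ^ n)
  have hI : I ≠ 0 := by
    refine Finset.prod_ne_zero_iff.2 fun P _ => zpow_ne_zero _ ?_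
    simpa using P.ne_bot
  refine ⟨Units.mk0 I hI, div_ext fun P => ?_⟩
  exact FractionalIdeal.count_finsuppProd K P (Multiplicative.toAdd D)
lemma dv_index : (dv (K := K)).range.index ≠ 0 := by
  have h1 : (dv (K := K)).range = (toPrincipalIdeal (𝓞 K) K).range.map cnt := by
    rw [MonoidHom.map_range]
    congr 1
    ext1 x
    refine div_ext fun P => ?_
    change _ = FractionalIdeal.count K P _
    rw [ev_dv, ← count_span, coe_toPrincipalIdeal]
  have h2 : (toPrincipalIdeal (𝓞 K) K).range.index ≠ 0 := by
    have := Nat.card_congr (ClassGroup.equiv (R := 𝓞 K) K).toEquiv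
    rw [Subgroup.index, ← this]
    exact Nat.card_pos.ne'
  rw [h1]
  exact fun h => h2 (Nat.eq_zero_of_zero_dvd (h ▸ Subgroup.index_map_dvd _ cnt_surj))
/-- units -/
lemma dv_ker_mem {x : Kˣ} : x ∈ (dv (K := K)).ker ↔ ∀ P : Pr K, ord P (x : K) = 0 := by
  rw [MonoidHom.mem_ker]
  constructor
  · intro h P; rw [← ev_dv, h, ev_one]
  · intro h; exact div_ext fun P => by simpa using h P
lemma dv_ker : (dv (K := K)).ker = (⊤ : Subgroup (𝓞 K)ˣ).map (Units.map (algebraMap (𝓞 K) K : 𝓞 K →* K)) := by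
  ext x
  rw [dv_ker_mem]
  constructor
  · intro h
    obtain ⟨a, ha⟩ := int_of_ord (x := (x : K)) (fun P => (h P).ge)
    obtain ⟨b, hb⟩ := int_of_ord (x := ((x⁻¹ : Kˣ) : K)) (fun P => by
      rw [Units.val_inv_eq_inv_val, ord_inv, h]; simp)
    have hab : a * b = 1 := by
      apply RingOfIntegers.ext
      change (a : K) * (b : K) = 1
      rw [ha, hb]; simp
    refine ⟨Units.mkOfMulEqOne a b hab, trivial, ?_⟩
    ext; exact ha
  · rintro ⟨u, -, rfl⟩ P
    have h1 := ord_int_nonneg P (u : 𝓞 K)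
    have h2 := ord_int_nonneg P ((u⁻¹ : (𝓞 K)ˣ) : 𝓞 K)
    have h3 : ((u : 𝓞 K) : K) * (((u⁻¹ : (𝓞 K)ˣ) : 𝓞 K) : K) = 1 := by
      rw [← map_mul]; simp
    have h4 := ord_mul P (left_ne_zero_of_mul_eq_one h3) (right_ne_zero_of_mul_eq_one h3)
    rw [h3, ord_one] at h4
    change ord P ((u : 𝓞 K) : K) = 0
    omega
lemma units_map_inj : Function.Injective (Units.map (algebraMap (𝓞 K) K : 𝓞 K →* K)) :=
  Units.map_injective RingOfIntegers.coe_injective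
lemma ker_sq_index [IsTotallyReal K] :
    ((dv (K := K)).ker.map (powMonoidHom 2)).relIndex (dv (K := K)).ker = 2 ^ (Module.finrank ℚ K) := by
  rw [← unit_sq_index K, dv_ker, ← relIndex_map_map_of_injective _ _ units_map_inj, Subgroup.map_map,
    Subgroup.map_map]
  congr 2
end
section
variable {K L : Type} [Field K] [NumberField K] [Field L] [NumberField L] [Algebra K L]
structure Quad (σ : L ≃ₐ[K] L) : Prop where
  deg : Module.finrank K L = 2
  ne : ∃ c, σ c ≠ c
lemma quad_galois (h : Module.finrank K L = 2) : IsGalois K L := by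
  haveI : Algebra.IsQuadraticExtension K L := ⟨h⟩
  infer_instance
lemma exists_quad (h : Module.finrank K L = 2) : ∃ σ : L ≃ₐ[K] L, Quad σ := by
  haveI := quad_galois h
  have hc := IsGalois.card_aut_eq_finrank K L
  rw [h, Nat.card_eq_two_iff' 1] at hc
  obtain ⟨σ, hσ, -⟩ := hc
  refine ⟨σ, h, ?_⟩
  by_contra hc
  push Not at hc
  exact hσ (AlgEquiv.ext hc)
variable {σ : L ≃ₐ[K] L}
lemma Quad.all (h : Quad σ) (τ : L ≃ₐ[K] L) : τ = 1 ∨ τ = σ := by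
  haveI := quad_galois h.deg
  have hc := IsGalois.card_aut_eq_finrank K L
  rw [h.deg, Nat.card_eq_two_iff' 1] at hc
  obtain ⟨ρ, hρ, hu⟩ := hc
  by_cases h1 : τ = 1
  · exact Or.inl h1
  · have h2 : σ ≠ 1 := by rintro rfl; obtain ⟨c, hc⟩ := h.ne; exact hc rfl
    exact Or.inr ((hu τ h1).trans (hu σ h2).symm)
lemma Quad.invol (h : Quad σ) (x : L) : σ (σ x) = x := by
  rcases h.all (σ * σ) with h1 | h1
  · exact DFunLike.congr_fun h1 x
  · have : σ = 1 := by simpa using h1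
    rw [this]; rfl
lemma Quad.fix (h : Quad σ) {x : L} (hx : σ x = x) : ∃ y, algebraMap K L y = x := by
  haveI := quad_galois h.deg
  have := (IsGalois.mem_bot_iff_fixed (F := K) x).2 (fun f => by
    rcases h.all f with rfl | rfl
    · rfl
    · exact hx)
  exact IntermediateField.mem_bot.1 this
/-- action on primes -/
noncomputable def pact (σ : L ≃ₐ[K] L) (P : Pr L) : Pr L := gact σ.toRingEquiv P
lemma Quad.pact_pact (h : Quad σ) (P : Pr L) : pact σ (pact σ P) = P := by
  unfold pact; rw [gact_gact]
  have : (σ.toRingEquiv.trans σ.toRingEquiv) = RingEquiv.refl L := by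
    ext x; exact h.invol x
  rw [this, gact_refl]
lemma ord_pact (σ : L ≃ₐ[K] L) (P : Pr L) (x : L) : ord (pact σ P) (σ x) = ord P x :=
  ord_gact σ.toRingEquiv P x
lemma Quad.ord_pact' (h : Quad σ) (P : Pr L) (x : L) : ord (pact σ P) x = ord P (σ x) := by
  rw [← ord_pact σ P, h.invol]
lemma under_pact (σ : L ≃ₐ[K] L) (P : Pr L) : under K (pact σ P) = under K P := under_gact σ P
lemma Quad.over (h : Quad σ) {P Q : Pr L} (hPQ : under K P = under K Q) : Q = P ∨ Q = pact σ P := by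
  haveI := quad_galois h.deg
  obtain ⟨τ, hτ⟩ := exists_gact P Q hPQ
  rcases h.all τ with rfl | rfl
  · left; rw [← hτ]; exact gact_refl P
  · right; exact hτ.symm
noncomputable def sA (σ : L ≃ₐ[K] L) : Lˣ →* Lˣ := Units.map (σ : L →* L)
@[simp] lemma sA_coe (σ : L ≃ₐ[K] L) (x : Lˣ) : ((sA σ x : Lˣ) : L) = σ (x : L) := rfl
/-- action on divisors -/
noncomputable def sD (h : Quad σ) : DivM L →* DivM L where
  toFun D := mkD (fun P => ev (pact σ P) D) (by
    have := (ev_finite D).preimage (f := pact σ) (fun a _ b _ hab => by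
      rw [← h.pact_pact a, hab, h.pact_pact])
    exact this)
  map_one' := div_ext fun P => by simp
  map_mul' x y := div_ext fun P => by simp
@[simp] lemma ev_sD (h : Quad σ) (D : DivM L) (P : Pr L) : ev P (sD h D) = ev (pact σ P) D := rfl
lemma sD_dv (h : Quad σ) (x : Lˣ) : dv (sA σ x) = sD h (dv x) := div_ext fun P => by
  rw [ev_dv, ev_sD, ev_dv, h.ord_pact']; rfl
lemma h90A (h : Quad σ) (a : Lˣ) (ha : a * sA σ a = 1) : ∃ b, a = b / sA σ b := by
  have ha' : (a : L) * σ a = 1 := by simpa using congrArg Units.val ha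
  by_cases h1 : (1 : L) + a = 0
  · obtain ⟨c, hc⟩ := h.ne
    have hb : c - σ c ≠ 0 := sub_ne_zero.2 (Ne.symm hc)
    refine ⟨Units.mk0 _ hb, ?_⟩
    rw [eq_div_iff_mul_eq']
    ext
    have : (a : L) = -1 := by linear_combination h1
    simp [this, h.invol]
  · refine ⟨Units.mk0 _ h1, ?_⟩
    rw [eq_div_iff_mul_eq']
    ext
    simp only [Units.val_mul, Units.val_mk0, sA_coe, map_add, map_one]
    linear_combination ha'
/-- half-system -/
lemma exists_half (h : Quad σ) : ∃ H : Pr L → Prop, ∀ P, pact σ P ≠ P → (H P ↔ ¬ H (pact σ P)) := by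
  classical
  letI := linearOrderOfSTO (WellOrderingRel (α := Pr L))
  refine ⟨fun P => P < pact σ P, fun P hP => ?_⟩
  simp only [h.pact_pact, not_lt]
  exact ⟨le_of_lt, fun h => lt_of_le_of_ne h (Ne.symm hP)⟩
lemma h90D (h : Quad σ) (a : DivM L) (ha : a * sD h a = 1) : ∃ b, a = b / sD h b := by
  classical
  obtain ⟨H, hH⟩ := exists_half h
  refine ⟨mkD (fun P => if H P then ev P a else 0) ?_, div_ext fun P => ?_⟩
  · refine (ev_finite a).subset fun P hP => ?_
    simp only [Set.mem_ofPred_eq, ne_eq, ite_eq_right_iff, not_forall] at hP ⊢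
    exact hP.2
  · have h1 := congrArg (ev P) ha
    simp only [ev_mul, ev_sD, ev_one] at h1
    simp only [ev_div, ev_sD, ev_mkD]
    by_cases hP : pact σ P = P
    · rw [hP] at h1 ⊢; simp; omega
    · have := hH P hP
      by_cases h2 : H P
      · simp [h2, this.1 h2]
      · have h3 : H (pact σ P) := by by_contra h3; exact h2 (this.2 h3)
        simp [h2, h3]; omega
lemma mem_nmD (h : Quad σ) (D : DivM L) :
    D ∈ (nm (sD h)).range ↔ sD h D = D ∧ ∀ P, pact σ P = P → Even (ev P D) := by
  classical
  constructor
  · rintro ⟨b, rfl⟩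
    refine ⟨div_ext fun P => ?_, fun P hP => ?_⟩
    · simp [h.pact_pact, add_comm]
    · simp [hP]
  · rintro ⟨h1, h2⟩
    obtain ⟨H, hH⟩ := exists_half h
    refine ⟨mkD (fun P => if pact σ P = P then ev P D / 2 else if H P then ev P D else 0) ?_,
      div_ext fun P => ?_⟩
    · refine (ev_finite D).subset fun P hP => ?_
      simp only [Set.mem_ofPred_eq, ne_eq] at hP ⊢
      intro h0; apply hP; simp [h0]
    · have h3 := congrArg (ev P) h1
      simp only [ev_sD] at h3
      simp only [nm_apply, ev_mul, ev_sD, ev_mkD]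
      by_cases hP : pact σ P = P
      · have := h2 P hP
        simp only [hP, if_true]
        obtain ⟨k, hk⟩ := this
        omega
      · have hP' : pact σ (pact σ P) ≠ pact σ P := by rw [h.pact_pact]; exact Ne.symm hP
        have := hH P hP
        simp only [if_neg hP, if_neg hP']
        by_cases h2 : H P
        · simp [h2, this.1 h2]
        · have h4 : H (pact σ P) := by by_contra h4; exact h2 (this.2 h4)
          simp [h2, h4, h3]
lemma fixD (h : Quad σ) {D : DivM L} : D ∈ (dm (sD h)).ker ↔ sD h D = D := mem_fix
lemma sA_invol (h : Quad σ) (a : Lˣ) : sA σ (sA σ a) = a := by ext; exact h.invol _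
lemma sD_invol (h : Quad σ) (a : DivM L) : sD h (sD h a) = a := div_ext fun P => by simp [h.pact_pact]
/-- the embedding of units -/
noncomputable def aK (K L : Type) [Field K] [Field L] [Algebra K L] : Kˣ →* Lˣ := Units.map (algebraMap K L : K →* L)
@[simp] lemma aK_coe (x : Kˣ) : ((aK K L x : Lˣ) : L) = algebraMap K L x := rfl
lemma aK_inj : Function.Injective (aK K L) := Units.map_injective (algebraMap K L).injective
lemma fixA (h : Quad σ) {x : Lˣ} : x ∈ (dm (sA σ)).ker ↔ ∃ y : Kˣ, aK K L y = x := by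
  rw [mem_fix]
  constructor
  · intro hx
    obtain ⟨y, hy⟩ := h.fix (congrArg Units.val hx)
    have : y ≠ 0 := by rintro rfl; apply x.ne_zero; rw [← hy]; simp
    exact ⟨Units.mk0 y this, by ext; exact hy⟩
  · rintro ⟨y, rfl⟩; ext; simp
lemma units_fix (h : Quad σ) : (dv (K := L)).ker ⊓ (dm (sA σ)).ker = (dv (K := K)).ker.map (aK K L) := by
  ext x
  rw [mem_inf, fixA h]
  constructor
  · rintro ⟨h1, y, rfl⟩
    refine ⟨y, ?_, rfl⟩
    rw [SetLike.mem_coe, dv_ker_mem]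
    intro p
    obtain ⟨P, rfl⟩ := exists_over (L := L) p
    have := dv_ker_mem.1 h1 P
    rw [aK_coe, ord_algebraMap] at this
    have hr := ram_pos (K := K) P
    simpa [hr.ne'] using this
  · rintro ⟨y, hy, rfl⟩
    refine ⟨dv_ker_mem.2 fun P => ?_, y, rfl⟩
    rw [aK_coe, ord_algebraMap, dv_ker_mem.1 hy, mul_zero]
theorem quad_star [IsTotallyReal L] (h : Quad σ) :
    ((nm (sD h)).range ⊔ ((dm (sA σ)).ker).map dv).relIndex (dm (sD h)).ker =
    2 * (nm (sA σ)).range.relIndex ((nm (sD h)).range.comap dv ⊓ (dm (sA σ)).ker) := by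
  have h1 := star (sA σ) (sD h) dv (sA_invol h) (sD_invol h) (sD_dv h) (h90A h) (h90D h) dv_index
  haveI : IsTotallyReal K := IsTotallyReal.of_algebra K L
  have hdeg : Module.finrank ℚ L = 2 * Module.finrank ℚ K := by
    rw [← Module.finrank_mul_finrank ℚ K L, h.deg, mul_comm]
  obtain ⟨h2, h3⟩ := unit_herbrand (sA σ) (sA_invol h) (dv (K := L)).ker
    (fun a ha => by
      rw [MonoidHom.mem_ker] at ha ⊢; rw [sD_dv h, ha, map_one]) (Module.finrank ℚ K) (-1)
    (dv_ker_mem.2 fun P => by simp [ord_neg, ord_one])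
    (by intro h; have := congrArg Units.val h; norm_num at this)
    (by simp) (by ext; simp)
    (fun x hx => by
      have : (x : L) ^ 2 = 1 := by simpa using congrArg Units.val hx
      have : ((x : L) - 1) * (x + 1) = 0 := by linear_combination this
      rcases mul_eq_zero.1 this with h | h
      · left; ext; exact sub_eq_zero.1 h
      · right; ext; exact eq_neg_of_add_eq_zero_left h)
    (by rw [ker_sq_index, hdeg])
    (by
      rw [units_fix h, ← ker_sq_index (K := K), Subgroup.map_map,
        ← relIndex_map_map_of_injective ((dv (K := K)).ker.map (powMonoidHom 2)) _ (aK_inj (K := K) (L := L)), Subgroup.map_map]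
      congr 2
      ext x; simp)
  rw [h2, ← mul_assoc] at h1
  rw [mul_comm 2]
  exact Nat.eq_of_mul_eq_mul_right (Nat.pos_of_ne_zero h3) h1
end
end T10
set_option linter.unusedSectionVars false
namespace T10
section
variable {K L : Type} [Field K] [NumberField K] [Field L] [NumberField L] [Algebra K L]
def Gen (Q : Finset (Pr K)) : Prop :=
  ∀ D : DivM K, ∃ x : Kˣ, ∀ p ∉ Q, Even (ev p D - ord p (x : K))
variable {σ : L ≃ₐ[K] L}
/-- elements of K with even order at fixed primes -/
noncomputable def Yg (h : Quad σ) : Subgroup Lˣ := (nm (sD h)).range.comap dv ⊓ (dm (sA σ)).ker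
lemma mem_Yg (h : Quad σ) (e : Kˣ) :
    aK K L e ∈ Yg h ↔ ∀ P, pact σ P = P → Even (ord P (algebraMap K L e)) := by
  rw [Yg, mem_inf, mem_comap, mem_nmD]
  constructor
  · rintro ⟨⟨-, h1⟩, -⟩ P hP
    exact h1 P hP
  · intro h1
    have h2 : sA σ (aK K L e) = aK K L e := by ext; simp
    exact ⟨⟨by rw [← sD_dv, h2], fun P hP => h1 P hP⟩, (fixA h).2 ⟨e, rfl⟩⟩
theorem quadIdx [IsTotallyReal L] (h : Quad σ) (Q : Finset (Pr K)) (hQ : Gen Q)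
    (F : Finset (Pr L)) (hF : ∀ P, pact σ P = P → P ∉ F → under K P ∉ Q ∧ ram K P = 1) :
    (nm (sA σ)).range.relIndex (Yg h) ≠ 0 ∧ 2 * (nm (sA σ)).range.relIndex (Yg h) ≤ 2 ^ F.card := by
  classical
  have hq := quad_star h
  have key : ∀ z : DivM L, ∃ x : Kˣ, sD h z = z → ∀ P, pact σ P = P → P ∉ F →
      Even (ev P z - ord P (algebraMap K L x)) := by
    intro z
    choose ovr hover using fun p : Pr K => exists_over (L := L) p
    have hoi : Function.Injective ovr := fun a b hab => by rw [← hover a, hab, hover]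
    obtain ⟨x, hx⟩ := hQ (mkD (fun p => ev (ovr p) z) ((ev_finite z).preimage hoi.injOn))
    refine ⟨x, fun hz P hP hPF => ?_⟩
    obtain ⟨h1, h2⟩ := hF P hP hPF
    have h3 := hx _ h1
    rw [ev_mkD] at h3
    have h4 : ovr (under K P) = P := by
      rcases h.over (hover (under K P)).symm with h5 | h5
      · exact h5
      · rw [h5, hP]
    rw [ord_algebraMap, h2]
    rw [h4] at h3
    simpa using h3
  choose x hx using key
  have := relIndex_le_card ((nm (sD h)).range ⊔ ((dm (sA σ)).ker).map dv) (dm (sD h)).ker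
    (fun z => fun P : F => decide (Even (ev P.1 z - ord P.1 (algebraMap K L (x z))))) (by
      intro z hz z' hz' hzz
      rw [fixD] at hz hz'
      have e : z / z' = (z / z') / dv (aK K L (x z / x z')) * dv (aK K L (x z / x z')) := by simp
      rw [e]
      apply mul_mem
      · apply mem_sup_left
        rw [mem_nmD]
        have h2 : sA σ (aK K L (x z / x z')) = aK K L (x z / x z') := by ext; simp
        refine ⟨by rw [map_div, map_div, hz, hz', ← sD_dv, h2], fun P hP => ?_⟩
        have e2 : ev P (z / z' / dv (aK K L (x z / x z'))) =
            (ev P z - ord P (algebraMap K L (x z))) - (ev P z' - ord P (algebraMap K L (x z'))) := by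
          rw [map_div, map_div]; simp only [ev_div, ev_dv, aK_coe]; ring
        rw [e2]
        by_cases hPF : P ∈ F
        · have := congrFun hzz ⟨P, hPF⟩
          simp only [decide_eq_decide] at this
          rw [Int.even_sub]; exact this
        · exact (hx z hz P hP hPF).sub (hx z' hz' P hP hPF)
      · apply mem_sup_right
        exact ⟨_, (fixA h).2 ⟨_, rfl⟩, rfl⟩)
  rw [hq] at this
  refine ⟨fun h0 => this.1 (by rw [Yg] at h0; rw [h0]), ?_⟩
  simpa [Yg] using this.2
end
end T10
open NumberField IsDedekindDomain Filter Topology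
open scoped nonZeroDivisors ENNReal
namespace T10
section
variable {K : Type} [Field K] [NumberField K]
noncomputable def wI (s : ℝ) (I : Ideal (𝓞 K)) : ℝ≥0∞ := ENNReal.ofReal ((Ideal.absNorm I : ℝ) ^ (-s))
lemma wI_mul (s : ℝ) (I J : Ideal (𝓞 K)) : wI s (I * J) = wI s I * wI s J := by
  unfold wI
  rw [map_mul, Nat.cast_mul, Real.mul_rpow (by positivity) (by positivity),
    ENNReal.ofReal_mul (by positivity)]
lemma wI_one (s : ℝ) : wI s (1 : Ideal (𝓞 K)) = 1 := by simp [wI]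
noncomputable def wIh (K : Type) [Field K] [NumberField K] (s : ℝ) : Ideal (𝓞 K) →* ℝ≥0∞ where
  toFun := wI s
  map_one' := wI_one s
  map_mul' := wI_mul s
noncomputable def wt (s : ℝ) (f : Pr K →₀ ℕ) : ℝ≥0∞ := f.prod fun P k => wI s P.asIdeal ^ k
noncomputable def idl (f : Pr K →₀ ℕ) : Ideal (𝓞 K) := f.prod fun P k => P.asIdeal ^ k
lemma wt_idl (s : ℝ) (f : Pr K →₀ ℕ) : wI s (idl f) = wt s f := by
  change wIh K s (idl f) = _
  rw [idl, wt, map_finsuppProd]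
  simp only [map_pow]; rfl
lemma wt_add (s : ℝ) (f g : Pr K →₀ ℕ) : wt s (f + g) = wt s f * wt s g :=
  Finsupp.prod_add_index' (by simp) (by intros; rw [pow_add])
lemma idl_ne (f : Pr K →₀ ℕ) : idl f ≠ ⊥ :=
  Finset.prod_ne_zero_iff.2 fun P _ => pow_ne_zero _ P.ne_bot
lemma idl_inj : Function.Injective (idl (K := K)) := by
  intro f g h
  ext P
  have key : ∀ f : Pr K →₀ ℕ, (f P : ℤ) = FractionalIdeal.count K P (idl f : FractionalIdeal (𝓞 K)⁰ K) := by
    intro f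
    let f' : Pr K →₀ ℤ := f.mapRange (fun n : ℕ => (n : ℤ)) rfl
    have := FractionalIdeal.count_finsuppProd K P f'
    have e : (f'.prod fun v n => (v.asIdeal : FractionalIdeal (𝓞 K)⁰ K) ^ n) = (idl f : FractionalIdeal (𝓞 K)⁰ K) := by
      rw [idl, Finsupp.prod_mapRange_index (by simp)]
      simp only [zpow_natCast]
      have h2 := map_finsuppProd (FractionalIdeal.coeIdealHom (𝓞 K)⁰ K) f (fun P k => P.asIdeal ^ k)
      simp only [map_pow] at h2
      exact h2.symm
    rw [← e, this]; simp [f']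
  have h1 := key f
  rw [h, ← key g] at h1
  exact_mod_cast h1
lemma idl_surj (I : Ideal (𝓞 K)) (hI : I ≠ ⊥) : ∃ f : Pr K →₀ ℕ, idl f = I := by
  classical
  have h := Ideal.finprod_heightOneSpectrum_factorization hI
  have hf := Ideal.hasFiniteMulSupport hI
  refine ⟨Finsupp.ofSupportFinite
    (fun P => (Associates.mk P.asIdeal).count (Associates.mk I).factors) ?_, ?_⟩
  · have := Ideal.finite_factors hI
    refine (Associates.finite_factors hI).subset ?_
    intro P hP
    simpa using hP
  · conv_rhs => rw [← h]
    rw [finprod_eq_prod_of_mulSupport_subset (s := Finsupp.support (Finsupp.ofSupportFinite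
      (fun P => (Associates.mk P.asIdeal).count (Associates.mk I).factors) _))]
    · rfl
    · intro P hP
      simp only [Finsupp.mem_support_iff, Finset.mem_coe]
      intro h0
      apply hP
      change P.asIdeal ^ _ = 1
      rw [show (Associates.mk P.asIdeal).count (Associates.mk I).factors = 0 from h0, pow_zero]
noncomputable def ZE (K : Type) [Field K] [NumberField K] (s : ℝ) : ℝ≥0∞ := ∑' f : Pr K →₀ ℕ, wt s f
lemma ZE_eq (s : ℝ) : ZE K s = ∑' I : {I : Ideal (𝓞 K) // I ≠ ⊥}, wI s I.1 := by
  let e : (Pr K →₀ ℕ) ≃ {I : Ideal (𝓞 K) // I ≠ ⊥} := Equiv.ofBijective (fun f => ⟨idl f, idl_ne f⟩)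
    ⟨fun f g h => idl_inj (congrArg Subtype.val h), fun I => by
      obtain ⟨f, hf⟩ := idl_surj I.1 I.2
      exact ⟨f, Subtype.ext hf⟩⟩
  rw [← e.tsum_eq]
  exact tsum_congr fun f => (wt_idl s f).symm
lemma ZE_sum (s : ℝ) : ZE K s = ∑' n : ℕ, ENNReal.ofReal (if n = 0 then 0 else
    (Nat.card {I : Ideal (𝓞 K) // Ideal.absNorm I = n} : ℝ) * (n : ℝ) ^ (-s)) := by
  rw [ZE_eq]
  let g : {I : Ideal (𝓞 K) // I ≠ ⊥} → ℕ := fun I => Ideal.absNorm I.1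
  rw [← (Equiv.sigmaFiberEquiv g).tsum_eq, ENNReal.tsum_sigma']
  refine tsum_congr fun n => ?_
  by_cases hn : n = 0
  · subst hn
    haveI : IsEmpty {x // g x = 0} := ⟨fun x => x.1.2 (Ideal.absNorm_eq_zero_iff.1 x.2)⟩
    simp
  · rw [if_neg hn]
    have hc : ∀ x : {x // g x = n}, wI s ((Equiv.sigmaFiberEquiv g) ⟨n, x⟩).1 =
        ENNReal.ofReal ((n : ℝ) ^ (-s)) := by
      rintro ⟨x, hx⟩
      change ENNReal.ofReal ((g x : ℝ) ^ (-s)) = _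
      rw [hx]
    simp_rw [hc]
    have hfin : Finite {I : Ideal (𝓞 K) // Ideal.absNorm I = n} :=
      Ideal.finite_setOfPred_absNorm_eq n
    let e : {x // g x = n} ≃ {I : Ideal (𝓞 K) // Ideal.absNorm I = n} :=
      { toFun := fun x => ⟨x.1.1, x.2⟩
        invFun := fun I => ⟨⟨I.1, by
          intro h; apply hn; rw [← I.2, h]; simp⟩, I.2⟩
        left_inv := fun x => rfl
        right_inv := fun x => rfl }
    haveI : Finite {x // g x = n} := Finite.of_equiv _ e.symm
    rw [ENNReal.tsum_const, ENNReal.ofReal_mul (by positivity), ENNReal.ofReal_natCast,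
      ENat.card_eq_coe_natCard, Nat.card_congr e]
    simp
lemma ZE_zeta (s : ℝ) (h : dedekindZeta K s ≠ 0) :
    ZE K s ≠ ⊤ ∧ dedekindZeta K s = (((ZE K s).toReal : ℝ) : ℂ) := by
  set r : ℕ → ℝ := fun n => if n = 0 then 0 else
    (Nat.card {I : Ideal (𝓞 K) // Ideal.absNorm I = n} : ℝ) * (n : ℝ) ^ (-s) with hr
  have hr0 : ∀ n, 0 ≤ r n := by intro n; rw [hr]; dsimp only; split_ifs <;> positivity
  have hterm : ∀ n, LSeries.term (fun n ↦ (Nat.card {I : Ideal (𝓞 K) // Ideal.absNorm I = n} : ℂ)) s n =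
      ((r n : ℝ) : ℂ) := by
    intro n
    rw [LSeries.term_def, hr]
    by_cases hn : n = 0
    · simp [hn]
    · simp only [hn, if_false]
      rw [Complex.ofReal_mul, Complex.ofReal_cpow (by positivity)]
      simp [Complex.cpow_neg, div_eq_mul_inv]
  have hz : dedekindZeta K s = ∑' n, ((r n : ℝ) : ℂ) := by
    rw [dedekindZeta, LSeries]; exact tsum_congr hterm
  have hs : Summable r := by
    by_contra hc
    apply h
    rw [hz]
    exact tsum_eq_zero_of_not_summable (fun h => hc (Complex.summable_ofReal.1 h))
  have hE : ZE K s = ENNReal.ofReal (∑' n, r n) := by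
    rw [ZE_sum, ENNReal.ofReal_tsum_of_nonneg hr0 hs]
  refine ⟨by rw [hE]; exact ENNReal.ofReal_ne_top, ?_⟩
  rw [hE, ENNReal.toReal_ofReal (tsum_nonneg hr0), hz, Complex.ofReal_tsum]
/-- asymptotics near 1 -/
lemma ZE_tendsto : ∃ κ : ℝ, 0 < κ ∧
    Tendsto (fun s : ℝ => (s - 1) * (ZE K s).toReal) (𝓝[>] 1) (𝓝 κ) ∧
    ∀ᶠ s in 𝓝[>] (1 : ℝ), ZE K s ≠ ⊤ := by
  have h := tendsto_sub_one_mul_dedekindZeta_nhdsGT K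
  have hp := dedekindZeta_residue_pos K
  have hne : ∀ᶠ s : ℝ in 𝓝[>] (1 : ℝ), dedekindZeta K s ≠ 0 := by
    have := h.eventually_ne (b₂ := 0) (by exact_mod_cast hp.ne')
    filter_upwards [this] with s hs h0
    exact hs (by rw [h0, mul_zero])
  refine ⟨_, hp, ?_, ?_⟩
  · have h2 : Tendsto (fun s : ℝ => (((s - 1) * (ZE K s).toReal : ℝ) : ℂ)) (𝓝[>] 1)
        (𝓝 ((dedekindZeta_residue K : ℝ) : ℂ)) := by
      refine h.congr' ?_
      filter_upwards [hne] with s hs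
      rw [(ZE_zeta s hs).2]; push_cast; ring
    have := (Complex.continuous_re.tendsto _).comp h2
    simpa [Function.comp_def] using this
  · filter_upwards [hne] with s hs using (ZE_zeta s hs).1
end
section
variable {K : Type} [Field K] [NumberField K]
lemma quad_neg {L : Type} [Field L] [NumberField L] [Algebra K L] {σ : L ≃ₐ[K] L} (h : Quad σ)
    {α : K} (hα : ¬ IsSquare α) {γ : L} (hγ : γ ^ 2 = algebraMap K L α) : σ γ = -γ := by
  have h1 : σ γ ^ 2 = γ ^ 2 := by rw [← map_pow, hγ]; simp
  rcases sq_eq_sq_iff_eq_or_eq_neg.1 h1 with h2 | h2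
  · exfalso
    obtain ⟨y, hy⟩ := h.fix h2
    apply hα
    refine ⟨y, (algebraMap K L).injective ?_⟩
    rw [← hγ, ← hy, map_mul, pow_two]
  · exact h2
open Polynomial in
lemma exists_ext (α : K) (hα : ¬ IsSquare α) : ∃ (L : Type) (_ : Field L) (_ : NumberField L)
    (_ : Algebra K L) (γ : L) (σ : L ≃ₐ[K] L), Quad σ ∧ γ ^ 2 = algebraMap K L α ∧ σ γ = -γ := by
  have hirr : Irreducible (X ^ 2 - C α : K[X]) := by
    refine (X_pow_sub_C_irreducible_iff_of_prime Nat.prime_two).2 ?_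
    intro b hb; exact hα ⟨b, by rw [← hb, pow_two]⟩
  haveI : Fact (Irreducible (X ^ 2 - C α : K[X])) := ⟨hirr⟩
  have hm : (X ^ 2 - C α : K[X]).Monic := monic_X_pow_sub_C α two_ne_zero
  let L := AdjoinRoot (X ^ 2 - C α : K[X])
  haveI : Module.Finite K L := hm.finite_adjoinRoot
  haveI : CharZero L := charZero_of_injective_algebraMap (algebraMap K L).injective
  haveI : NumberField L :=
    { to_charZero := inferInstance
      to_finiteDimensional := Module.Finite.trans K L }
  have hdeg : Module.finrank K L = 2 := by
    have := (AdjoinRoot.powerBasis hm.ne_zero).finrank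
    rw [AdjoinRoot.powerBasis_dim, natDegree_X_pow_sub_C] at this
    exact this
  have hγ : (AdjoinRoot.root (X ^ 2 - C α : K[X])) ^ 2 = algebraMap K L α := by
    have := AdjoinRoot.eval₂_root (X ^ 2 - C α : K[X])
    simp only [eval₂_sub, eval₂_pow, eval₂_X, eval₂_C] at this
    exact sub_eq_zero.1 this
  obtain ⟨σ, hσ⟩ := exists_quad hdeg
  exact ⟨L, inferInstance, inferInstance, inferInstance, _, σ, hσ, hγ, quad_neg hσ hα hγ⟩
/-- weights -/
lemma wI_prime_le (s : ℝ) (hs : 1 ≤ s) (P : Pr K) : wI s P.asIdeal ≤ 2⁻¹ := by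
  have h2 : 2 ≤ Ideal.absNorm P.asIdeal := by
    have h0 : Ideal.absNorm P.asIdeal ≠ 0 := by
      rw [Ne, Ideal.absNorm_eq_zero_iff]; exact P.ne_bot
    have h1 : Ideal.absNorm P.asIdeal ≠ 1 := by
      rw [Ne, Ideal.absNorm_eq_one_iff]; exact P.isPrime.ne_top
    omega
  have h2' : (2 : ℝ) ≤ Ideal.absNorm P.asIdeal := by exact_mod_cast h2
  rw [wI]
  have : ((Ideal.absNorm P.asIdeal : ℝ)) ^ (-s) ≤ (2 : ℝ)⁻¹ := by
    rw [Real.rpow_neg (by positivity)]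
    apply inv_anti₀ (by norm_num)
    calc (2 : ℝ) ≤ Ideal.absNorm P.asIdeal := h2'
      _ = (Ideal.absNorm P.asIdeal : ℝ) ^ (1 : ℝ) := by simp
      _ ≤ _ := Real.rpow_le_rpow_of_exponent_le (by linarith) hs
  calc ENNReal.ofReal _ ≤ ENNReal.ofReal (2 : ℝ)⁻¹ := ENNReal.ofReal_le_ofReal this
    _ = 2⁻¹ := by rw [ENNReal.ofReal_inv_of_pos (by norm_num)]; simp
lemma wI_anti (s : ℝ) (hs : 0 ≤ s) {L : Type} [Field L] [NumberField L] {I : Ideal (𝓞 K)} {J : Ideal (𝓞 L)}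
    (hJ : J ≠ ⊥) (h : Ideal.absNorm J ≤ Ideal.absNorm I) : wI s I ≤ wI s J := by
  apply ENNReal.ofReal_le_ofReal
  have h0 : 0 < Ideal.absNorm J := Nat.pos_of_ne_zero (by rwa [Ne, Ideal.absNorm_eq_zero_iff])
  exact Real.rpow_le_rpow_of_nonpos (by exact_mod_cast h0) (by exact_mod_cast h) (by linarith)
/-- sum over ideals prime to S -/
noncomputable def ZS (S : Finset (Pr K)) (s : ℝ) : ℝ≥0∞ :=
  ∑' f : {f : Pr K →₀ ℕ // ∀ P ∈ S, f P = 0}, wt s f.1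
lemma ZS_step [DecidableEq (Pr K)] (S : Finset (Pr K)) (P : Pr K) (hP : P ∉ S) (s : ℝ) (hs : 1 ≤ s) (hfin : ZS S s ≠ ⊤) :
    ZS S s ≤ 2 * ZS (insert P S) s := by
  set X := ZS S s with hX
  have key : X ≤ ZS (insert P S) s + 2⁻¹ * X := by
    classical
    let A := {f : Pr K →₀ ℕ // ∀ P ∈ S, f P = 0}
    let φ : {f : Pr K →₀ ℕ // ∀ Q ∈ insert P S, f Q = 0} ⊕ A → A := fun x => match x with
      | .inl f => ⟨f.1, fun Q hQ => f.2 Q (Finset.mem_insert_of_mem hQ)⟩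
      | .inr f => ⟨f.1 + Finsupp.single P 1, fun Q hQ => by
          have : Q ≠ P := by rintro rfl; exact hP hQ
          simp [f.2 Q hQ, Finsupp.single_apply, this.symm]⟩
    have hφ : Function.Surjective φ := by
      intro f
      by_cases h : f.1 P = 0
      · refine ⟨.inl ⟨f.1, ?_⟩, rfl⟩
        intro Q hQ
        rcases Finset.mem_insert.1 hQ with rfl | hQ
        · exact h
        · exact f.2 Q hQ
      · refine ⟨.inr ⟨f.1 - Finsupp.single P 1, fun Q hQ => by simp [f.2 Q hQ]⟩, ?_⟩
        apply Subtype.ext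
        change f.1 - Finsupp.single P 1 + Finsupp.single P 1 = f.1
        apply tsub_add_cancel_of_le
        rw [Finsupp.single_le_iff]; omega
    calc X ≤ ∑' x, wt s (φ x).1 := ENNReal.tsum_le_tsum_comp_of_surjective hφ (fun f => wt s f.1)
      _ = ZS (insert P S) s + ∑' f : A, wt s (f.1 + Finsupp.single P 1) := by
          exact Summable.tsum_sum (f := fun x => wt s (φ x).1) ENNReal.summable ENNReal.summable
      _ ≤ ZS (insert P S) s + 2⁻¹ * X := by
          gcongr
          rw [hX, ZS, ← ENNReal.tsum_mul_left]
          refine ENNReal.tsum_le_tsum fun f => ?_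
          rw [wt_add, mul_comm]
          gcongr
          rw [wt, Finsupp.prod_single_index (by simp), pow_one]
          exact wI_prime_le s hs P
  by_cases hB : ZS (insert P S) s = ⊤
  · rw [hB]; simp
  have hB' : 2⁻¹ * X ≠ ⊤ := ENNReal.mul_ne_top (by simp) hfin
  have h3 := ENNReal.toReal_mono (ENNReal.add_ne_top.2 ⟨hB, hB'⟩) key
  rw [ENNReal.toReal_add hB hB', ENNReal.toReal_mul] at h3
  rw [← ENNReal.toReal_le_toReal hfin (ENNReal.mul_ne_top (by simp) hB), ENNReal.toReal_mul]
  simp at h3 ⊢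
  linarith
lemma ZS_le (S : Finset (Pr K)) (s : ℝ) : ZS S s ≤ ZE K s :=
  ENNReal.tsum_comp_le_tsum_of_injective Subtype.val_injective _
lemma ZE_le_ZS (S : Finset (Pr K)) (s : ℝ) (hs : 1 ≤ s) (hfin : ZE K s ≠ ⊤) :
    ZE K s ≤ 2 ^ S.card * ZS S s := by
  classical
  induction S using Finset.induction_on with
  | empty =>
    simp only [Finset.card_empty, pow_zero, one_mul]
    rw [ZE, ZS]
    exact ENNReal.tsum_le_tsum_comp_of_surjective
      (f := fun f : {f : Pr K →₀ ℕ // ∀ P ∈ (∅ : Finset (Pr K)), f P = 0} => f.1)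
      (fun f => ⟨⟨f, by simp⟩, rfl⟩) (wt s)
  | insert P S hP ih =>
    rw [Finset.card_insert_of_notMem hP, pow_succ, mul_assoc]
    refine ih.trans ?_
    gcongr
    exact ZS_step S P hP s hs (ne_top_of_le_ne_top hfin (ZS_le S s))
/-- splitting inequality -/
lemma split_ineq {L : Type} [Field L] [NumberField L] [Algebra K L] (S : Finset (Pr K))
    (p₁ p₂ : Pr K → Pr L) (h1 : ∀ P, under K (p₁ P) = P) (h2 : ∀ P, under K (p₂ P) = P)
    (hne : ∀ P ∉ S, p₁ P ≠ p₂ P)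
    (hn1 : ∀ P ∉ S, Ideal.absNorm (p₁ P).asIdeal ≤ Ideal.absNorm P.asIdeal)
    (hn2 : ∀ P ∉ S, Ideal.absNorm (p₂ P).asIdeal ≤ Ideal.absNorm P.asIdeal) (s : ℝ) (hs : 0 ≤ s) :
    ZS S s * ZS S s ≤ ZE L s := by
  classical
  have i1 : Function.Injective p₁ := fun a b h => by rw [← h1 a, h, h1]
  have i2 : Function.Injective p₂ := fun a b h => by rw [← h2 a, h, h2]
  let A := {f : Pr K →₀ ℕ // ∀ P ∈ S, f P = 0}
  let φ : A × A → (Pr L →₀ ℕ) := fun x => x.1.1.mapDomain p₁ + x.2.1.mapDomain p₂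
  have hφ1 : ∀ x P, P ∉ S → φ x (p₁ P) = x.1.1 P := by
    intro x P hP
    simp only [φ, Finsupp.add_apply]
    rw [Finsupp.mapDomain_apply i1, Finsupp.mapDomain_of_notMem_range, add_zero]
    rintro ⟨Q, hQ⟩
    have : Q = P := by rw [← h2 Q, hQ, h1]
    subst this; exact hne Q hP hQ.symm
  have hφ2 : ∀ x P, P ∉ S → φ x (p₂ P) = x.2.1 P := by
    intro x P hP
    simp only [φ, Finsupp.add_apply]
    rw [Finsupp.mapDomain_apply i2, Finsupp.mapDomain_of_notMem_range, zero_add]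
    rintro ⟨Q, hQ⟩
    have : Q = P := by rw [← h1 Q, hQ, h2]
    subst this; exact hne Q hP hQ
  have hφ : Function.Injective φ := by
    intro x y hxy
    refine Prod.ext (Subtype.ext (Finsupp.ext fun P => ?_)) (Subtype.ext (Finsupp.ext fun P => ?_))
    · by_cases hP : P ∈ S
      · rw [x.1.2 P hP, y.1.2 P hP]
      · rw [← hφ1 x P hP, hxy, hφ1 y P hP]
    · by_cases hP : P ∈ S
      · rw [x.2.2 P hP, y.2.2 P hP]
      · rw [← hφ2 x P hP, hxy, hφ2 y P hP]
  have hw : ∀ (p : Pr K → Pr L), Function.Injective p →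
      (∀ P ∉ S, Ideal.absNorm (p P).asIdeal ≤ Ideal.absNorm P.asIdeal) → ∀ f : A,
      wt s f.1 ≤ wt s (f.1.mapDomain p) := by
    intro p hp hn f
    rw [wt, wt, Finsupp.prod_mapDomain_index_inj hp]
    refine Finset.prod_le_prod' fun P hP => ?_
    have hPS : P ∉ S := fun h => (Finsupp.mem_support_iff.1 hP) (f.2 P h)
    exact pow_le_pow_left' (wI_anti s hs (p P).ne_bot (hn P hPS)) _
  calc ZS S s * ZS S s = ∑' x : A × A, wt s x.1.1 * wt s x.2.1 := by
        rw [ENNReal.tsum_prod (f := fun a b : A => wt s a.1 * wt s b.1)]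
        simp_rw [ENNReal.tsum_mul_left, ENNReal.tsum_mul_right]
        rfl
    _ ≤ ∑' x : A × A, wt s (φ x) := by
        refine ENNReal.tsum_le_tsum fun x => ?_
        rw [wt_add]
        exact mul_le_mul' (hw p₁ i1 hn1 x.1) (hw p₂ i2 hn2 x.2)
    _ ≤ ZE L s := ENNReal.tsum_comp_le_tsum_of_injective hφ (wt s)
lemma not_all_split {L : Type} [Field L] [NumberField L] [Algebra K L] (S : Finset (Pr K))
    (p₁ p₂ : Pr K → Pr L) (h1 : ∀ P, under K (p₁ P) = P) (h2 : ∀ P, under K (p₂ P) = P)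
    (hne : ∀ P ∉ S, p₁ P ≠ p₂ P)
    (hn1 : ∀ P ∉ S, Ideal.absNorm (p₁ P).asIdeal ≤ Ideal.absNorm P.asIdeal)
    (hn2 : ∀ P ∉ S, Ideal.absNorm (p₂ P).asIdeal ≤ Ideal.absNorm P.asIdeal) : False := by
  obtain ⟨κ, hκ, hT, hfin⟩ := ZE_tendsto (K := K)
  obtain ⟨κ', hκ', hT', hfin'⟩ := ZE_tendsto (K := L)
  set C : ℝ := 2 ^ S.card
  have hineq : ∀ᶠ s : ℝ in 𝓝[>] (1 : ℝ), ((s - 1) * (ZE K s).toReal) ^ 2 ≤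
      C ^ 2 * ((s - 1) * ((s - 1) * (ZE L s).toReal)) := by
    filter_upwards [hfin, hfin', self_mem_nhdsWithin] with s hs hs' h1s
    have h1s' : (1 : ℝ) ≤ s := le_of_lt h1s
    have e1 := ZE_le_ZS S s h1s' hs
    have e2 := split_ineq S p₁ p₂ h1 h2 hne hn1 hn2 s (by linarith)
    have e3 : ZE K s * ZE K s ≤ (2 ^ S.card) ^ 2 * ZE L s := by
      calc _ ≤ (2 ^ S.card * ZS S s) * (2 ^ S.card * ZS S s) := mul_le_mul' e1 e1
        _ = (2 ^ S.card) ^ 2 * (ZS S s * ZS S s) := by ring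
        _ ≤ _ := by gcongr
    have e4 := ENNReal.toReal_mono (ENNReal.mul_ne_top (by simp) hs') e3
    rw [ENNReal.toReal_mul, ENNReal.toReal_mul] at e4
    simp only [ENNReal.toReal_pow, ENNReal.toReal_ofNat] at e4
    have : 0 ≤ (s - 1) ^ 2 := by positivity
    nlinarith [mul_le_mul_of_nonneg_left e4 this]
  have hl : Tendsto (fun s : ℝ => ((s - 1) * (ZE K s).toReal) ^ 2) (𝓝[>] 1) (𝓝 (κ ^ 2)) := hT.pow 2
  have h0 : Tendsto (fun s : ℝ => s - 1) (𝓝[>] 1) (𝓝 0) := by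
    have : Tendsto (fun s : ℝ => s - 1) (𝓝 1) (𝓝 (1 - 1)) := (continuous_id.sub continuous_const).tendsto 1
    rw [sub_self] at this
    exact this.mono_left nhdsWithin_le_nhds
  have hr : Tendsto (fun s : ℝ => C ^ 2 * ((s - 1) * ((s - 1) * (ZE L s).toReal))) (𝓝[>] 1) (𝓝 (C ^ 2 * (0 * κ'))) :=
    (h0.mul hT').const_mul _
  have := le_of_tendsto_of_tendsto hl hr hineq
  simp at this
  nlinarith [sq_pos_of_pos hκ]
end
section
variable {K : Type} [Field K] [NumberField K]
/-- locally a square at `t` (unit part a square modulo t) -/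
def SS (t : Pr K) : Subgroup Kˣ where
  carrier := {α | ∃ x : Kˣ, ∃ w ∈ t.asIdeal, (α : K) * (x : K) ^ 2 = 1 + (w : K)}
  one_mem' := ⟨1, 0, t.asIdeal.zero_mem, by simp⟩
  mul_mem' := by
    rintro a b ⟨x, w, hw, h⟩ ⟨y, z, hz, h'⟩
    refine ⟨x * y, w + z + w * z, ?_, ?_⟩
    · exact Ideal.add_mem _ (Ideal.add_mem _ hw hz) (Ideal.mul_mem_left _ _ hz)
    · have : ((a * b : Kˣ) : K) * ((x * y : Kˣ) : K) ^ 2 = ((a : K) * (x : K) ^ 2) * ((b : K) * (y : K) ^ 2) := by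
        push_cast; ring
      rw [this, h, h']
      change _ = (1 : K) + ((w : K) + (z : K) + (w : K) * (z : K))
      ring
  inv_mem' := by
    rintro a ⟨x, w, hw, h⟩
    refine ⟨a * x, w, hw, ?_⟩
    rw [← h]; push_cast; field_simp
lemma sq_mem_SS (t : Pr K) (x : Kˣ) : x ^ 2 ∈ SS t :=
  ⟨x⁻¹, 0, t.asIdeal.zero_mem, by push_cast; field_simp; simp⟩
variable {L : Type} [Field L] [NumberField L] [Algebra K L] {σ : L ≃ₐ[K] L}
lemma mem_pact (σ : L ≃ₐ[K] L) (P : Pr L) {x y : 𝓞 L} (hxy : (y : L) = σ x) (hx : x ∈ P.asIdeal) :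
    y ∈ (pact σ P).asIdeal := by
  rw [pact, gact_asIdeal]
  have : y = RingOfIntegers.mapRingEquiv σ.toRingEquiv x := RingOfIntegers.ext hxy
  rw [this]
  exact Ideal.mem_map_of_mem _ hx
lemma two_mem_under (P : Pr L) : (2 : 𝓞 K) ∈ (under K P).asIdeal ↔ (2 : 𝓞 L) ∈ P.asIdeal := by
  rw [mem_under, map_ofNat]
lemma SS_not_fixed (h : Quad σ) {α : Kˣ} {γ : L} (hγ : γ ^ 2 = algebraMap K L α) (hs : σ γ = -γ)
    (P : Pr L) (hα : α ∈ SS (under K P)) (h2 : (2 : 𝓞 K) ∉ (under K P).asIdeal) : pact σ P ≠ P := by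
  intro hfix
  obtain ⟨x, w, hw, he⟩ := hα
  rw [two_mem_under] at h2
  have e1 : (algebraMap K L x * γ) ^ 2 = 1 + algebraMap K L (w : K) := by
    rw [mul_pow, hγ, ← map_pow, ← map_mul, mul_comm, he, map_add, map_one]
  have hint : IsIntegral ℤ (algebraMap K L x * γ) := by
    apply IsIntegral.of_pow (n := 2) two_pos
    rw [e1]
    exact isIntegral_one.add ((RingOfIntegers.isIntegral_coe w).algebraMap)
  let δ : 𝓞 L := ⟨_, hint⟩
  have hδ : (δ : L) = algebraMap K L x * γ := rfl
  have hp : (δ - 1) * (δ + 1) = algebraMap (𝓞 K) (𝓞 L) w := by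
    apply RingOfIntegers.ext
    change ((δ : L) - 1) * ((δ : L) + 1) = algebraMap K L (w : K)
    rw [hδ]; linear_combination e1
  have hm : (δ - 1) * (δ + 1) ∈ P.asIdeal := by rw [hp]; exact hw
  have hsd : σ (δ : L) = -(δ : L) := by rw [hδ, map_mul, hs]; simp
  rcases P.isPrime.mem_or_mem hm with h1 | h1
  · have h3 : (-δ - 1) ∈ P.asIdeal := by
      suffices hh : _ ∈ (pact σ P).asIdeal by rw [hfix] at hh; exact hh
      refine mem_pact σ P (x := δ - 1) ?_ h1
      change -(δ : L) - 1 = σ ((δ : L) - 1)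
      rw [map_sub, hsd, map_one]
    apply h2
    have := P.asIdeal.neg_mem (P.asIdeal.add_mem h1 h3)
    ring_nf at this; exact this
  · have h3 : (-δ + 1) ∈ P.asIdeal := by
      suffices hh : _ ∈ (pact σ P).asIdeal by rw [hfix] at hh; exact hh
      refine mem_pact σ P (x := δ + 1) ?_ h1
      change -(δ : L) + 1 = σ ((δ : L) + 1)
      rw [map_add, hsd, map_one]
    apply h2
    have := (P.asIdeal.add_mem h1 h3)
    ring_nf at this; exact this
lemma absNorm_pact (σ : L ≃ₐ[K] L) (P : Pr L) : Ideal.absNorm (pact σ P).asIdeal = Ideal.absNorm P.asIdeal := by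
  rw [pact, gact_asIdeal, Ideal.absNorm_apply, Ideal.absNorm_apply, Submodule.cardQuot_apply, Submodule.cardQuot_apply]
  exact (Nat.card_congr (Ideal.quotientEquiv P.asIdeal _ (RingOfIntegers.mapRingEquiv σ.toRingEquiv) rfl).toEquiv).symm
lemma norm_split (h : Quad σ) (P : Pr L) (hP : pact σ P ≠ P) :
    Ideal.absNorm P.asIdeal ≤ Ideal.absNorm (under K P).asIdeal := by
  have hle : (under K P).asIdeal.map (algebraMap (𝓞 K) (𝓞 L)) ≤ (pact σ P).asIdeal * P.asIdeal := by
    have hcop : IsCoprime (pact σ P).asIdeal P.asIdeal := by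
      haveI := (pact σ P).isMaximal
      haveI := P.isMaximal
      rw [Ideal.isCoprime_iff_sup_eq]
      exact Ideal.IsMaximal.coprime_of_ne inferInstance inferInstance (fun e => hP (HeightOneSpectrum.ext e))
    rw [Ideal.mul_eq_inf_of_isCoprime hcop]
    refine le_inf ?_ ?_
    · rw [Ideal.map_le_iff_le_comap, ← under_pact σ P]; exact le_rfl
    · rw [Ideal.map_le_iff_le_comap]; exact le_rfl
  have h1 := Ideal.absNorm_dvd_absNorm_of_le hle
  rw [map_mul, absNorm_pact, Ideal.absNorm_algebraMap, ← pow_two] at h1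
  have hf : Module.finrank (𝓞 K) (𝓞 L) = 2 := by
    rw [← h.deg]; exact (IsFractionRing.finrank_eq (𝓞 K) K (𝓞 L) L).symm
  rw [hf] at h1
  have h0 : Ideal.absNorm (under K P).asIdeal ≠ 0 := by
    rw [Ne, Ideal.absNorm_eq_zero_iff]; exact (under K P).ne_bot
  have := Nat.le_of_dvd (by positivity) h1
  exact (Nat.pow_le_pow_iff_left two_ne_zero).1 this
theorem inert (α : Kˣ) (hα : ¬ IsSquare (α : K)) (S : Set (Pr K)) (hS : S.Finite) :
    ∃ P ∉ S, (2 : 𝓞 K) ∉ P.asIdeal ∧ α ∉ SS P := by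
  by_contra hcon
  push Not at hcon
  obtain ⟨L, _, _, _, γ, σ, h, hγ, hs⟩ := exists_ext (α : K) hα
  have hS2 := hS.union (finite_over (K := K) (x := 2) two_ne_zero)
  choose p hp using fun P : Pr K => exists_over (L := L) P
  have key : ∀ P ∉ hS2.toFinset, pact σ (p P) ≠ p P := by
    intro P hP
    simp only [Set.Finite.mem_toFinset, Set.mem_union, not_or] at hP
    refine SS_not_fixed h hγ hs (p P) ?_ ?_
    · rw [hp]; exact hcon P hP.1 hP.2
    · rw [hp]; exact hP.2
  refine not_all_split hS2.toFinset p (fun P => pact σ (p P)) hp (fun P => by rw [under_pact, hp])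
    (fun P hP => (key P hP).symm) (fun P hP => ?_) (fun P hP => ?_)
  · have := norm_split h _ (key P hP)
    rwa [hp] at this
  · have := norm_split h _ (key P hP)
    rw [hp] at this
    rw [absNorm_pact]; exact this
end
section
variable {K : Type} [Field K] [NumberField K]
lemma SS_of_res (t : Pr K) {α x : Kˣ} {u r : 𝓞 K} (h : (α : K) * (x : K) ^ 2 = u) (hu : u ∉ t.asIdeal)
    (hr : u - r ^ 2 ∈ t.asIdeal) : α ∈ SS t := by
  have hr' : r ∉ t.asIdeal := fun h' => hu (by
    have := t.asIdeal.add_mem hr (t.asIdeal.mul_mem_left r h')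
    rwa [show u - r ^ 2 + r * r = u by ring] at this)
  haveI := t.isMaximal
  obtain ⟨f, hf⟩ := Ideal.IsMaximal.exists_inv (I := t.asIdeal) inferInstance hr'
  obtain ⟨m, hm, hfm⟩ := hf
  have hf0 : f ≠ 0 := by
    rintro rfl
    apply t.isPrime.ne_top
    rw [Ideal.eq_top_iff_one, ← hfm]; simpa using hm
  have hfK : (f : K) ≠ 0 := RingOfIntegers.coe_ne_zero_iff.2 hf0
  refine ⟨x * Units.mk0 _ hfK, u * f ^ 2 - 1, ?_, ?_⟩
  · have e : u * f ^ 2 - 1 = (u - r ^ 2) * f ^ 2 + m * (m - 2) := by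
      have : f * r = 1 - m := by rw [← hfm]; ring
      linear_combination (f * r + (1 - m)) * this
    rw [e]
    exact t.asIdeal.add_mem (t.asIdeal.mul_mem_right _ hr) (t.asIdeal.mul_mem_right _ hm)
  · change (α : K) * ((x : K) * (f : K)) ^ 2 = 1 + ((u : K) * (f : K) ^ 2 - 1)
    rw [mul_pow, ← mul_assoc, h]; ring
lemma SS_of_local (t : Pr K) {α x : Kˣ} {w : K} (h : (α : K) * (x : K) ^ 2 = 1 + w)
    (hw : w = 0 ∨ 0 < ord t w) : α ∈ SS t := by
  obtain ⟨n, d, hd, hn⟩ := exists_frac t (x := w) (by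
    rcases hw with rfl | hw
    · simp [ord]
    · exact hw.le)
  have hd0 : d ≠ 0 := by rintro rfl; exact hd t.asIdeal.zero_mem
  have hdK : (d : K) ≠ 0 := RingOfIntegers.coe_ne_zero_iff.2 hd0
  have hnt : n ∈ t.asIdeal := by
    rcases hw with rfl | hw
    · have : n = 0 := RingOfIntegers.ext (by rw [← hn]; simp)
      rw [this]; exact t.asIdeal.zero_mem
    · by_cases hn0 : n = 0
      · rw [hn0]; exact t.asIdeal.zero_mem
      · rw [← ord_int_pos t hn0, ← hn, ord_mul t (by rintro rfl; simp [ord] at hw) hdK, ord_int_zero t hd]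
        simpa using hw
  refine SS_of_res t (x := x * Units.mk0 _ hdK) (u := d ^ 2 + n * d) (r := d) ?_ ?_ ?_
  · change (α : K) * ((x : K) * (d : K)) ^ 2 = (d : K) ^ 2 + (n : K) * (d : K)
    rw [mul_pow, ← mul_assoc, h, ← hn]; ring
  · intro h'
    have := t.asIdeal.sub_mem h' (t.asIdeal.mul_mem_right d hnt)
    rw [add_sub_cancel_right] at this
    exact hd (t.isPrime.mem_of_pow_mem _ this)
  · rw [add_sub_cancel_left]; exact t.asIdeal.mul_mem_right _ hnt
lemma unit_rep (t : Pr K) (α : Kˣ) (h : Even (ord t (α : K))) :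
    ∃ x : Kˣ, ∃ u : 𝓞 K, u ∉ t.asIdeal ∧ (α : K) * (x : K) ^ 2 = u := by
  obtain ⟨m, hm⟩ := h
  obtain ⟨π, hπ, h1⟩ := exists_unif t
  have hz : ord t (π ^ (-m)) = -m := by
    rcases Int.eq_nat_or_neg m with ⟨k, rfl | rfl⟩
    · rw [zpow_neg, ord_inv, zpow_natCast, ord_pow, h1]; simp
    · rw [neg_neg, zpow_natCast, ord_pow, h1]; simp
  have hz0 : π ^ (-m) ≠ 0 := zpow_ne_zero _ hπ
  have hu : ord t ((α : K) * (π ^ (-m)) ^ 2) = 0 := by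
    rw [ord_mul t α.ne_zero (pow_ne_zero _ hz0), ord_pow, hz, hm]; push_cast; ring
  obtain ⟨n, d, hd, hn⟩ := exists_frac t (le_of_eq hu.symm)
  have hd0 : d ≠ 0 := by rintro rfl; exact hd t.asIdeal.zero_mem
  have hdK : (d : K) ≠ 0 := RingOfIntegers.coe_ne_zero_iff.2 hd0
  have hp0 := mul_ne_zero α.ne_zero (pow_ne_zero 2 hz0)
  have hn0 : n ≠ 0 := by
    rintro rfl
    have : (α : K) * (π ^ (-m)) ^ 2 * d = 0 := by rw [hn]; simp
    exact mul_ne_zero hp0 hdK this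
  have hnt : n ∉ t.asIdeal := by
    rw [← ord_int_pos t hn0, ← hn, ord_mul t hp0 hdK, hu, ord_int_zero t hd]; simp
  refine ⟨Units.mk0 _ hz0 * Units.mk0 _ hdK, n * d, ?_, ?_⟩
  · intro h; rcases t.isPrime.mem_or_mem h with h | h
    · exact hnt h
    · exact hd h
  · change (α : K) * (π ^ (-m) * (d : K)) ^ 2 = (n : K) * (d : K)
    rw [← hn]; ring
lemma SS_mul (t : Pr K) {α β : Kˣ} (hα : Even (ord t (α : K))) (hβ : Even (ord t (β : K)))
    (h1 : α ∉ SS t) (h2 : β ∉ SS t) : α * β ∈ SS t := by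
  obtain ⟨x, u, hu, hx⟩ := unit_rep t α hα
  obtain ⟨y, v, hv, hy⟩ := unit_rep t β hβ
  haveI := t.isMaximal
  letI : Field (𝓞 K ⧸ t.asIdeal) := Ideal.Quotient.field _
  haveI : Finite (𝓞 K ⧸ t.asIdeal) := Ideal.finiteQuotientOfFreeOfNeBot _ t.ne_bot
  letI : Fintype (𝓞 K ⧸ t.asIdeal) := Fintype.ofFinite _
  classical
  have key : ∀ {α x : Kˣ} {u : 𝓞 K}, (α : K) * (x : K) ^ 2 = u → u ∉ t.asIdeal →
      IsSquare (Ideal.Quotient.mk t.asIdeal u) → α ∈ SS t := by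
    intro α x u h hu ⟨r, hr⟩
    obtain ⟨r, rfl⟩ := Ideal.Quotient.mk_surjective r
    refine SS_of_res t h hu (r := r) ?_
    rw [← Ideal.Quotient.eq_zero_iff_mem, map_sub, hr, map_pow]; ring
  have n0 : ∀ {u : 𝓞 K}, u ∉ t.asIdeal → Ideal.Quotient.mk t.asIdeal u ≠ 0 := by
    intro u hu h; exact hu (Ideal.Quotient.eq_zero_iff_mem.1 h)
  have nu : ¬ IsSquare (Ideal.Quotient.mk t.asIdeal u) := fun h => h1 (key hx hu h)
  have nv : ¬ IsSquare (Ideal.Quotient.mk t.asIdeal v) := fun h => h2 (key hy hv h)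
  have hc : ringChar (𝓞 K ⧸ t.asIdeal) ≠ 2 := fun hc => nu (FiniteField.isSquare_of_char_two hc _)
  have huv : u * v ∉ t.asIdeal := by
    intro h; rcases t.isPrime.mem_or_mem h with h | h
    · exact hu h
    · exact hv h
  refine key (x := x * y) (u := u * v) ?_ huv ?_
  · change (α : K) * (β : K) * ((x : K) * (y : K)) ^ 2 = (u : K) * (v : K)
    rw [← hx, ← hy]; ring
  · rw [← quadraticChar_one_iff_isSquare (n0 huv), map_mul, map_mul,
      (quadraticChar_neg_one_iff_not_isSquare).2 nu, (quadraticChar_neg_one_iff_not_isSquare).2 nv]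
    norm_num
variable {L : Type} [Field L] [NumberField L] [Algebra K L] {σ : L ≃ₐ[K] L}
lemma SS_up (P : Pr L) {α : Kˣ} (h : α ∈ SS (under K P)) : aK K L α ∈ SS P := by
  obtain ⟨x, w, hw, e⟩ := h
  refine ⟨aK K L x, algebraMap (𝓞 K) (𝓞 L) w, hw, ?_⟩
  rw [aK_coe, aK_coe, ← map_pow, ← map_mul, e, map_add, map_one]
  rfl
/-- simultaneous local squares -/
def SI (T : Finset (Pr K)) : Subgroup Kˣ := ⨅ t ∈ T, SS t
lemma mem_SI {T : Finset (Pr K)} {a : Kˣ} : a ∈ SI T ↔ ∀ t ∈ T, a ∈ SS t := by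
  simp [SI, Subgroup.mem_iInf]
lemma SI_index (T : Finset (Pr K)) (A : Subgroup Kˣ) (hA : ∀ a ∈ A, ∀ t ∈ T, Even (ord t (a : K))) :
    (SI T).relIndex A ≠ 0 ∧ (SI T).relIndex A ≤ 2 ^ T.card := by
  classical
  have := relIndex_le_card (SI T) A (α := T → Bool) (fun a t => decide (a ∈ SS t.1)) ?_
  · simpa using this
  · intro x hx y hy hxy
    rw [mem_SI]
    intro t ht
    have h1 := congrFun hxy ⟨t, ht⟩
    simp only [decide_eq_decide] at h1
    by_cases h2 : x ∈ SS t
    · exact div_mem h2 (h1.1 h2)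
    · have h3 : y ∉ SS t := fun h => h2 (h1.2 h)
      have h4 := SS_mul t (hA x hx t ht) (hA y hy t ht) h2 h3
      have h5 : x / y = x * y * (y⁻¹) ^ 2 := by
        rw [div_eq_mul_inv, pow_two, mul_assoc, mul_inv_cancel_left]
      rw [h5]
      exact mul_mem h4 (sq_mem_SS t _)
end
lemma idx_sq {G : Type*} [CommGroup G] (s : G →* G) (hs : Function.Injective s) (P : Subgroup G)
    (hP : P.index ≠ 0) (hsP : P.map s ≤ P) :
    (P.map s).relIndex (s.range ⊓ P) = (s.range ⊔ P).index := by
  have h1 : (P.map s).relIndex s.range = P.index := by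
    rw [MonoidHom.range_eq_map, relIndex_map_map_of_injective _ _ hs, relIndex_top_right]
  have h2 := relIndex_mul_relIndex (P.map s) (s.range ⊓ P) s.range
    (le_inf (map_le_range s P) hsP) inf_le_left
  rw [h1, inf_comm, inf_relIndex_right] at h2
  have h3 := relIndex_mul_index (H := P) (K := s.range ⊔ P) le_sup_right
  rw [relIndex_sup_right] at h3
  rw [inf_comm]
  have h4 : P.relIndex s.range ≠ 0 := fun h => hP (by rw [← h2, h, mul_zero])
  apply Nat.eq_of_mul_eq_mul_right (Nat.pos_of_ne_zero h4)
  rw [h2, mul_comm, h3]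
section
variable {K : Type} [Field K] [NumberField K]
/-- divisors even off T -/
def RT (T : Finset (Pr K)) : Subgroup (DivM K) where
  carrier := {D | ∀ p ∉ T, Even (ev p D)}
  one_mem' := fun p _ => by simp
  mul_mem' := fun ha hb p hp => by rw [ev_mul]; exact (ha p hp).add (hb p hp)
  inv_mem' := fun ha p hp => by rw [ev_inv]; exact (ha p hp).neg
lemma mem_RT {T : Finset (Pr K)} {D : DivM K} : D ∈ RT T ↔ ∀ p ∉ T, Even (ev p D) := Iff.rfl
lemma RT_mono {T T' : Finset (Pr K)} (h : T ⊆ T') : RT T ≤ RT T' := fun _ hD p hp => hD p (fun h' => hp (h h'))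
noncomputable def VT (T : Finset (Pr K)) : Subgroup Kˣ := (RT T).comap dv
lemma mem_VT {T : Finset (Pr K)} {a : Kˣ} : a ∈ VT T ↔ ∀ p ∉ T, Even (ord p (a : K)) := Iff.rfl
lemma VT_mono {T T' : Finset (Pr K)} (h : T ⊆ T') : VT T ≤ VT T' := comap_mono (RT_mono h)
def Sqr (K : Type) [Field K] : Subgroup Kˣ := (powMonoidHom 2 : Kˣ →* Kˣ).range
lemma mem_Sqr {a : Kˣ} : a ∈ Sqr K ↔ ∃ x, x ^ 2 = a := Iff.rfl
lemma mem_Sqr' {a : Kˣ} : a ∈ Sqr K ↔ IsSquare (a : K) := by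
  rw [mem_Sqr]
  constructor
  · rintro ⟨x, rfl⟩; exact ⟨x, by push_cast; ring⟩
  · rintro ⟨x, hx⟩
    have : x ≠ 0 := by rintro rfl; simp at hx
    exact ⟨Units.mk0 x this, Units.ext (by push_cast; rw [hx]; simp [pow_two])⟩
lemma Sqr_le_VT (T : Finset (Pr K)) : Sqr K ≤ VT T := by
  rintro _ ⟨x, rfl⟩ p _
  rw [ev_dv]; simp [ord_pow]
lemma Sqr_le_SI (T : Finset (Pr K)) : Sqr K ≤ SI T := by
  rintro _ ⟨x, rfl⟩
  exact mem_SI.2 fun t _ => sq_mem_SS t x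
lemma RT_empty : RT (∅ : Finset (Pr K)) = (powMonoidHom 2 : DivM K →* DivM K).range := by
  ext D
  rw [mem_RT]
  constructor
  · intro h
    refine ⟨mkD (fun P => ev P D / 2) ((ev_finite D).subset fun P hP h0 => hP (by simp [h0])), ?_⟩
    refine div_ext fun P => ?_
    rw [powMonoidHom_apply, ev_pow, ev_mkD]
    obtain ⟨m, hm⟩ := h P (by simp)
    rw [hm]; push_cast; omega
  · rintro ⟨D, rfl⟩ p _
    simp
lemma sq_inj_div : Function.Injective (powMonoidHom 2 : DivM K →* DivM K) := by
  intro D E h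
  refine div_ext fun P => ?_
  have := congrArg (ev P) h
  simpa using this
/-- class number mod squares -/
noncomputable def cK (K : Type) [Field K] [NumberField K] : ℕ := (RT (∅ : Finset (Pr K)) ⊔ (dv (K := K)).range).index
lemma cK_ne : cK K ≠ 0 := by
  intro h
  have := relIndex_mul_index (H := (dv (K := K)).range) (K := RT (∅ : Finset (Pr K)) ⊔ (dv (K := K)).range) le_sup_right
  rw [show (RT (∅ : Finset (Pr K)) ⊔ (dv (K := K)).range).index = 0 from h, mul_zero] at this
  exact dv_index this.symm
lemma v_eq [IsTotallyReal K] : (Sqr K).relIndex (VT ∅) = 2 ^ (Module.finrank ℚ K) * cK K := by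
  rw [idxR dv (Sqr_le_VT ∅)]
  have e1 : Sqr K ⊓ (dv (K := K)).ker = (dv (K := K)).ker.map (powMonoidHom 2) := by
    ext x
    constructor
    · rintro ⟨⟨y, rfl⟩, hx⟩
      refine ⟨y, ?_, rfl⟩
      change y ∈ dv.ker
      change (powMonoidHom 2 y) ∈ dv.ker at hx
      rw [dv_ker_mem] at hx ⊢
      intro P
      have := hx P
      rw [powMonoidHom_apply, Units.val_pow_eq_pow_val, ord_pow] at this
      push_cast at this; omega
    · rintro ⟨y, hy, rfl⟩
      exact ⟨⟨y, rfl⟩, pow_mem hy 2⟩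
  have e2 : VT ∅ ⊓ (dv (K := K)).ker = (dv (K := K)).ker := by
    refine inf_eq_right.2 fun x hx => ?_
    rw [dv_ker_mem] at hx
    rw [mem_VT]
    intro p _; rw [hx]; simp
  have e3 : (Sqr K).map dv = (dv (K := K)).range.map (powMonoidHom 2) := by
    ext x
    constructor
    · rintro ⟨_, ⟨y, rfl⟩, rfl⟩
      exact ⟨dv y, ⟨y, rfl⟩, by simp⟩
    · rintro ⟨_, ⟨y, rfl⟩, rfl⟩
      exact ⟨y ^ 2, ⟨y, rfl⟩, by simp⟩
  rw [e1, e2, e3, ker_sq_index, VT, map_comap_eq, inf_comm, cK, RT_empty, idx_sq _ sq_inj_div _ dv_index, mul_comm]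
  rintro _ ⟨_, ⟨y, rfl⟩, rfl⟩
  exact ⟨y ^ 2, by simp⟩
lemma RT_index (T : Finset (Pr K)) : (RT ∅).relIndex (RT T) = 2 ^ T.card := by
  let f : DivM K →* Multiplicative (T → ZMod 2) :=
    { toFun := fun D => Multiplicative.ofAdd fun t => (ev t.1 D : ZMod 2)
      map_one' := by
        change Multiplicative.ofAdd _ = Multiplicative.ofAdd 0
        congr 1; try (ext t; simp)
      map_mul' := fun D E => by
        rw [← ofAdd_add]; congr 1; ext t; simp }
  have h1 : RT ∅ = f.ker ⊓ RT T := by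
    ext D
    constructor
    · intro h
      refine ⟨?_, fun p _ => h p (by simp)⟩
      change Multiplicative.ofAdd _ = Multiplicative.ofAdd 0
      congr 1; ext t
      exact (ZMod.intCast_zmod_eq_zero_iff_dvd _ 2).2 (h t.1 (by simp)).two_dvd
    · rintro ⟨h, h'⟩ p _
      by_cases hp : p ∈ T
      · have h2 : Multiplicative.toAdd (f D) = 0 := by rw [show f D = 1 from h]; rfl
        have := congrFun h2 ⟨p, hp⟩
        exact even_iff_two_dvd.2 ((ZMod.intCast_zmod_eq_zero_iff_dvd _ 2).1 this)
      · exact h' p hp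
  have h2 : (RT T).map f = ⊤ := by
    rw [eq_top_iff]
    intro g _
    classical
    refine ⟨mkD (fun p => if hp : p ∈ T then ((Multiplicative.toAdd g ⟨p, hp⟩).val : ℤ) else 0) ?_, ?_, ?_⟩
    · refine T.finite_toSet.subset fun p hp => ?_
      by_contra h
      apply hp
      exact dif_neg h
    · intro p hp
      rw [ev_mkD, dif_neg hp]; simp
    · change Multiplicative.ofAdd _ = _
      apply Multiplicative.toAdd.injective
      ext t
      simp
  rw [h1, inf_relIndex_right, relIndex_ker, h2]
  rw [card_top]
  change Nat.card (T → ZMod 2) = _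
  rw [Nat.card_fun]; simp
lemma RT_count (T : Finset (Pr K)) :
    (RT ∅ ⊔ (dv (K := K)).range).relIndex (RT T ⊔ (dv (K := K)).range) * (VT ∅).relIndex (VT T) = 2 ^ T.card := by
  set P := (dv (K := K)).range
  have hle : RT (∅ : Finset (Pr K)) ≤ RT T := RT_mono (by simp)
  have e1 : (RT ∅ ⊔ P).relIndex (RT T ⊔ P) = (RT ∅ ⊔ P).relIndex (RT T) := by
    rw [← relIndex_sup_right (RT T) (RT ∅ ⊔ P)]
    congr 1
    rw [sup_comm (RT ∅) P, ← sup_assoc]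
    rw [sup_eq_left.2 (hle.trans le_sup_left)]
  have e2 : (VT ∅).relIndex (VT T) = (RT ∅).relIndex ((RT T ⊓ P) ⊔ RT ∅) := by
    rw [relIndex_sup_right, VT, VT, relIndex_comap, map_comap_eq, inf_comm]
  rw [e1, e2, mul_comm, ← inf_relIndex_right (RT ∅ ⊔ P) (RT T)]
  rw [show (RT ∅ ⊔ P) ⊓ RT T = (RT T ⊓ P) ⊔ RT ∅ by
    rw [sup_inf_assoc_of_le _ hle, sup_comm, inf_comm], relIndex_mul_relIndex _ _ _ le_sup_right
      (sup_le inf_le_left hle), RT_index]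
lemma gen_of_top {T : Finset (Pr K)} (h : RT T ⊔ (dv (K := K)).range = ⊤) : Gen T := by
  intro D
  have : D ∈ RT T ⊔ (dv (K := K)).range := by rw [h]; trivial
  obtain ⟨r, hr, _, ⟨x, rfl⟩, rfl⟩ := mem_sup.1 this
  refine ⟨x, fun p hp => ?_⟩
  rw [ev_mul, ev_dv, add_sub_cancel_right]
  exact hr p hp
lemma gen_of_count {T : Finset (Pr K)} (h : (VT ∅).relIndex (VT T) * cK K ≤ 2 ^ T.card) : Gen T := by
  apply gen_of_top
  have h1 := RT_count T
  have h2 := relIndex_mul_index (H := RT ∅ ⊔ (dv (K := K)).range) (K := RT T ⊔ (dv (K := K)).range)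
    (sup_le_sup_right (RT_mono (by simp)) _)
  change _ = cK K at h2
  rw [← index_eq_one]
  have hpos : 0 < (VT ∅).relIndex (VT T) := Nat.pos_of_ne_zero fun h0 => by
    rw [h0, mul_zero] at h1; exact absurd h1.symm (by positivity)
  have h3 : cK K ≤ (RT ∅ ⊔ (dv (K := K)).range).relIndex (RT T ⊔ (dv (K := K)).range) := by
    rw [← h1, mul_comm] at h
    exact Nat.le_of_mul_le_mul_right h hpos
  have h4 : (RT T ⊔ (dv (K := K)).range).index ≠ 0 := fun h0 => cK_ne (K := K) (by rw [← h2, h0, mul_zero])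
  have h5 := cK_ne (K := K)
  rw [← h2] at h3 h5
  have h6 : (RT ∅ ⊔ (dv (K := K)).range).relIndex (RT T ⊔ (dv (K := K)).range) ≠ 0 := fun h0 => h5 (by rw [h0, zero_mul])
  have h7 : (RT T ⊔ (dv (K := K)).range).index ≤ 1 := by
    by_contra hc
    push Not at hc
    nlinarith [Nat.pos_of_ne_zero h6]
  omega
noncomputable def δ1 (q : Pr K) : DivM K := Multiplicative.ofAdd (Finsupp.single q 1)
lemma δ1_zpow (q : Pr K) (n : ℤ) : δ1 q ^ n = Multiplicative.ofAdd (Finsupp.single q n) := by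
  rw [δ1, ← ofAdd_zsmul]; simp
lemma exists_q (G : Subgroup (DivM K)) (hG : (dv (K := K)).range ≤ G) (hne : G ≠ ⊤) (S : Finset (Pr K)) :
    ∃ q ∉ S, δ1 q ∉ G := by
  by_contra hcon
  push Not at hcon
  apply hne
  rw [eq_top_iff]
  intro D _
  obtain ⟨x, hx, h⟩ := approx S (fun P => ev P D)
  have h1 : dv (Units.mk0 x hx) ∈ G := hG ⟨_, rfl⟩
  suffices h2 : D / dv (Units.mk0 x hx) ∈ G by simpa using mul_mem h2 h1
  set E := D / dv (Units.mk0 x hx)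
  have hE : ∀ q ∈ S, ev q E = 0 := fun q hq => by
    simp only [E, ev_div, ev_dv, Units.val_mk0]; rw [h q hq, sub_self]
  have e : E = ∏ q ∈ (Multiplicative.toAdd E).support, δ1 q ^ (ev q E) := by
    conv_lhs => rw [← ofAdd_toAdd E, ← Finsupp.sum_single (Multiplicative.toAdd E)]
    rw [Finsupp.sum, ofAdd_sum]
    exact Finset.prod_congr rfl fun q _ => (δ1_zpow q _).symm
  rw [e]
  refine prod_mem fun q hq => zpow_mem (hcon q fun hqS => ?_) _
  exact Finsupp.mem_support_iff.1 hq (hE q hqS)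
lemma δ1_mem_RT {q : Pr K} {T : Finset (Pr K)} (h : q ∈ T) : δ1 q ∈ RT T := by
  intro p hp
  have : p ≠ q := by rintro rfl; exact hp h
  classical
  change Even (Finsupp.single q (1 : ℤ) p)
  rw [Finsupp.single_apply, if_neg this.symm]; simp
lemma sel_Q [DecidableEq (Pr K)] : ∀ (m : ℕ) (G : Subgroup (DivM K)) (S : Finset (Pr K)), (dv (K := K)).range ≤ G → G.index = m → m ≠ 0 →
    ∃ Q : Finset (Pr K), Disjoint Q S ∧ 2 ^ Q.card ≤ m ∧ RT Q ⊔ G = ⊤ := by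
  intro m
  induction m using Nat.strong_induction_on with
  | _ m ih =>
  intro G S hG hm h0
  by_cases htop : G = ⊤
  · exact ⟨∅, by simp, by simpa using Nat.one_le_iff_ne_zero.2 h0, by rw [htop, sup_top_eq]⟩
  obtain ⟨q, hqS, hq⟩ := exists_q G hG htop S
  set G' := G ⊔ zpowers (δ1 q)
  have hqG' : δ1 q ∈ G' := (le_sup_right : _ ≤ G') (mem_zpowers _)
  have h1 := relIndex_mul_index (H := G) (K := G') le_sup_left
  rw [hm] at h1
  have h2 : G.relIndex G' ≠ 1 := by
    intro h; rw [relIndex_eq_one] at h; exact hq (h hqG')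
  have h3 : G.relIndex G' ≠ 0 := fun h => h0 (by rw [← h1, h, zero_mul])
  have h4 : G'.index ≠ 0 := fun h => h0 (by rw [← h1, h, mul_zero])
  have h5 : 2 * G'.index ≤ m := by
    rw [← h1]; exact Nat.mul_le_mul_right _ (by omega)
  obtain ⟨Q, hQ1, hQ2, hQ3⟩ := ih G'.index (by omega) G' (insert q S) (hG.trans le_sup_left) rfl h4
  rw [Finset.disjoint_insert_right] at hQ1
  refine ⟨insert q Q, ?_, ?_, ?_⟩
  · rw [Finset.disjoint_insert_left]; exact ⟨hqS, hQ1.2⟩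
  · rw [Finset.card_insert_of_notMem hQ1.1, pow_succ]; omega
  · rw [eq_top_iff, ← hQ3]
    refine sup_le ((RT_mono (Finset.subset_insert _ _)).trans le_sup_left) (sup_le le_sup_right ?_)
    rw [zpowers_le]
    exact (le_sup_left : RT (insert q Q) ≤ _) (δ1_mem_RT (Finset.mem_insert_self _ _))
lemma exists_Q (S : Finset (Pr K)) : ∃ Q : Finset (Pr K), Disjoint Q S ∧ 2 ^ Q.card ≤ cK K ∧ Gen Q := by
  classical
  obtain ⟨Q, h1, h2, h3⟩ := sel_Q (cK K) (RT ∅ ⊔ (dv (K := K)).range) S le_sup_right rfl cK_ne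
  refine ⟨Q, h1, h2, gen_of_top ?_⟩
  rw [← sup_assoc, sup_eq_left.2 (RT_mono (by simp))] at h3
  exact h3
end
section
variable {K : Type} [Field K] [NumberField K]
variable {L : Type} [Field L] [NumberField L] [Algebra K L] {σ : L ≃ₐ[K] L}
lemma Quad.basis (h : Quad σ) {δ : L} (hδ : σ δ ≠ δ) (x : L) :
    ∃ a b : K, x = algebraMap K L a + algebraMap K L b * δ := by
  have h0 : δ - σ δ ≠ 0 := sub_ne_zero.2 hδ.symm
  obtain ⟨b, hb⟩ := h.fix (x := (x - σ x) / (δ - σ δ)) (by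
    rw [map_div₀, map_sub, map_sub, h.invol, h.invol, ← neg_sub x, ← neg_sub δ, neg_div_neg_eq])
  obtain ⟨a, ha⟩ := h.fix (x := x - algebraMap K L b * δ) (by
    rw [map_sub, map_mul, AlgEquiv.commutes, hb]
    field_simp; ring)
  exact ⟨a, b, by rw [ha]; ring⟩
lemma Quad.adjoin (h : Quad σ) {δ : L} (hδ : σ δ ≠ δ) : Algebra.adjoin K {δ} = ⊤ := by
  rw [eq_top_iff]
  intro x _
  obtain ⟨a, b, rfl⟩ := h.basis hδ x
  exact add_mem (Subalgebra.algebraMap_mem _ _)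
    (mul_mem (Subalgebra.algebraMap_mem _ _) (Algebra.self_mem_adjoin_singleton K δ))
open Polynomial in
lemma Quad.minpoly (h : Quad σ) {δ : L} (hδ : σ δ ≠ δ) {s p : K} (hs : algebraMap K L s = δ + σ δ)
    (hp : algebraMap K L p = δ * σ δ) : minpoly K δ = X ^ 2 - C s * X + C p := by
  have hdeg : (X ^ 2 - C s * X + C p : K[X]).degree = 2 := by compute_degree!
  symm
  apply minpoly.unique
  · monicity!
  · simp [hs, hp]; ring
  · intro q hq hq0
    have hδi : IsIntegral K δ := Algebra.IsIntegral.isIntegral δ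
    have h2 : 2 ≤ (_root_.minpoly K δ).natDegree := by
      rw [minpoly.two_le_natDegree_iff hδi]
      rintro ⟨y, rfl⟩
      exact hδ (by simp)
    rw [hdeg]
    refine le_trans ?_ (minpoly.min K δ hq hq0)
    rw [degree_eq_natDegree (minpoly.ne_zero hδi)]
    exact_mod_cast h2
noncomputable def sO (σ : L ≃ₐ[K] L) : 𝓞 L ≃+* 𝓞 L := RingOfIntegers.mapRingEquiv σ.toRingEquiv
@[simp] lemma sO_coe (σ : L ≃ₐ[K] L) (x : 𝓞 L) : ((sO σ x : 𝓞 L) : L) = σ (x : L) := rfl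
open Polynomial in
lemma diff_mem (h : Quad σ) (δ : 𝓞 L) : δ - sO σ δ ∈ differentIdeal (𝓞 K) (𝓞 L) := by
  by_cases hδ : σ (δ : L) = δ
  · have : δ - sO σ δ = 0 := RingOfIntegers.ext (by
      change (δ : L) - σ (δ : L) = 0; rw [hδ, sub_self])
    rw [this]; exact Ideal.zero_mem _
  obtain ⟨s, hs⟩ := h.fix (x := (δ : L) + σ δ) (by rw [map_add, h.invol, add_comm])
  obtain ⟨p, hp⟩ := h.fix (x := (δ : L) * σ δ) (by rw [map_mul, h.invol, mul_comm])
  have hm := h.minpoly hδ hs hp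
  have hi : IsIntegral (𝓞 K) δ := Algebra.IsIntegral.isIntegral δ
  have h1 := minpoly.isIntegrallyClosed_eq_field_fractions K L hi
  have h2 := aeval_derivative_mem_differentIdeal (𝓞 K) K L δ (h.adjoin hδ)
  convert h2 using 1
  apply RingOfIntegers.ext
  have h3 : algebraMap (𝓞 L) L (aeval δ (derivative (_root_.minpoly (𝓞 K) δ))) =
      aeval (δ : L) (derivative (_root_.minpoly K (δ : L))) := by
    rw [show _root_.minpoly K (δ : L) = (_root_.minpoly (𝓞 K) δ).map (algebraMap (𝓞 K) K) from h1, derivative_map,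
      aeval_map_algebraMap, aeval_algebraMap_apply]
  refine Eq.trans ?_ h3.symm
  rw [hm]
  change (δ : L) - σ (δ : L) = _
  simp [hs]; ring
lemma ram_one (h : Quad σ) (P : Pr L) (δ : 𝓞 L) (hδ : δ - sO σ δ ∉ P.asIdeal) : ram K P = 1 := by
  by_contra hne
  have hpos := ram_pos (K := K) P
  have h2 : 2 ≤ ram K P := by omega
  have h3 : (under K P).asIdeal.map (algebraMap (𝓞 K) (𝓞 L)) ≤ P.asIdeal ^ 2 :=
    Ideal.le_pow_of_le_ramificationIdx' h2
  haveI := (under K P).isMaximal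
  have h4 := pow_sub_one_dvd_differentIdeal (𝓞 K) (p := (under K P).asIdeal) P.asIdeal 2 (under K P).ne_bot
    (Ideal.dvd_iff_le.2 h3)
  rw [Nat.add_one_sub_one, pow_one, Ideal.dvd_iff_le] at h4
  exact hδ (h4 (diff_mem h δ))
/-- congruent to a square mod 4 -/
def S4 (K : Type) [Field K] [NumberField K] : Subgroup Kˣ where
  carrier := {α | ∃ x : Kˣ, ∃ w : 𝓞 K, (α : K) * (x : K) ^ 2 = 1 + 4 * (w : K)}
  one_mem' := ⟨1, 0, by simp⟩
  mul_mem' := by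
    rintro a b ⟨x, w, h⟩ ⟨y, z, h'⟩
    refine ⟨x * y, w + z + 4 * w * z, ?_⟩
    have : ((a * b : Kˣ) : K) * ((x * y : Kˣ) : K) ^ 2 = ((a : K) * (x : K) ^ 2) * ((b : K) * (y : K) ^ 2) := by
      push_cast; ring
    rw [this, h, h']
    change _ = (1 : K) + 4 * ((w : K) + (z : K) + 4 * (w : K) * (z : K))
    ring
  inv_mem' := by
    rintro a ⟨x, w, h⟩
    refine ⟨a * x, w, ?_⟩
    rw [← h]; push_cast; field_simp
def TP (K : Type) [Field K] : Subgroup Kˣ where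
  carrier := {α | ∀ φ : K →+* ℝ, 0 < φ (α : K)}
  one_mem' := fun φ => by simp
  mul_mem' := fun ha hb φ => by
    rw [Units.val_mul, map_mul]; exact mul_pos (ha φ) (hb φ)
  inv_mem' := fun ha φ => by
    rw [Units.val_inv_eq_inv_val, map_inv₀]; exact inv_pos.2 (ha φ)
open Polynomial in
lemma int_of_mul_sub {F : Type*} [Field F] {x : F} (h : IsIntegral ℤ (x * (x - 1))) : IsIntegral ℤ x := by
  refine IsIntegral.of_aeval_monic (p := (X ^ 2 - X : ℤ[X])) ?_ ?_ ?_
  · monicity!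
  · have : (X ^ 2 - X : ℤ[X]).natDegree = 2 := by compute_degree!
    rw [this]; norm_num
  · simp only [map_sub, map_pow, aeval_X]
    rw [show x ^ 2 - x = x * (x - 1) by ring]; exact h
/-- unramified at P when ord even and (odd or S4) -/
lemma kummer_delta {α : Kˣ} {γ : L} (hγ : γ ^ 2 = algebraMap K L α) (hs : σ γ = -γ)
    (P : Pr L) (he : Even (ord (under K P) (α : K))) (h4 : α ∈ S4 K) : ∃ δ : 𝓞 L, δ - sO σ δ ∉ P.asIdeal := by
  by_cases h2 : (2 : 𝓞 K) ∈ (under K P).asIdeal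
  · obtain ⟨x, w, hx⟩ := h4
    have e1 : (algebraMap K L x * γ) ^ 2 = 1 + 4 * algebraMap K L (w : K) := by
      rw [mul_pow, hγ, ← map_pow, ← map_mul, mul_comm, hx, map_add, map_one, map_mul, map_ofNat]
    have hint : IsIntegral ℤ ((1 + algebraMap K L x * γ) / 2) := by
      have e2 : ((1 + algebraMap K L x * γ) / 2) * ((1 + algebraMap K L x * γ) / 2 - 1) = algebraMap K L (w : K) := by
        linear_combination e1 / 4
      have hw : IsIntegral ℤ (algebraMap K L (w : K)) := (RingOfIntegers.isIntegral_coe w).algebraMap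
      rw [← e2] at hw
      exact int_of_mul_sub hw
    let δ : 𝓞 L := ⟨_, hint⟩
    refine ⟨δ, ?_⟩
    intro hmem
    have e3 : (δ - sO σ δ) ^ 2 = 1 + 4 * algebraMap (𝓞 K) (𝓞 L) w := by
      apply RingOfIntegers.ext
      change ((1 + algebraMap K L x * γ) / 2 - σ ((1 + algebraMap K L x * γ) / 2)) ^ 2 = 1 + 4 * algebraMap K L (w : K)
      rw [map_div₀, map_add, map_mul, hs, map_one, map_ofNat, AlgEquiv.commutes, ← e1]; ring
    have h5 := P.asIdeal.mul_mem_left (δ - sO σ δ) hmem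
    rw [← pow_two, e3] at h5
    rw [two_mem_under] at h2
    have h6 := P.asIdeal.sub_mem h5 (P.asIdeal.mul_mem_left (2 * algebraMap (𝓞 K) (𝓞 L) w) h2)
    apply P.isPrime.ne_top
    rw [Ideal.eq_top_iff_one]
    convert h6 using 1; ring
  · obtain ⟨x, u, hu, hx⟩ := unit_rep _ α he
    have e1 : (algebraMap K L x * γ) ^ 2 = algebraMap K L (u : K) := by
      rw [mul_pow, hγ, ← map_pow, ← map_mul, mul_comm, hx]
    have hint : IsIntegral ℤ (algebraMap K L x * γ) := by
      apply IsIntegral.of_pow (n := 2) two_pos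
      rw [e1]
      exact (RingOfIntegers.isIntegral_coe u).algebraMap
    let δ : 𝓞 L := ⟨_, hint⟩
    refine ⟨δ, ?_⟩
    have e3 : (δ - sO σ δ) ^ 2 = 2 * 2 * algebraMap (𝓞 K) (𝓞 L) u := by
      apply RingOfIntegers.ext
      change ((algebraMap K L x * γ) - σ (algebraMap K L x * γ)) ^ 2 = 2 * 2 * algebraMap K L (u : K)
      rw [map_mul, hs, AlgEquiv.commutes, ← e1]; ring
    intro hmem
    have h5 := P.asIdeal.mul_mem_left (δ - sO σ δ) hmem
    rw [← pow_two, e3] at h5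
    rw [two_mem_under] at h2
    rcases P.isPrime.mem_or_mem h5 with h6 | h6
    · rcases P.isPrime.mem_or_mem h6 with h6 | h6 <;> exact h2 h6
    · exact hu h6
lemma ram_one_kummer (h : Quad σ) {α : Kˣ} {γ : L} (hγ : γ ^ 2 = algebraMap K L α) (hs : σ γ = -γ)
    (P : Pr L) (he : Even (ord (under K P) (α : K))) (h4 : α ∈ S4 K) : ram K P = 1 := by
  obtain ⟨δ, hδ⟩ := kummer_delta hγ hs P he h4
  exact ram_one h P δ hδ
end
section
variable {K : Type} [Field K] [NumberField K]
def R2 (K : Type) [Field K] [NumberField K] : Prop := ∀ x : 𝓞 K, (2 : 𝓞 K) ∣ x ^ 2 → (2 : 𝓞 K) ∣ x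
lemma R2.surj (h : R2 K) (c : 𝓞 K) : ∃ y, (2 : 𝓞 K) ∣ c - y ^ 2 := by
  let I : Ideal (𝓞 K) := Ideal.span {(2 : 𝓞 K)}
  have hI : I ≠ ⊥ := by simp [I]
  haveI : Finite (𝓞 K ⧸ I) := Ideal.finiteQuotientOfFreeOfNeBot _ hI
  have hinj : Function.Injective (fun x : 𝓞 K ⧸ I => x ^ 2) := by
    intro x y hxy
    obtain ⟨x, rfl⟩ := Ideal.Quotient.mk_surjective x
    obtain ⟨y, rfl⟩ := Ideal.Quotient.mk_surjective y
    simp only [← map_pow] at hxy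
    rw [Ideal.Quotient.eq, Ideal.mem_span_singleton] at hxy ⊢
    apply h
    rw [show (x - y) ^ 2 = (x ^ 2 - y ^ 2) + 2 * (y * (y - x)) by ring]
    exact dvd_add hxy (dvd_mul_right _ _)
  obtain ⟨y, hy⟩ := Finite.surjective_of_injective hinj (Ideal.Quotient.mk I c)
  obtain ⟨y, rfl⟩ := Ideal.Quotient.mk_surjective y
  refine ⟨y, ?_⟩
  rw [← Ideal.mem_span_singleton, ← Ideal.Quotient.eq, map_pow]
  exact hy.symm
lemma rep2 (hR : R2 K) (α : Kˣ) (h : ∀ P : Pr K, (2 : 𝓞 K) ∈ P.asIdeal → Even (ord P (α : K))) :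
    ∃ x : Kˣ, ∃ a : 𝓞 K, (α : K) * (x : K) ^ 2 = 1 + 2 * (a : K) := by
  classical
  have fin2 := finite_over (K := K) (x := 2) two_ne_zero
  obtain ⟨x0, hx0, hx⟩ := approx fin2.toFinset (fun P => - (ord P (α : K) / 2))
  have hu0 : (α : K) * x0 ^ 2 ≠ 0 := mul_ne_zero α.ne_zero (pow_ne_zero _ hx0)
  set u := (α : K) * x0 ^ 2
  have hu : ∀ P : Pr K, (2 : 𝓞 K) ∈ P.asIdeal → ord P u = 0 := by
    intro P hP
    obtain ⟨m, hm⟩ := h P hP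
    rw [ord_mul P α.ne_zero (pow_ne_zero _ hx0), ord_pow, hx P (by simpa using hP), hm]
    push_cast; omega
  obtain ⟨d, hd0, hd⟩ := approx_int (fin2.union (ord_finite hu0)).toFinset (fun P => (ord P u).natAbs)
  have hdK : (d : K) ≠ 0 := RingOfIntegers.coe_ne_zero_iff.2 hd0
  obtain ⟨b, hb⟩ := int_of_ord (x := u * (d : K) ^ 2) (by
    intro P
    rw [ord_mul P hu0 (pow_ne_zero _ hdK), ord_pow]
    by_cases hP : ord P u = 0
    · have := ord_int_nonneg P d
      rw [hP]; push_cast; omega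
    · rw [hd P (by simp [hP])]
      have := neg_abs_le (ord P u)
      have := abs_nonneg (ord P u)
      push_cast; omega)
  have hbP : ∀ P : Pr K, (2 : 𝓞 K) ∈ P.asIdeal → b ∉ P.asIdeal := by
    intro P hP hbP
    have hb0 : b ≠ 0 := by
      rintro rfl
      have : u * (d : K) ^ 2 = 0 := by rw [← hb]; simp
      exact mul_ne_zero hu0 (pow_ne_zero _ hdK) this
    rw [← ord_int_pos P hb0, hb, ord_mul P hu0 (pow_ne_zero _ hdK), ord_pow, hu P hP, hd P (by simp; left; exact hP), hu P hP] at hbP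
    simp at hbP
  have hcop : Ideal.span {b} ⊔ Ideal.span {(2 : 𝓞 K)} = ⊤ := by
    by_contra hne
    obtain ⟨M, hM, hle⟩ := Ideal.exists_le_maximal _ hne
    have h2 : (2 : 𝓞 K) ∈ M := hle (Ideal.mem_sup_right (Ideal.mem_span_singleton_self _))
    have h1 : b ∈ M := hle (Ideal.mem_sup_left (Ideal.mem_span_singleton_self _))
    exact hbP ⟨M, hM.isPrime, by rintro rfl; simp at h2⟩ h2 h1
  obtain ⟨p, hp, q, hq, hpq⟩ := Submodule.mem_sup.1 ((Ideal.eq_top_iff_one _).1 hcop)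
  rw [Ideal.mem_span_singleton] at hp hq
  obtain ⟨c, rfl⟩ := hp
  obtain ⟨e, rfl⟩ := hq
  have hy : ∃ y : 𝓞 K, y ≠ 0 ∧ (2 : 𝓞 K) ∣ b * y ^ 2 - 1 := by
    obtain ⟨y, f, hf⟩ := hR.surj c
    have h1 : b * y ^ 2 - 1 = 2 * (-(b * f + e)) := by
      linear_combination (-b) * hf + hpq
    by_cases hy0 : y = 0
    · refine ⟨1, one_ne_zero, ?_⟩
      rw [hy0] at h1
      have h3 : (2 : 𝓞 K) ∣ 1 := ⟨b * f + e, by linear_combination -h1⟩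
      exact h3.trans (one_dvd _)
    · exact ⟨y, hy0, _, h1⟩
  obtain ⟨y, hy0, a, ha⟩ := hy
  have hyK : (y : K) ≠ 0 := RingOfIntegers.coe_ne_zero_iff.2 hy0
  refine ⟨Units.mk0 _ hx0 * Units.mk0 _ hdK * Units.mk0 _ hyK, a, ?_⟩
  have haK : (b : K) * (y : K) ^ 2 - 1 = 2 * (a : K) := congrArg (fun z : 𝓞 K => (z : K)) ha
  change (α : K) * (x0 * (d : K) * (y : K)) ^ 2 = _
  rw [← haK, hb]
  simp only [u]; ring
lemma S4_of_cong {α β x y : Kˣ} {a b : 𝓞 K} (h1 : (α : K) * (x : K) ^ 2 = 1 + 2 * (a : K))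
    (h2 : (β : K) * (y : K) ^ 2 = 1 + 2 * (b : K)) (hab : (2 : 𝓞 K) ∣ a - b) : α / β ∈ S4 K := by
  obtain ⟨c, hc⟩ := hab
  have hcK : (a : K) - (b : K) = 2 * (c : K) := congrArg (fun z : 𝓞 K => (z : K)) hc
  refine ⟨x * β * y, b + b ^ 2 + c * (1 + 2 * b), ?_⟩
  have e : ((α / β : Kˣ) : K) * ((x * β * y : Kˣ) : K) ^ 2 = ((α : K) * (x : K) ^ 2) * ((β : K) * (y : K) ^ 2) := by
    push_cast; field_simp
  rw [e, h1, h2]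
  change _ = (1 : K) + 4 * ((b : K) + (b : K) ^ 2 + (c : K) * (1 + 2 * (b : K)))
  linear_combination (2 + 4 * (b : K)) * hcK
noncomputable def WT (T : Finset (Pr K)) : Subgroup Kˣ := VT T ⊓ (TP K ⊓ S4 K)
lemma Sqr_le_TP : Sqr K ≤ TP K := by
  rintro _ ⟨x, rfl⟩ φ
  have : φ (x : K) ≠ 0 := by simp
  simp only [powMonoidHom_apply, Units.val_pow_eq_pow_val, map_pow]
  positivity
lemma Sqr_le_S4 : Sqr K ≤ S4 K := by
  rintro _ ⟨x, rfl⟩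
  exact ⟨x⁻¹, 0, by simp⟩
lemma Sqr_le_WT (T : Finset (Pr K)) : Sqr K ≤ WT T := le_inf (Sqr_le_VT T) (le_inf Sqr_le_TP Sqr_le_S4)
instance : Finite (K →+* ℝ) := by
  apply Finite.of_injective (fun φ : K →+* ℝ => (Complex.ofRealHom.comp φ : K →+* ℂ))
  intro a b h
  ext x
  have := congrArg (fun f : K →+* ℂ => f x) h
  simpa using this
lemma card_real : Nat.card (K →+* ℝ) ≤ Module.finrank ℚ K := by
  have h1 : Nat.card (K →+* ℂ) = Module.finrank ℚ K := by
    rw [Nat.card_eq_fintype_card]; exact NumberField.Embeddings.card K ℂ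
  rw [← h1]
  refine Nat.card_le_card_of_injective (fun φ : K →+* ℝ => (Complex.ofRealHom.comp φ : K →+* ℂ)) ?_
  intro a b h
  ext x
  have := congrArg (fun f : K →+* ℂ => f x) h
  simpa using this
lemma card_two : Nat.card (𝓞 K ⧸ Ideal.span {(2 : 𝓞 K)}) = 2 ^ Module.finrank ℚ K := by
  have := Ideal.absNorm_span_natCast (S := 𝓞 K) 2
  rw [RingOfIntegers.rank, Ideal.absNorm_apply, Submodule.cardQuot_apply] at this
  exact_mod_cast this
instance fin_two : Finite (𝓞 K ⧸ Ideal.span {(2 : 𝓞 K)}) :=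
  Ideal.finiteQuotientOfFreeOfNeBot _ (by simp)
lemma WT_index (hR : R2 K) (T : Finset (Pr K)) (hT : ∀ t ∈ T, (2 : 𝓞 K) ∉ t.asIdeal) :
    (WT T).relIndex (VT T) ≠ 0 ∧ (WT T).relIndex (VT T) ≤ 2 ^ (2 * Module.finrank ℚ K) := by
  classical
  have hrep : ∀ α : Kˣ, ∃ a : 𝓞 K, α ∈ VT T → ∃ x : Kˣ, (α : K) * (x : K) ^ 2 = 1 + 2 * (a : K) := by
    intro α
    by_cases h : α ∈ VT T
    · obtain ⟨x, a, hx⟩ := rep2 hR α (fun P hP => h P (fun hPT => hT P hPT hP))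
      exact ⟨a, fun _ => ⟨x, hx⟩⟩
    · exact ⟨0, fun h' => absurd h' h⟩
  choose a ha using hrep
  have := relIndex_le_card (WT T) (VT T) (α := ((K →+* ℝ) → Bool) × (𝓞 K ⧸ Ideal.span {(2 : 𝓞 K)}))
    (fun α => (fun φ => decide (0 < φ (α : K)), Ideal.Quotient.mk _ (a α))) ?_
  · refine ⟨this.1, this.2.trans ?_⟩
    rw [Nat.card_prod, card_two, Nat.card_fun, two_mul, pow_add]
    rw [Nat.card_eq_fintype_card (α := Bool), Fintype.card_bool]
    exact Nat.mul_le_mul_right _ (Nat.pow_le_pow_right two_pos card_real)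
  · intro α hα β hβ hab
    obtain ⟨h1, h2⟩ := Prod.ext_iff.1 hab
    refine ⟨(VT T).div_mem hα hβ, fun φ => ?_, ?_⟩
    · have h3 := congrFun h1 φ
      simp only [decide_eq_decide] at h3
      rw [Units.val_div_eq_div_val, map_div₀]
      have hn1 : φ (α : K) ≠ 0 := by simp
      have hn2 : φ (β : K) ≠ 0 := by simp
      rcases lt_or_gt_of_ne hn1 with h | h
      · refine div_pos_of_neg_of_neg h ?_
        exact lt_of_le_of_ne (not_lt.1 fun h' => absurd (h3.2 h') (not_lt.2 h.le)) hn2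
      · exact div_pos h (h3.1 h)
    · obtain ⟨x, hx⟩ := ha α hα
      obtain ⟨y, hy⟩ := ha β hβ
      refine S4_of_cong hx hy ?_
      rw [← Ideal.mem_span_singleton, ← Ideal.Quotient.eq]
      exact h2
end
section
variable {K : Type} [Field K] [NumberField K]
lemma ord_one_add (P : Pr K) {z : K} (hz : z ≠ 0) (h : 0 < ord P z) : ord P (1 + z) = 0 := by
  rw [ord_pos_iff P hz] at h
  rw [ord, Valuation.map_one_add_of_lt _ h]; simp
lemma ord_one_add' (P : Pr K) {z : K} (hz : z ≠ 0) (h : ord P z < 0) : ord P (1 + z) = ord P z := by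
  have h1 : 0 < ord P z⁻¹ := by rw [ord_inv]; omega
  have h2 := ord_one_add P (inv_ne_zero hz) h1
  have h3 : (1 : K) + z⁻¹ ≠ 0 := by
    intro h0
    have : z⁻¹ = -1 := by linear_combination h0
    rw [this, ord_neg, ord_one] at h1; exact lt_irrefl _ h1
  have : 1 + z = z * (1 + z⁻¹) := by field_simp; ring
  rw [this, ord_mul P hz h3, h2, add_zero]
variable {L : Type} [Field L] [NumberField L] [Algebra K L] {σ : L ≃ₐ[K] L}
lemma gam_ne {α : Kˣ} {γ : L} (hγ : γ ^ 2 = algebraMap K L α) (hs : σ γ = -γ) : σ γ ≠ γ := by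
  intro h
  have h0 : γ = 0 := by
    rw [h] at hs
    have : (2 : L) * γ = 0 := by linear_combination hs
    simpa using this
  rw [h0] at hγ
  have : algebraMap K L α ≠ 0 := by simp
  exact this (by rw [← hγ]; simp)
lemma norm_SS (h : Quad σ) {α : Kˣ} {γ : L} (hγ : γ ^ 2 = algebraMap K L α) (hs : σ γ = -γ)
    (t : Pr K) (ht : ¬ Even (ord t (α : K))) (e : Kˣ) (he : Even (ord t (e : K)))
    (hn : aK K L e ∈ (nm (sA σ)).range) : e ∈ SS t := by
  obtain ⟨y, hy⟩ := hn
  obtain ⟨a, b, hab⟩ := h.basis (gam_ne hγ hs) (y : L)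
  have e1 : (e : K) = a ^ 2 - α * b ^ 2 := by
    apply (algebraMap K L).injective
    have := congrArg (fun z : Lˣ => (z : L)) hy
    simp only [nm_apply, Units.val_mul, sA_coe, aK_coe] at this
    rw [← this, hab]
    simp only [map_add, map_mul, map_sub, map_pow, AlgEquiv.commutes, hs]
    rw [← hγ]; ring
  by_cases hb : b = 0
  · have ha : a ≠ 0 := by rintro rfl; rw [hb] at e1; simp at e1
    have : e = (Units.mk0 a ha) ^ 2 := Units.ext (by rw [e1, hb]; simp)
    rw [this]; exact sq_mem_SS t _
  by_cases ha : a = 0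
  · exfalso
    rw [e1, ha] at he
    rw [show (0 : K) ^ 2 - α * b ^ 2 = - (α * b ^ 2) by ring, ord_neg,
      ord_mul t α.ne_zero (pow_ne_zero _ hb), ord_pow] at he
    apply ht
    obtain ⟨m, hm⟩ := he
    exact ⟨m - ord t b, by push_cast at hm; omega⟩
  set w := - ((α : K) * b ^ 2 / a ^ 2) with hw
  have hw0 : w ≠ 0 := neg_ne_zero.2 (div_ne_zero (mul_ne_zero α.ne_zero (pow_ne_zero _ hb)) (pow_ne_zero _ ha))
  have how : ord t w = ord t (α : K) + 2 * ord t b - 2 * ord t a := by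
    rw [hw, ord_neg, ord_div t (mul_ne_zero α.ne_zero (pow_ne_zero _ hb)) (pow_ne_zero _ ha),
      ord_mul t α.ne_zero (pow_ne_zero _ hb), ord_pow, ord_pow]; push_cast; ring
  have e2 : (e : K) * (((Units.mk0 a ha)⁻¹ : Kˣ) : K) ^ 2 = 1 + w := by
    rw [e1, hw]; simp; field_simp; ring
  refine SS_of_local t (x := (Units.mk0 a ha)⁻¹) (w := w) e2 (Or.inr ?_)
  rcases lt_trichotomy (ord t w) 0 with h1 | h1 | h1
  · exfalso
    have h2 := ord_one_add' t hw0 h1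
    rw [← e2, ord_mul t e.ne_zero (pow_ne_zero _ (Units.ne_zero _)), ord_pow, how] at h2
    obtain ⟨m, hm⟩ := he
    simp only [Units.val_inv_eq_inv_val, Units.val_mk0, ord_inv] at h2
    exact ht ⟨m - ord t b, by push_cast at h2; omega⟩
  · exfalso
    exact ht ⟨ord t a - ord t b, by omega⟩
  · exact h1
lemma TR_ext [IsTotallyReal K] (h : Quad σ) {α : Kˣ} {γ : L} (hγ : γ ^ 2 = algebraMap K L α) (hs : σ γ = -γ)
    (hα : α ∈ TP K) : IsTotallyReal L := by
  refine ⟨fun v => ?_⟩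
  rw [InfinitePlace.isReal_iff]
  set φ := v.embedding
  have hK : ComplexEmbedding.IsReal (φ.comp (algebraMap K L)) := IsTotallyReal.complexEmbedding_isReal _
  have hc : ∀ a : K, φ (algebraMap K L a) = ((hK.embedding a : ℝ) : ℂ) := fun a => (hK.coe_embedding_apply a).symm
  have h1 : (φ γ) ^ 2 = ((Real.sqrt (hK.embedding (α : K)) : ℝ) : ℂ) ^ 2 := by
    rw [← map_pow, hγ, hc, ← Complex.ofReal_pow, Real.sq_sqrt (hα _).le]
  have h2 : starRingEnd ℂ (φ γ) = φ γ := by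
    rcases sq_eq_sq_iff_eq_or_eq_neg.1 h1 with h3 | h3 <;> rw [h3] <;> simp
  rw [ComplexEmbedding.isReal_iff]
  ext x
  obtain ⟨a, b, rfl⟩ := h.basis (gam_ne hγ hs) x
  simp only [ComplexEmbedding.conjugate_coe_eq, map_add, map_mul, h2, hc, Complex.conj_ofReal]
lemma fin_above (h : Quad σ) (S : Finset (Pr K)) : {P : Pr L | under K P ∈ S}.Finite := by
  classical
  choose p hp using fun t : Pr K => exists_over (L := L) t
  refine (S.image p ∪ S.image (fun t => pact σ (p t))).finite_toSet.subset ?_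
  intro P hP
  change under K P ∈ S at hP
  rcases h.over (P := p (under K P)) (Q := P) (hp _) with h1 | h1
  · simp only [Finset.coe_union, Finset.coe_image]
    exact Or.inl ⟨_, hP, h1.symm⟩
  · simp only [Finset.coe_union, Finset.coe_image]
    exact Or.inr ⟨_, hP, h1.symm⟩
lemma sq_up (h : Quad σ) {β : Kˣ} {γ : L} (hγ : γ ^ 2 = algebraMap K L β) (hs : σ γ = -γ) (a : Kˣ)
    (hsq : IsSquare (aK K L a : L)) : a ∈ Sqr K ∨ a * β ∈ Sqr K := by
  obtain ⟨y, hy⟩ := hsq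
  rw [aK_coe] at hy
  have h1 : σ y ^ 2 = y ^ 2 := by rw [← map_pow, pow_two, ← hy]; simp
  have hγ0 : γ ≠ 0 := by rintro rfl; have : algebraMap K L β ≠ 0 := by simp
                         exact this (by rw [← hγ]; simp)
  rcases sq_eq_sq_iff_eq_or_eq_neg.1 h1 with h2 | h2
  · left
    obtain ⟨z, rfl⟩ := h.fix h2
    rw [mem_Sqr']
    exact ⟨z, (algebraMap K L).injective (by rw [hy, map_mul])⟩
  · right
    obtain ⟨z, hz⟩ := h.fix (x := y * γ) (by rw [map_mul, h2, hs]; ring)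
    rw [mem_Sqr']
    refine ⟨z, (algebraMap K L).injective ?_⟩
    rw [Units.val_mul, map_mul, map_mul, hy, ← hγ, hz]; ring
lemma sel_T [DecidableEq (Pr K)] (h : Quad σ) {β : Kˣ} {γ : L} (hγ : γ ^ 2 = algebraMap K L β) (hs : σ γ = -γ)
    (hβV : β ∈ VT ∅) :
    ∀ (m : ℕ) (A : Subgroup Kˣ) (S : Finset (Pr K)), A ≤ VT ∅ → Sqr K ≤ A → (∀ a ∈ A, a * β ∉ Sqr K) →
      (Sqr K).relIndex A = m → m ≠ 0 →
    ∃ T : Finset (Pr K), Disjoint T S ∧ (∀ t ∈ T, (2 : 𝓞 K) ∉ t.asIdeal ∧ β ∈ SS t) ∧ 2 ^ T.card = m ∧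
      A ⊓ SI T ≤ Sqr K := by
  intro m
  induction m using Nat.strong_induction_on with
  | _ m ih =>
  intro A S hAV hA hAβ hm h0
  by_cases hAS : A ≤ Sqr K
  · refine ⟨∅, by simp, by simp, ?_, inf_le_left.trans hAS⟩
    rw [← hm, (relIndex_eq_one).2 hAS]; simp
  obtain ⟨a, haA, ha⟩ := SetLike.not_le_iff_exists.1 hAS
  have hnsq : ¬ IsSquare (aK K L a : L) := by
    intro hsq
    rcases sq_up h hγ hs a hsq with h1 | h1
    · exact ha h1
    · exact hAβ a haA h1
  obtain ⟨P, hPS, hP2, haP⟩ := inert (aK K L a) hnsq _ (fin_above h S)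
  set t := under K P with ht
  have htS : t ∉ S := hPS
  have ht2 : (2 : 𝓞 K) ∉ t.asIdeal := by rwa [ht, two_mem_under]
  have hat : a ∉ SS t := fun h' => haP (SS_up P h')
  have hβt : β ∈ SS t := by
    by_contra hβt
    have h1 := SS_mul t (hAV haA t (by simp)) (hβV t (by simp)) hat hβt
    have h2 := SS_up P h1
    rw [map_mul] at h2
    have hγ0 : γ ≠ 0 := by rintro rfl; have : algebraMap K L β ≠ 0 := by simp
                           exact this (by rw [← hγ]; simp)
    have h3 : aK K L β ∈ SS P := by
      have : aK K L β = (Units.mk0 γ hγ0) ^ 2 := Units.ext (by rw [aK_coe, ← hγ]; simp)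
      rw [this]; exact sq_mem_SS P _
    exact haP ((Subgroup.mul_mem_cancel_right _ h3).1 h2)
  have hidx := SI_index {t} A (fun b hb s _ => hAV hb s (by simp))
  have hSI : SI {t} = SS t := by ext x; simp [mem_SI]
  rw [hSI] at hidx
  simp only [Finset.card_singleton, pow_one] at hidx
  have hne1 : (SS t).relIndex A ≠ 1 := by
    intro h1; rw [relIndex_eq_one] at h1; exact hat (h1 haA)
  have h2 : (SS t).relIndex A = 2 := by omega
  have h3 := relIndex_mul_relIndex (Sqr K) (SS t ⊓ A) A
    (le_inf (by rintro _ ⟨x, rfl⟩; exact sq_mem_SS t x) hA) inf_le_right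
  rw [inf_relIndex_right, h2, hm] at h3
  obtain ⟨T, hT1, hT2, hT3, hT4⟩ := ih ((Sqr K).relIndex (SS t ⊓ A)) (by omega) (SS t ⊓ A) (insert t S)
    (inf_le_right.trans hAV) (le_inf (by rintro _ ⟨x, rfl⟩; exact sq_mem_SS t x) hA)
    (fun b hb => hAβ b hb.2) rfl (by omega)
  rw [Finset.disjoint_insert_right] at hT1
  refine ⟨insert t T, ?_, ?_, ?_, ?_⟩
  · rw [Finset.disjoint_insert_left]; exact ⟨htS, hT1.2⟩
  · intro s hs
    rcases Finset.mem_insert.1 hs with rfl | hs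
    · exact ⟨ht2, hβt⟩
    · exact hT2 s hs
  · rw [Finset.card_insert_of_notMem hT1.1, pow_succ, hT3, h3]
  · rintro x ⟨hx1, hx2⟩
    have hx2 := mem_SI.1 hx2
    refine hT4 ⟨⟨hx2 t (Finset.mem_insert_self _ _), hx1⟩, ?_⟩
    exact mem_SI.2 fun s hs => hx2 s (Finset.mem_insert_of_mem hs)
end
section
variable {K : Type} [Field K] [NumberField K]
lemma rel_le_of_inf {G : Type*} [Group G] {H A B : Subgroup G} (h : B ⊓ H ≤ A) (hne : H.relIndex B ≠ 0) :
    A.relIndex B ≠ 0 ∧ A.relIndex B ≤ H.relIndex B := by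
  rw [← inf_relIndex_left B H] at hne ⊢
  exact ⟨fun h0 => hne (relIndex_eq_zero_of_le_left h h0), relIndex_le_of_le_left h hne⟩
lemma indep [DecidableEq (Pr K)] (T' T0 : Finset (Pr K)) (hT : T0 ⊆ T') (hind : VT ∅ ⊓ SI T' ≤ Sqr K)
    (hc : 2 ^ T'.card = (Sqr K).relIndex (VT ∅)) : 2 ^ T0.card ≤ (SI T0).relIndex (VT ∅) := by
  have hev : ∀ T : Finset (Pr K), (SI T).relIndex (VT ∅) ≠ 0 ∧ (SI T).relIndex (VT ∅) ≤ 2 ^ T.card :=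
    fun T => SI_index T (VT ∅) fun a ha t _ => mem_VT.1 ha t (by simp)
  have h1 := (rel_le_of_inf hind (hev T').1).2
  have h2 : SI T0 ⊓ SI (T' \ T0) ≤ SI T' := fun a ha => mem_SI.2 fun t ht => by
    by_cases h : t ∈ T0
    · exact mem_SI.1 ha.1 t h
    · exact mem_SI.1 ha.2 t (Finset.mem_sdiff.2 ⟨ht, h⟩)
  have h3 : (SI T').relIndex (VT ∅) ≤ (SI T0 ⊓ SI (T' \ T0)).relIndex (VT ∅) :=
    relIndex_le_of_le_left h2 (relIndex_inf_ne_zero (hev T0).1 (hev _).1)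
  have h4 := relIndex_inf_le (H := SI T0) (K := SI (T' \ T0)) (L := VT ∅)
  have h5 := (hev (T' \ T0)).2
  have h6 : T'.card = T0.card + (T' \ T0).card := by
    rw [Finset.card_sdiff_of_subset hT]; have := Finset.card_le_card hT; omega
  rw [← hc, h6, pow_add] at h1
  have h7 : 2 ^ T0.card * 2 ^ (T' \ T0).card ≤ (SI T0).relIndex (VT ∅) * 2 ^ (T' \ T0).card :=
    h1.trans (h3.trans (h4.trans (Nat.mul_le_mul_left _ h5)))
  exact Nat.le_of_mul_le_mul_right h7 (by positivity)
variable {L : Type} [Field L] [NumberField L] [Algebra K L] {σ : L ≃ₐ[K] L}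
lemma Quad.fixed_eq (h : Quad σ) {P Q : Pr L} (hP : pact σ P = P) (hPQ : under K P = under K Q) : Q = P := by
  rcases h.over hPQ with h1 | h1
  · exact h1
  · rw [h1, hP]
lemma use1_aux [DecidableEq (Pr K)] [IsTotallyReal K] (T' Q : Finset (Pr K)) (hQ : Gen Q)
    (hind : VT ∅ ⊓ SI T' ≤ Sqr K)
    (hc : 2 ^ T'.card = (Sqr K).relIndex (VT ∅)) (hodd : ∀ q ∈ Q, (2 : 𝓞 K) ∉ q.asIdeal)
    (h : Quad σ) {α : Kˣ} {γ : L} (hγ : γ ^ 2 = algebraMap K L α) (hs : σ γ = -γ)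
    (hW : α ∈ WT T') (hS : α ∈ SI Q) : False := by
  classical
  haveI : IsTotallyReal L := TR_ext h hγ hs hW.2.1
  choose p hp using (fun t : Pr K => exists_over (L := L) t)
  set T0 := T'.filter (fun t => ¬ Even (ord t (α : K))) with hT0
  have hF : ∀ P : Pr L, pact σ P = P → P ∉ T0.image p → under K P ∉ Q ∧ ram K P = 1 := by
    intro P hP hPF
    refine ⟨fun hq => SS_not_fixed h hγ hs P (mem_SI.1 hS _ hq) (hodd _ hq) hP, ?_⟩
    refine ram_one_kummer h hγ hs P ?_ hW.2.2
    by_contra hne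
    by_cases hT : under K P ∈ T'
    · apply hPF
      refine Finset.mem_image.2 ⟨under K P, Finset.mem_filter.2 ⟨hT, hne⟩, h.fixed_eq hP (hp _).symm⟩
    · exact hne (mem_VT.1 hW.1 _ hT)
  obtain ⟨h0, h1⟩ := quadIdx h Q hQ (T0.image p) hF
  have h2 : (VT ∅).map (aK K L) ≤ Yg h := by
    rintro _ ⟨e, he, rfl⟩
    rw [mem_Yg]
    intro P _
    rw [ord_algebraMap]
    exact (mem_VT.1 he _ (by simp)).mul_left _
  have h3 : (nm (sA σ)).range.relIndex ((VT ∅).map (aK K L)) ≤ (nm (sA σ)).range.relIndex (Yg h) :=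
    relIndex_le_of_le_right h2 h0
  have h3' : (nm (sA σ)).range.relIndex ((VT ∅).map (aK K L)) ≠ 0 := fun h' =>
    h0 (relIndex_eq_zero_of_le_right h2 h')
  rw [← relIndex_comap] at h3 h3'
  have h4 : VT ∅ ⊓ (nm (sA σ)).range.comap (aK K L) ≤ SI T0 := by
    rintro e ⟨he, hn⟩
    refine mem_SI.2 fun t ht => ?_
    exact norm_SS h hγ hs t (Finset.mem_filter.1 ht).2 e (mem_VT.1 he _ (by simp)) hn
  have h5 := (rel_le_of_inf h4 h3').2
  have h6 := indep T' T0 (Finset.filter_subset _ _) hind hc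
  have h7 : 2 ^ (T0.image p).card ≤ 2 ^ T0.card := Nat.pow_le_pow_right (by norm_num) Finset.card_image_le
  have : 0 < 2 ^ T0.card := by positivity
  omega
lemma use1 [DecidableEq (Pr K)] [IsTotallyReal K] (hR : R2 K) (T' Q : Finset (Pr K)) (hQ : Gen Q)
    (hind : VT ∅ ⊓ SI T' ≤ Sqr K)
    (hc : 2 ^ T'.card = (Sqr K).relIndex (VT ∅)) (hodd : ∀ q ∈ Q, (2 : 𝓞 K) ∉ q.asIdeal)
    (hodd' : ∀ q ∈ T', (2 : 𝓞 K) ∉ q.asIdeal)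
    (hQT : Disjoint Q T') (hQc : 2 ^ Q.card ≤ cK K) : Gen T' := by
  have h1 : WT T' ⊓ SI Q ≤ Sqr K := by
    rintro α ⟨hW, hS⟩
    by_contra hα
    rw [mem_Sqr'] at hα
    obtain ⟨L, _, _, _, γ, σ, h, hγ, hs⟩ := exists_ext (α : K) hα
    exact use1_aux T' Q hQ hind hc hodd h hγ hs hW hS
  obtain ⟨h2, h3⟩ := SI_index Q (WT T') fun a ha t ht =>
    mem_VT.1 ha.1 t (Finset.disjoint_left.1 hQT ht)
  obtain ⟨h4, h5⟩ := rel_le_of_inf h1 h2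
  obtain ⟨h6, h7⟩ := WT_index hR T' hodd'
  have h8 := relIndex_mul_relIndex (Sqr K) (WT T') (VT T') (Sqr_le_WT T') inf_le_left
  have h9 := relIndex_mul_relIndex (Sqr K) (VT ∅) (VT T') (Sqr_le_VT ∅) (VT_mono (by simp))
  apply gen_of_count
  rw [← h8, v_eq] at h9
  rw [hc, v_eq]
  have hcK := Nat.pos_of_ne_zero (cK_ne (K := K))
  set n := Module.finrank ℚ K
  set X := (VT ∅).relIndex (VT T')
  have h10 : 2 ^ n * cK K * X ≤ cK K * 2 ^ (2 * n) := by
    rw [h9]; exact Nat.mul_le_mul (h5.trans (h3.trans hQc)) h7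
  have h11 : (2 ^ n * cK K) * X ≤ (2 ^ n * cK K) * 2 ^ n := by
    calc _ ≤ _ := h10
      _ = _ := by rw [two_mul, pow_add]; ring
  have h12 := Nat.le_of_mul_le_mul_left h11 (by positivity)
  exact Nat.mul_le_mul_right _ h12
theorem HN [IsTotallyReal L] (h : Quad σ) (hU : Unr K L) (hR : R2 K) (e : Kˣ)
    (he : ∀ P, pact σ P = P → Even (ord P (algebraMap K L e))) : ∃ y : Lˣ, y * sA σ y = aK K L e := by
  classical
  haveI : IsTotallyReal K := IsTotallyReal.of_algebra K L
  obtain ⟨c, hc⟩ := h.ne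
  obtain ⟨γ, hγ⟩ : ∃ γ, γ = c - σ c := ⟨_, rfl⟩
  have hγ0 : γ ≠ 0 := by rw [hγ]; exact sub_ne_zero.2 (Ne.symm hc)
  have hs : σ γ = -γ := by rw [hγ, map_sub, h.invol]; ring
  obtain ⟨b, hb⟩ := h.fix (x := γ ^ 2) (by rw [map_pow, hs]; ring)
  have hb0 : b ≠ 0 := by rintro rfl; simp only [map_zero] at hb; exact hγ0 (pow_eq_zero_iff two_ne_zero |>.1 hb.symm)
  obtain ⟨β, hβ⟩ : ∃ β : Kˣ, (β : K) = b := ⟨Units.mk0 b hb0, rfl⟩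
  rw [← hβ] at hb
  have hb := hb.symm
  have hβV : β ∈ VT ∅ := by
    rw [mem_VT]
    intro p _
    obtain ⟨P, hP⟩ := exists_over (L := L) p
    have h1 := ord_algebraMap P (β : K)
    rw [← hb, hU.ram P, ord_pow, hP] at h1
    exact ⟨ord P γ, by push_cast at h1; linarith⟩
  have hβS : β ∉ Sqr K := by
    rw [mem_Sqr']
    rintro ⟨r, hr⟩
    have hne := gam_ne hb hs
    rw [hr, map_mul, ← pow_two] at hb
    rcases sq_eq_sq_iff_eq_or_eq_neg.1 hb with h1 | h1 <;>
    · apply hne; rw [h1]; simp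
  obtain ⟨u, -, hu2, hu⟩ := inert β (by rwa [mem_Sqr'] at hβS) ∅ Set.finite_empty
  have hev : ∀ T : Finset (Pr K), (SI T).relIndex (VT ∅) ≠ 0 ∧ (SI T).relIndex (VT ∅) ≤ 2 ^ T.card :=
    fun T => SI_index T (VT ∅) fun a ha t _ => mem_VT.1 ha t (by simp)
  set A := VT ∅ ⊓ SI {u} with hA
  have hAS : Sqr K ≤ A := le_inf (Sqr_le_VT ∅) (Sqr_le_SI _)
  have hA2 : A.relIndex (VT ∅) = 2 := by
    have h1 := hev {u}
    rw [← inf_relIndex_left, ← hA] at h1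
    simp only [Finset.card_singleton, pow_one] at h1
    have h2 : A.relIndex (VT ∅) ≠ 1 := by
      rw [Ne, relIndex_eq_one]
      intro h2
      exact hu (mem_SI.1 (h2 hβV).2 u (by simp))
    omega
  have hm := relIndex_mul_relIndex (Sqr K) A (VT ∅) hAS inf_le_left
  rw [hA2] at hm
  have hv0 : (Sqr K).relIndex (VT ∅) ≠ 0 := by
    rw [v_eq]; exact Nat.mul_ne_zero (by positivity) cK_ne
  obtain ⟨T, hT1, hT2, hT3, hT4⟩ := sel_T h hb hs hβV _ A {u} inf_le_left hAS (by
    intro a ha hab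
    have h1 : a * β ∈ SS u := mem_SI.1 (Sqr_le_SI {u} hab) u (by simp)
    exact hu (((SS u).mul_mem_cancel_left (mem_SI.1 ha.2 u (by simp))).1 h1)) rfl (by
      intro h0; rw [h0] at hm; simp at hm; exact hv0 hm.symm)
  have huT : u ∉ T := fun h' => Finset.disjoint_left.1 hT1 h' (by simp)
  set T' := insert u T with hT'
  have hc : 2 ^ T'.card = (Sqr K).relIndex (VT ∅) := by
    rw [hT', Finset.card_insert_of_notMem huT, pow_succ, hT3, hm]
  have hind : VT ∅ ⊓ SI T' ≤ Sqr K := by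
    rintro a ⟨ha1, ha2⟩
    refine hT4 ⟨⟨ha1, mem_SI.2 fun t ht => mem_SI.1 ha2 t ?_⟩, mem_SI.2 fun t ht => mem_SI.1 ha2 t ?_⟩
    · rw [Finset.mem_singleton.1 ht]; exact Finset.mem_insert_self _ _
    · exact Finset.mem_insert_of_mem ht
  obtain ⟨Q, hQ1, hQ2, hQ3⟩ := exists_Q (T' ∪ (finite_over (K := K) (x := 2) two_ne_zero).toFinset)
  rw [Finset.disjoint_union_right] at hQ1
  have hG : Gen T' := use1 hR T' Q hQ3 hind hc
    (fun q hq h2 => Finset.disjoint_left.1 hQ1.2 hq (by simpa using h2))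
    (fun q hq => by
      rcases Finset.mem_insert.1 hq with rfl | hq
      · exact hu2
      · exact (hT2 q hq).1) hQ1.1 hQ2
  obtain ⟨p, hp⟩ := exists_over (L := L) u
  obtain ⟨i0, i1⟩ := quadIdx h T' hG {p} (by
    intro P hP hne
    refine ⟨fun hmem => ?_, hU.ram P⟩
    rcases Finset.mem_insert.1 hmem with h1 | h1
    · exact hne (Finset.mem_singleton.2 (h.fixed_eq hP (h1.trans hp.symm)).symm)
    · exact SS_not_fixed h hb hs P (hT2 _ h1).2 (hT2 _ h1).1 hP)
  have hi : (nm (sA σ)).range.relIndex (Yg h) = 1 := by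
    simp at i1; omega
  rw [relIndex_eq_one] at hi
  obtain ⟨y, hy⟩ := hi ((mem_Yg h e).2 he)
  exact ⟨y, hy⟩
end
section GS
variable {R : Type} [Ring R] (ε : R →+* ZMod 2)
variable {M N : Type} [AddCommGroup M] [Module R M] [AddCommGroup N] [Module R N]
/-- product of the augmentation ideal with a submodule -/
def Dm (S : Submodule R M) : Submodule R M := Submodule.span R {x | ∃ r, ∃ n ∈ S, ε r = 0 ∧ x = r • n}
lemma Dm_map (f : M →ₗ[R] N) (S : Submodule R M) : (Dm ε S).map f = Dm ε (S.map f) := by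
  rw [Dm, Dm, Submodule.map_span]
  congr 1
  ext x
  constructor
  · rintro ⟨_, ⟨r, n, hn, hr, rfl⟩, rfl⟩
    exact ⟨r, f n, ⟨n, hn, rfl⟩, hr, by simp⟩
  · rintro ⟨r, _, ⟨n, hn, rfl⟩, hr, rfl⟩
    exact ⟨r • n, ⟨r, n, hn, hr, rfl⟩, by simp⟩
lemma Dm_mono {S T : Submodule R M} (h : S ≤ T) : Dm ε S ≤ Dm ε T :=
  Submodule.span_mono fun _ ⟨r, n, hn, hr, hx⟩ => ⟨r, n, h hn, hr, hx⟩
lemma smul_mem_Dm {S : Submodule R M} {r : R} {n : M} (hr : ε r = 0) (hn : n ∈ S) : r • n ∈ Dm ε S :=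
  Submodule.subset_span ⟨r, n, hn, hr, rfl⟩
lemma Dmi_map (f : M →ₗ[R] N) (m : ℕ) (S : Submodule R M) :
    ((Dm ε)^[m] S).map f = (Dm ε)^[m] (S.map f) := by
  induction m with
  | zero => rfl
  | succ m ih => rw [Function.iterate_succ_apply', Function.iterate_succ_apply', Dm_map, ih]
lemma Dmi_mono (m : ℕ) {S T : Submodule R M} (h : S ≤ T) : (Dm ε)^[m] S ≤ (Dm ε)^[m] T := by
  induction m with
  | zero => exact h
  | succ m ih => rw [Function.iterate_succ_apply', Function.iterate_succ_apply']; exact Dm_mono ε ih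
lemma Dm_pi (d : ℕ) (S : Submodule R M) :
    Dm ε (Submodule.pi Set.univ fun _ : Fin d => S) = Submodule.pi Set.univ fun _ : Fin d => Dm ε S := by
  apply le_antisymm
  · rw [Dm, Submodule.span_le]
    rintro _ ⟨r, n, hn, hr, rfl⟩ i hi
    exact smul_mem_Dm ε hr (hn i hi)
  · intro x hx
    have : x = ∑ i, LinearMap.single R (fun _ : Fin d => M) i (x i) := by
      ext j; simp [Finset.sum_apply, Pi.single_apply]
    rw [this]
    refine Submodule.sum_mem _ fun i _ => ?_
    have h1 : LinearMap.single R (fun _ : Fin d => M) i (x i) ∈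
        (Dm ε S).map (LinearMap.single R (fun _ : Fin d => M) i) := ⟨_, hx i trivial, rfl⟩
    rw [Dm_map] at h1
    refine Dm_mono ε ?_ h1
    rintro _ ⟨y, hy, rfl⟩ j _
    by_cases hj : j = i
    · subst hj; simpa using hy
    · simp [Pi.single_eq_of_ne hj]
lemma Dmi_pi (d m : ℕ) (S : Submodule R M) :
    (Dm ε)^[m] (Submodule.pi Set.univ fun _ : Fin d => S) =
      Submodule.pi Set.univ fun _ : Fin d => (Dm ε)^[m] S := by
  induction m with
  | zero => rfl
  | succ m ih => simp only [Function.iterate_succ_apply']; rw [ih, Dm_pi]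
lemma Dmi_top (d m : ℕ) :
    (Dm ε)^[m] (⊤ : Submodule R (Fin d → R)) =
      Submodule.pi Set.univ fun _ : Fin d => (Dm ε)^[m] ⊤ := by
  rw [← Dmi_pi]; congr 1; ext x; simp
lemma card_pi (d : ℕ) (S : Submodule R M) :
    Nat.card (Submodule.pi Set.univ fun _ : Fin d => S : Submodule R (Fin d → M)) = Nat.card S ^ d := by
  have e : (Submodule.pi Set.univ fun _ : Fin d => S : Submodule R (Fin d → M)) ≃ (Fin d → S) :=
    { toFun := fun x i => ⟨x.1 i, x.2 i trivial⟩
      invFun := fun x => ⟨fun i => x i, fun i _ => (x i).2⟩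
      left_inv := fun _ => rfl
      right_inv := fun _ => rfl }
  rw [Nat.card_congr e, Nat.card_fun]; simp
lemma cm (f : M →ₗ[R] N) (S : Submodule R M) :
    Nat.card S = Nat.card (S.map f) * Nat.card (S ⊓ LinearMap.ker f : Submodule R M) := by
  have h1 := Submodule.card_eq_card_quotient_mul_card (LinearMap.ker (f.domRestrict S))
  rw [Nat.card_congr (f.domRestrict S).quotKerEquivRange.toEquiv, mul_comm] at h1
  rw [h1]
  congr 1
  · rw [LinearMap.range_domRestrict]
  · refine Nat.card_congr
      { toFun := fun x => ⟨x.1.1, x.1.2, x.2⟩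
        invFun := fun x => ⟨⟨x.1, x.2.1⟩, x.2.2⟩
        left_inv := fun _ => rfl
        right_inv := fun _ => rfl }
/-- Nakayama property -/
def NP : Prop := ∀ (M : Type) [AddCommGroup M] [Module R M] [Finite M] [Nontrivial M],
  ∃ φ : M →ₛₗ[ε] ZMod 2, φ ≠ 0
variable {ε}
lemma gens (hNP : NP ε) [Finite M] : ∃ (d : ℕ) (y : Fin d → M), Nat.card (M →ₛₗ[ε] ZMod 2) = 2 ^ d ∧
    Submodule.span R (Set.range y) = ⊤ ∧ ∀ c : Fin d → R, ∑ i, c i • y i = 0 → ∀ i, ε (c i) = 0 := by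
  classical
  haveI : Finite (M →ₛₗ[ε] ZMod 2) := Finite.of_injective (fun f => (f : M → ZMod 2)) DFunLike.coe_injective
  haveI := Fintype.ofFinite (M →ₛₗ[ε] ZMod 2)
  let b := Module.finBasis (ZMod 2) (M →ₛₗ[ε] ZMod 2)
  set d := Module.finrank (ZMod 2) (M →ₛₗ[ε] ZMod 2)
  let ev : M →+ (Fin d → ZMod 2) :=
    { toFun := fun m i => b i m
      map_zero' := by ext; simp
      map_add' := fun x y => by ext; simp }
  let evl : AddSubgroup (Fin d → ZMod 2) := ev.range
  have htop : AddSubgroup.toZModSubmodule 2 evl = ⊤ := by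
    by_contra hne
    obtain ⟨f, hf, hle⟩ := Submodule.exists_le_ker_of_lt_top _ (lt_top_iff_ne_top.2 hne)
    have h0 : ∑ i, f (Pi.single i 1) • b i = 0 := by
      ext m
      have h1 : f (ev m) = 0 := hle (show ev m ∈ AddSubgroup.toZModSubmodule 2 evl from ⟨m, rfl⟩)
      have h2 : ev m = ∑ i, (b i m) • (Pi.single i 1 : Fin d → ZMod 2) := by
        ext j; simp [Finset.sum_apply, Pi.single_apply, ev]
      rw [h2, map_sum] at h1
      simpa [LinearMap.sum_apply, mul_comm] using h1
    have h1 := Fintype.linearIndependent_iff.1 b.linearIndependent _ h0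
    apply hf
    refine LinearMap.pi_ext' fun i => ?_
    ext
    simpa using h1 i
  have hy : ∀ j : Fin d, ∃ y : M, ∀ i, b i y = if i = j then 1 else 0 := by
    intro j
    have h1 : (Pi.single j 1 : Fin d → ZMod 2) ∈ AddSubgroup.toZModSubmodule 2 evl := by rw [htop]; trivial
    obtain ⟨y, hy⟩ : (Pi.single j 1 : Fin d → ZMod 2) ∈ ev.range := h1
    exact ⟨y, fun i => by have := congrFun hy i; simpa [Pi.single_apply, ev] using this⟩
  choose y hy using hy
  refine ⟨d, y, ?_, ?_, ?_⟩
  · rw [Nat.card_eq_fintype_card, Module.card_eq_pow_finrank (K := ZMod 2), ZMod.card]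
  · by_contra hne
    haveI : Nontrivial (M ⧸ Submodule.span R (Set.range y)) := Submodule.Quotient.nontrivial_iff.2 hne
    haveI : Finite (M ⧸ Submodule.span R (Set.range y)) :=
      Finite.of_surjective _ (Submodule.mkQ_surjective _)
    obtain ⟨φ, hφ⟩ := hNP (M ⧸ Submodule.span R (Set.range y))
    let φ' : M →ₛₗ[ε] ZMod 2 := φ.comp (Submodule.mkQ _)
    have h1 : ∀ j, φ' (y j) = 0 := fun j => by
      change φ (Submodule.mkQ _ (y j)) = 0
      rw [show Submodule.mkQ (Submodule.span R (Set.range y)) (y j) = 0 from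
        (Submodule.Quotient.mk_eq_zero _).2 (Submodule.subset_span ⟨j, rfl⟩), map_zero]
    have h2 : φ' = 0 := by
      have h3 := b.sum_repr φ'
      have h4 : ∀ j, b.repr φ' j = 0 := fun j => by
        have h5 := DFunLike.congr_fun h3 (y j)
        rw [LinearMap.sum_apply, h1 j] at h5
        simpa [hy, -Module.Basis.sum_repr] using h5
      rw [← h3]; simp [h4]
    apply hφ
    ext x
    exact DFunLike.congr_fun h2 x
  · intro c hc i
    have := congrArg (b i) hc
    simpa [map_sum, LinearMap.map_smulₛₗ, hy] using this
lemma Dm_top : Dm ε (⊤ : Submodule R R) = RingHom.ker ε := by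
  apply le_antisymm
  · rw [Dm, Submodule.span_le]
    rintro _ ⟨r, n, hn, hr, rfl⟩
    simp [RingHom.mem_ker, hr]
  · intro x hx
    have := smul_mem_Dm ε (S := (⊤ : Submodule R R)) (r := x) (n := 1) hx trivial
    simpa using this
lemma card_ker [Finite R] : Nat.card R = 2 * Nat.card (RingHom.ker ε) := by
  have h1 := AddSubgroup.index_mul_card (ε : R →+ ZMod 2).ker
  have h2 : (ε : R →+ ZMod 2).ker.index = 2 := by
    rw [AddSubgroup.index_ker]
    have : (ε : R →+ ZMod 2).range = ⊤ := by
      rw [AddMonoidHom.range_eq_top]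
      exact ZMod.ringHom_surjective ε
    rw [this]; simp
  rw [h2] at h1
  exact h1.symm
lemma real_gs (d r : ℕ) (hd : 2 ≤ d) (hr : 4 * r ≤ d * d) (l : ℕ → ℝ) (B : ℝ) (hB : ∀ m, l m ≤ B) (h0 : l 0 = 0)
    (h1 : l 1 = 1) (h : ∀ m, d * l (m + 1) + 1 ≤ r * l m + l (m + 2)) (hn : ∀ m, 0 ≤ l m) : False := by
  have hd' : (2 : ℝ) ≤ d := by exact_mod_cast hd
  have hr' : 4 * (r : ℝ) ≤ d * d := by exact_mod_cast hr
  have h2 : ∀ m, l (m + 1) ≥ d / 2 * l m + 1 := by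
    intro m
    induction m with
    | zero => rw [h0, zero_add, h1]; simp
    | succ m ih =>
      have h3 := h m
      have h4 : (r : ℝ) * l m ≤ d / 2 * (d / 2 * l m) := by nlinarith [hn m]
      have h5 : (d : ℝ) / 2 * (d / 2 * l m + 1) ≤ d / 2 * l (m + 1) :=
        mul_le_mul_of_nonneg_left ih (by positivity)
      nlinarith
  have h3 : ∀ m : ℕ, (m : ℝ) ≤ l m := by
    intro m
    induction m with
    | zero => simp [h0]
    | succ m ih =>
      have := h2 m
      have h6 := hn m
      push_cast
      nlinarith
  obtain ⟨n, hn⟩ := exists_nat_gt B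
  linarith [h3 n, hB n]
theorem GS [Finite R] (hNP : NP ε) (d : ℕ) (hd : 2 ≤ d)
    (hcard : Nat.card (RingHom.ker ε →ₛₗ[ε] ZMod 2) = 2 ^ d) :
    ∃ π : (Fin d → R) →ₗ[R] R, LinearMap.range π = RingHom.ker ε ∧
      (∀ z, π z = 0 → ∀ i, ε (z i) = 0) ∧
      2 ^ (d * d) < Nat.card (LinearMap.ker π →ₛₗ[ε] ZMod 2) ^ 4 := by
  obtain ⟨d', y, hy1, hy2, hy3⟩ := gens (M := RingHom.ker ε) hNP
  obtain rfl : d' = d := Nat.pow_right_injective (le_refl 2) (hy1.symm.trans hcard)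
  let π : (Fin d' → R) →ₗ[R] R := Fintype.linearCombination R (fun i => (y i : R))
  have hπ : ∀ z, π z = ∑ i, z i * (y i : R) := fun z => by simp [π, Fintype.linearCombination_apply]
  have hrange : LinearMap.range π = RingHom.ker ε := by
    rw [Fintype.range_linearCombination]
    have := congrArg (Submodule.map (Submodule.subtype (RingHom.ker ε))) hy2
    rw [Submodule.map_span, ← Set.range_comp, Submodule.map_top, Submodule.range_subtype] at this
    exact this
  refine ⟨π, hrange, ?_, ?_⟩
  · intro z hz
    apply hy3
    apply Subtype.ext
    rw [hπ] at hz
    simpa using hz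
  obtain ⟨r, u, hu1, hu2, -⟩ := gens (M := LinearMap.ker π) hNP
  rw [hu1]
  by_contra hlt
  have hr : 4 * r ≤ d' * d' := by
    rw [not_lt, ← pow_mul] at hlt
    have := (Nat.pow_le_pow_iff_right (le_refl 2)).1 hlt
    omega
  let q : (Fin r → R) →ₗ[R] (Fin d' → R) := Fintype.linearCombination R (fun i => (u i : Fin d' → R))
  have hq : LinearMap.range q = LinearMap.ker π := by
    rw [Fintype.range_linearCombination]
    have := congrArg (Submodule.map (Submodule.subtype (LinearMap.ker π))) hu2
    rw [Submodule.map_span, ← Set.range_comp, Submodule.map_top, Submodule.range_subtype] at this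
    exact this
  set J : ℕ → ℕ := fun m => Nat.card ((Dm ε)^[m] (⊤ : Submodule R R)) with hJ
  have hJpos : ∀ m, 0 < J m := fun m => Nat.card_pos
  have hJ0 : J 0 = Nat.card R := by simp [hJ]
  have hJ1 : J 0 = 2 * J 1 := by
    rw [hJ0, card_ker (ε := ε)]; simp only [hJ, Function.iterate_one]; rw [Dm_top]
  have hKpos : 0 < Nat.card (LinearMap.ker π) := Nat.card_pos
  have e1 : J 0 ^ d' = J 1 * Nat.card (LinearMap.ker π) := by
    have := cm π ⊤
    rw [Submodule.map_top, hrange, ← Dm_top, top_inf_eq] at this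
    rw [hJ0]
    rw [← show Nat.card (⊤ : Submodule R (Fin d' → R)) = Nat.card R ^ d' by simp [Nat.card_fun]]
    exact this
  have e2 : J 0 ^ r = Nat.card (LinearMap.ker π) * Nat.card (LinearMap.ker q) := by
    have := cm q ⊤
    rw [Submodule.map_top, hq, top_inf_eq] at this
    rw [hJ0]
    rw [← show Nat.card (⊤ : Submodule R (Fin r → R)) = Nat.card R ^ r by simp [Nat.card_fun]]
    exact this
  have e3 : ∀ m, J m ^ r ≤ Nat.card ((Dm ε)^[m] (LinearMap.ker π)) * Nat.card (LinearMap.ker q) := by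
    intro m
    have := cm q ((Dm ε)^[m] ⊤)
    rw [Dmi_map, Submodule.map_top, hq, Dmi_top, card_pi] at this
    rw [hJ, this]
    exact Nat.mul_le_mul_left _ (Nat.card_mono (Set.toFinite _) inf_le_right)
  have e4 : ∀ m, J (m + 2) * Nat.card ((Dm ε)^[m] (LinearMap.ker π)) ≤ J (m + 1) ^ d' := by
    intro m
    have := cm π ((Dm ε)^[m + 1] ⊤)
    rw [Dmi_map, Submodule.map_top, hrange, ← Dm_top, ← Function.iterate_succ_apply] at this
    have h1 : (Dm ε)^[m] (LinearMap.ker π) ≤ (Dm ε)^[m + 1] ⊤ ⊓ LinearMap.ker π := by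
      refine le_inf ?_ ?_
      · rw [Function.iterate_succ_apply]
        refine Dmi_mono ε m ?_
        have h2 := Dmi_top ε d' 1
        rw [Function.iterate_one] at h2
        rw [h2]
        intro z hz i _
        simp only [Function.iterate_one, Dm_top]
        refine hy3 z ?_ i
        apply Subtype.ext
        have hz' : π z = 0 := hz
        rw [hπ] at hz'
        simpa using hz'
      · have : ∀ n, (Dm ε)^[n] (LinearMap.ker π) ≤ LinearMap.ker π := by
          intro n
          induction n with
          | zero => exact le_rfl
          | succ n ih =>
            rw [Function.iterate_succ_apply', Dm, Submodule.span_le]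
            rintro _ ⟨r, n, hn, hr, rfl⟩
            exact Submodule.smul_mem _ _ (ih hn)
        exact this m
    rw [Dmi_top, card_pi, ← Dmi_top] at this
    rw [hJ]
    dsimp only
    rw [this]
    exact Nat.mul_le_mul_left _ (Nat.card_mono (Set.toFinite _) h1)
  have key : ∀ m, 2 * (J (m + 2) * J m ^ r * J 0 ^ d') ≤ J (m + 1) ^ d' * (J 0 ^ r * J 0) := by
    intro m
    have hk := Nat.mul_le_mul (e4 m) (Nat.mul_le_mul (e3 m) (le_refl (J 0 ^ d' * 2)))
    have hX : 0 < Nat.card ((Dm ε)^[m] (LinearMap.ker π)) := Nat.card_pos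
    refine Nat.le_of_mul_le_mul_left ?_ hX
    calc _ = J (m + 2) * Nat.card ((Dm ε)^[m] (LinearMap.ker π)) * (J m ^ r * (J 0 ^ d' * 2)) := by ring
      _ ≤ _ := hk
      _ = _ := by rw [e1, e2, hJ1]; ring
  have hJR : ∀ m, (0 : ℝ) < J m := fun m => by exact_mod_cast hJpos m
  have hJle : ∀ m, J m ≤ J 0 := fun m => by rw [hJ0]; exact Finite.card_subtype_le _
  refine real_gs d' r hd hr (fun m => Real.logb 2 (J 0) - Real.logb 2 (J m)) (Real.logb 2 (J 0)) ?_ ?_ ?_ ?_ ?_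
  · intro m
    have : 0 ≤ Real.logb 2 (J m) := Real.logb_nonneg (by norm_num) (by exact_mod_cast hJpos m)
    linarith
  · simp
  · rw [hJ1]; push_cast
    rw [Real.logb_mul (by norm_num) (hJR 1).ne']
    simp
  · intro m
    have hk : (2 : ℝ) * (J (m + 2) * J m ^ r * J 0 ^ d') ≤ J (m + 1) ^ d' * (J 0 ^ r * J 0) := by
      exact_mod_cast key m
    have hk2 := Real.logb_le_logb_of_le (b := 2) (by norm_num)
      (mul_pos two_pos (mul_pos (mul_pos (hJR _) (pow_pos (hJR _) _)) (pow_pos (hJR _) _))) hk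
    have p1 := (hJR (m+1)).ne'
    have p2 := (hJR (m+2)).ne'
    have p3 := (hJR m).ne'
    have p4 := (hJR 0).ne'
    rw [Real.logb_mul (by norm_num) (by positivity), Real.logb_mul (by positivity) (by positivity),
      Real.logb_mul (by positivity) (by positivity), Real.logb_mul (by positivity) (by positivity),
      Real.logb_mul (by positivity) (by positivity), Real.logb_pow, Real.logb_pow, Real.logb_pow,
      Real.logb_pow, Real.logb_self_eq_one (by norm_num)] at hk2
    linarith
  · intro m
    have := Real.logb_le_logb_of_le (b := 2) (by norm_num) (hJR m) (by exact_mod_cast hJle m : (J m : ℝ) ≤ J 0)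
    linarith
end GS
section GP
variable (G : Type) [Group G]
abbrev GA := MonoidAlgebra (ZMod 2) G
variable {G}
noncomputable def go (g : G) : GA G := MonoidAlgebra.of (ZMod 2) G g
lemma go_mul (g h : G) : go (g * h) = go g * go h := map_mul _ _ _
lemma go_one : go (1 : G) = 1 := map_one _
lemma single_eq (g : G) (a : ZMod 2) : (MonoidAlgebra.single g a : GA G) = a • go g := by
  simp [go]
noncomputable def aug : GA G →+* ZMod 2 := (MonoidAlgebra.lift (ZMod 2) (ZMod 2) G 1).toRingHom
@[simp] lemma aug_single (g : G) (a : ZMod 2) : aug (MonoidAlgebra.single g a : GA G) = a := by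
  change MonoidAlgebra.lift (ZMod 2) (ZMod 2) G 1 _ = a
  rw [MonoidAlgebra.lift_single]; simp
@[simp] lemma aug_go (g : G) : aug (go g) = 1 := aug_single g 1
instance [Finite G] : Finite (GA G) := by
  haveI : Finite (G →₀ ZMod 2) := Finite.of_injective (fun f => (f : G → ZMod 2)) DFunLike.coe_injective
  exact Finite.of_injective MonoidAlgebra.coeff fun a b h => by
    cases a; cases b; simp_all
variable {M : Type} [AddCommGroup M] [Module (GA G) M]
lemma inv_semi (f : M →+ ZMod 2) (hf : ∀ (g : G) (m : M), f (go g • m) = f m) (r : GA G) (m : M) :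
    f (r • m) = aug r * f m := by
  induction r using MonoidAlgebra.induction_linear with
  | zero => simp
  | add x y hx hy => rw [add_smul, map_add, hx, hy, map_add, add_mul]
  | single g a =>
    rw [aug_single, single_eq]
    rcases (by decide : ∀ a : ZMod 2, a = 0 ∨ a = 1) a with rfl | rfl
    · rw [zero_smul, zero_smul, zero_mul, map_zero]
    · rw [one_smul, one_mul, hf]
noncomputable def mkSemi (f : M →+ ZMod 2) (hf : ∀ (g : G) (m : M), f (go g • m) = f m) : M →ₛₗ[aug (G := G)] ZMod 2 where
  toFun := f
  map_add' := map_add f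
  map_smul' r m := by rw [inv_semi f hf]; rfl
lemma np_aug (hG : IsPGroup 2 G) : NP (aug (G := G)) := by
  intro M _ _ _ _
  letI : Module (ZMod 2) M := Module.compHom M (algebraMap (ZMod 2) (GA G))
  letI : MulAction G (M →+ ZMod 2) :=
    { smul := fun g f => f.comp (DistribSMul.toAddMonoidHom M (go g⁻¹))
      one_smul := fun f => by
        ext m; change f (go (1 : G)⁻¹ • m) = f m; rw [inv_one, go_one, one_smul]
      mul_smul := fun g h f => by
        ext m; change f (go (g * h)⁻¹ • m) = f (go h⁻¹ • go g⁻¹ • m)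
        rw [mul_inv_rev, go_mul, mul_smul] }
  have hs : ∀ (g : G) (f : M →+ ZMod 2) (m : M), (g • f) m = f (go g⁻¹ • m) := fun _ _ _ => rfl
  haveI : Finite (M →+ ZMod 2) := Finite.of_injective (fun f => (f : M → ZMod 2)) DFunLike.coe_injective
  obtain ⟨f, hf, -⟩ := Submodule.exists_le_ker_of_lt_top (⊥ : Submodule (ZMod 2) M) bot_lt_top
  have h2 : 2 ∣ Nat.card (M →+ ZMod 2) := by
    have h3 : addOrderOf (f : M →+ ZMod 2) = 2 := by
      apply addOrderOf_eq_prime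
      · ext m; exact CharTwo.two_nsmul (f m)
      · intro h0; apply hf; ext m; exact DFunLike.congr_fun h0 m
    have h4 := addOrderOf_dvd_natCard (f : M →+ ZMod 2)
    rwa [h3] at h4
  haveI : Fact (Nat.Prime 2) := ⟨Nat.prime_two⟩
  obtain ⟨b, hb, hb0⟩ := hG.exists_fixed_point_of_prime_dvd_card_of_fixed_point (M →+ ZMod 2) h2
    (a := 0) (by intro g; ext m; rw [hs]; rfl)
  refine ⟨mkSemi b fun g m => ?_, fun h0 => hb0 ?_⟩
  · have := DFunLike.congr_fun (hb g⁻¹) m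
    rw [hs, inv_inv] at this; exact this
  · ext m; exact (DFunLike.congr_fun h0 m).symm
/-- additive extension of a function on G -/
noncomputable def lin {T : Type} [AddCommGroup T] [Module (ZMod 2) T] (t : G → T) : GA G →+ T where
  toFun a := Finsupp.linearCombination (ZMod 2) t a.coeff
  map_zero' := by simp
  map_add' a b := by simp
lemma lin_single {T : Type} [AddCommGroup T] [Module (ZMod 2) T] (t : G → T) (g : G) (a : ZMod 2) :
    lin t (MonoidAlgebra.single g a) = a • t g := by simp [lin]
def e2 : ℤˣ ≃* Multiplicative (ZMod 2) where
  toFun u := if u = 1 then 1 else Multiplicative.ofAdd 1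
  invFun a := if a = 1 then 1 else -1
  left_inv := by decide
  right_inv := by decide
  map_mul' := by decide
lemma lin_go_mul {T : Type} [AddCommGroup T] [Module (ZMod 2) T] (t : G → T) (g : G) (w : GA G) :
    lin t (go g * w) = lin (fun h => t (g * h)) w := by
  induction w using MonoidAlgebra.induction_linear with
  | zero => simp
  | add x y hx hy => rw [mul_add, map_add, hx, hy, map_add]
  | single h a =>
    rw [lin_single, go, MonoidAlgebra.of_apply, MonoidAlgebra.single_mul_single, lin_single, one_mul]
lemma lin_add {T : Type} [AddCommGroup T] [Module (ZMod 2) T] (t t' : G → T) (w : GA G) :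
    lin (fun h => t h + t' h) w = lin t w + lin t' w := by
  induction w using MonoidAlgebra.induction_linear with
  | zero => simp
  | add x y hx hy => simp only [map_add, hx, hy]; abel
  | single h a => simp only [lin_single, smul_add]
lemma lin_const {T : Type} [AddCommGroup T] [Module (ZMod 2) T] (t : T) (w : GA G) :
    lin (fun _ => t) w = aug w • t := by
  induction w using MonoidAlgebra.induction_linear with
  | zero => simp
  | add x y hx hy => simp only [map_add, hx, hy, add_smul]
  | single h a => simp only [lin_single, aug_single]
lemma lin_map {T T' : Type} [AddCommGroup T] [Module (ZMod 2) T] [AddCommGroup T'] [Module (ZMod 2) T']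
    (f : T →+ T') (t : G → T) (w : GA G) :
    f (lin t w) = lin (fun h => f (t h)) w := by
  induction w using MonoidAlgebra.induction_linear with
  | zero => simp
  | add x y hx hy => simp only [map_add, hx, hy]
  | single h a => 
    simp only [lin_single]
    rcases (by decide : ∀ a : ZMod 2, a = 0 ∨ a = 1) a with rfl | rfl
    · rw [zero_smul, zero_smul, map_zero]
    · rw [one_smul, one_smul]
lemma lin_id (w : GA G) : lin (fun h => (go h : GA G)) w = w := by
  induction w using MonoidAlgebra.induction_linear with
  | zero => simp
  | add x y hx hy => simp only [map_add, hx, hy]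
  | single h a => rw [lin_single, single_eq]
lemma card_hom_le [Finite G] :
    Nat.card (G →* ℤˣ) ≤ Nat.card (RingHom.ker (aug (G := G)) →ₛₗ[aug (G := G)] ZMod 2) := by
  haveI : Finite (RingHom.ker (aug (G := G)) →ₛₗ[aug (G := G)] ZMod 2) :=
    Finite.of_injective (fun f => (f : RingHom.ker (aug (G := G)) → ZMod 2)) DFunLike.coe_injective
  let X : (G →* ℤˣ) → G → ZMod 2 := fun χ g => Multiplicative.toAdd (e2 (χ g))
  have hX : ∀ χ g h, X χ (g * h) = X χ g + X χ h := fun χ g h => by simp [X]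
  refine Nat.card_le_card_of_injective
    (fun χ => mkSemi ((lin (X χ)).comp (Submodule.subtype (RingHom.ker (aug (G := G)))).toAddMonoidHom) (by
    rintro g ⟨w, hw⟩
    change lin (X χ) (go g * w) = lin (X χ) w
    rw [lin_go_mul]
    simp only [hX]
    rw [lin_add, lin_const, show aug w = 0 from hw]; simp)) ?_
  · intro χ χ' h
    ext g
    have hm : go g - go 1 ∈ RingHom.ker (aug (G := G)) := by simp [RingHom.mem_ker]
    have h1 : lin (X χ) (go g - go 1) = lin (X χ') (go g - go 1) := DFunLike.congr_fun h ⟨_, hm⟩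
    have h2 : ∀ χ, lin (X χ) (go g - go 1) = X χ g := fun χ => by
      rw [map_sub, go, go, MonoidAlgebra.of_apply, MonoidAlgebra.of_apply, lin_single, lin_single]
      simp [X]
    rw [h2, h2] at h1
    have := e2.injective (Multiplicative.toAdd.injective h1)
    rw [this]
variable {d : ℕ} (π : (Fin d → GA G) →ₗ[GA G] GA G)
def Gam := {p : (Fin d → GA G) × G // π p.1 = go p.2 - 1}
noncomputable instance : Group (Gam π) :=
  letI : Mul (Gam π) := ⟨fun p q => ⟨(p.1.1 + go p.1.2 • q.1.1, p.1.2 * q.1.2), by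
    change π (p.1.1 + go p.1.2 • q.1.1) = go (p.1.2 * q.1.2) - 1
    rw [map_add, map_smul, p.2, q.2, go_mul, smul_eq_mul, mul_sub]; simp⟩⟩
  letI : One (Gam π) := ⟨⟨(0, 1), by change π 0 = go 1 - 1; rw [map_zero, go_one, sub_self]⟩⟩
  letI : Inv (Gam π) := ⟨fun p => ⟨(-(go p.1.2⁻¹ • p.1.1), p.1.2⁻¹), by
    change π (-(go p.1.2⁻¹ • p.1.1)) = go p.1.2⁻¹ - 1
    rw [map_neg, map_smul, p.2, smul_eq_mul, mul_sub, ← go_mul, inv_mul_cancel, go_one]; simp⟩⟩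
  Group.ofLeftAxioms
    (fun a b c => Subtype.ext (Prod.ext (by
      change (a.1.1 + go a.1.2 • b.1.1) + go (a.1.2 * b.1.2) • c.1.1 =
        a.1.1 + go a.1.2 • (b.1.1 + go b.1.2 • c.1.1)
      rw [go_mul, mul_smul, smul_add, add_assoc]) (mul_assoc _ _ _)))
    (fun a => Subtype.ext (Prod.ext (by
      change 0 + go 1 • a.1.1 = a.1.1
      rw [go_one, one_smul, zero_add]) (one_mul _)))
    (fun a => Subtype.ext (Prod.ext (by
      change -(go a.1.2⁻¹ • a.1.1) + go a.1.2⁻¹ • a.1.1 = 0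
      exact neg_add_cancel _) (inv_mul_cancel _)))
variable {π}
lemma Gam.mul_fst (p q : Gam π) : (p * q).1.1 = p.1.1 + go p.1.2 • q.1.1 := rfl
lemma Gam.mul_snd (p q : Gam π) : (p * q).1.2 = p.1.2 * q.1.2 := rfl
lemma Gam.ext' {p q : Gam π} (h1 : p.1.1 = q.1.1) (h2 : p.1.2 = q.1.2) : p = q :=
  Subtype.ext (Prod.ext h1 h2)
instance [Finite G] : Finite (Gam π) := inferInstanceAs (Finite (Subtype _))
def Gam.pr : Gam π →* G where
  toFun p := p.1.2
  map_one' := rfl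
  map_mul' _ _ := rfl
def Gam.mk (y : Fin d → GA G) (g : G) (h : π y = go g - 1) : Gam π := ⟨(y, g), h⟩
def Gam.inK (y : Fin d → GA G) (h : π y = 0) : Gam π := ⟨(y, 1), by
  change π y = go 1 - 1; rw [h, go_one, sub_self]⟩
lemma Gam.triv (hr : LinearMap.range π = RingHom.ker (aug (G := G)))
    (hmin : ∀ z, π z = 0 → ∀ i, aug (z i) = 0) (χ : Gam π →* ℤˣ) (p : Gam π) (hp : p.1.2 = 1) :
    χ p = 1 := by
  classical
  let c : Gam π → ZMod 2 := fun p => Multiplicative.toAdd (e2 (χ p))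
  have hc : ∀ p q, c (p * q) = c p + c q := fun p q => by simp [c]
  have hgo : ∀ g : G, ∃ y, π y = go g - 1 := fun g => by
    have : go g - 1 ∈ LinearMap.range π := by rw [hr, RingHom.mem_ker]; simp
    exact this
  choose s hs using hgo
  have haug : ∀ y, aug (π y) = 0 := fun y => by
    have : π y ∈ RingHom.ker (aug (G := G)) := hr ▸ LinearMap.mem_range_self π y
    exact this
  let m : G → Gam π := fun g => Gam.mk (s g) g (hs g)
  let S : GA G →+ (Fin d → GA G) := lin s
  let X : GA G →+ ZMod 2 := lin fun g => c (m g)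
  let ψ : LinearMap.ker π →+ ZMod 2 := AddMonoidHom.mk' (fun y => c (Gam.inK y.1 y.2)) (by
    intro a b
    rw [← hc]; congr 1
    exact Gam.ext' (by rw [Gam.mul_fst]; change a.1 + b.1 = a.1 + go 1 • b.1; rw [go_one, one_smul])
      (mul_one (1 : G)).symm)
  have hψ : ∀ (y) (h : π y = 0), ψ ⟨y, h⟩ = c (Gam.inK y h) := fun _ _ => rfl
  have hS : ∀ w, π (S w) = w - aug w • 1 := fun w => by
    have h1 := lin_map π.toAddMonoidHom s w
    change π (S w) = lin (fun h => π (s h)) w at h1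
    simp only [hs, sub_eq_add_neg] at h1
    rw [h1, lin_add, lin_id, lin_const, smul_neg, sub_eq_add_neg]
  have hSπ : ∀ y, π (y - S (π y)) = 0 := fun y => by
    rw [map_sub, hS, haug, zero_smul, sub_zero, sub_self]
  let Θ : (Fin d → GA G) →+ ZMod 2 := AddMonoidHom.mk' (fun y => ψ ⟨y - S (π y), hSπ y⟩ + X (π y)) (by
    intro a b
    have : (⟨a + b - S (π (a + b)), hSπ _⟩ : LinearMap.ker π) = ⟨a - S (π a), hSπ a⟩ + ⟨b - S (π b), hSπ b⟩ := by
      apply Subtype.ext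
      change a + b - S (π (a + b)) = a - S (π a) + (b - S (π b))
      rw [map_add, map_add]; abel
    rw [this, map_add, map_add, map_add]; abel)
  have hΘ : ∀ y, Θ y = ψ ⟨y - S (π y), hSπ y⟩ + X (π y) := fun _ => rfl
  have hψg : ∀ (g : G) (y : LinearMap.ker π), ψ (go g • y) = ψ y := fun g y => by
    have : m g * Gam.inK y.1 y.2 = Gam.inK (go g • y).1 (go g • y).2 * m g := by
      refine Gam.ext' ?_ ?_
      · rw [Gam.mul_fst, Gam.mul_fst]
        change s g + go g • y.1 = go g • y.1 + go (1 : G) • s g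
        rw [go_one, one_smul, add_comm]
      · change g * 1 = 1 * g
        simp
    have h2 := congrArg c this
    rw [hc, hc, add_comm] at h2
    exact (add_right_cancel h2).symm
  have hκ : ∀ g h, π (go g • s h + (s g + -s (g * h))) = 0 := fun g h => by
    rw [map_add, map_add, map_neg, map_smul, hs, hs, hs, go_mul, smul_eq_mul, mul_sub]; simp
  have hψκ : ∀ g h, ψ ⟨_, hκ g h⟩ = c (m h) + (c (m g) + -c (m (g * h))) := fun g h => by
    have : m g * m h = Gam.inK _ (hκ g h) * m (g * h) := by
      refine Gam.ext' ?_ ?_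
      · rw [Gam.mul_fst, Gam.mul_fst]
        change s g + go g • s h = go g • s h + (s g + -s (g * h)) + go (1 : G) • s (g * h)
        rw [go_one, one_smul]; abel
      · exact (one_mul (g * h)).symm
    have h2 := congrArg c this
    rw [hc, hc] at h2
    rw [hψ]
    linear_combination -h2
  have hinv : ∀ (g : G) (y : Fin d → GA G), Θ (go g • y) = Θ y := fun g y => by
    rw [hΘ, hΘ, ← hψg g ⟨y - S (π y), hSπ y⟩]
    have hw := haug y
    let κ : G → LinearMap.ker π := fun h => ⟨_, hκ g h⟩
    have h1 : (⟨go g • y - S (π (go g • y)), hSπ _⟩ : LinearMap.ker π) =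
        go g • ⟨y - S (π y), hSπ y⟩ + lin κ (π y) := by
      apply Subtype.ext
      have h2 := lin_map (LinearMap.ker π).subtype.toAddMonoidHom κ (π y)
      change (lin κ (π y)).1 = lin (fun h => go g • s h + (s g + -s (g * h))) (π y) at h2
      change go g • y - S (π (go g • y)) = go g • (y - S (π y)) + (lin κ (π y)).1
      have h3 := lin_map (DistribSMul.toAddMonoidHom (Fin d → GA G) (go g)) s (π y)
      change go g • S (π y) = lin (fun h => go g • s h) (π y) at h3
      have h4 := lin_map (-AddMonoidHom.id (Fin d → GA G)) (fun h => s (g * h)) (π y)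
      change - lin (fun h => s (g * h)) (π y) = lin (fun h => - s (g * h)) (π y) at h4
      rw [h2, lin_add, lin_add, lin_const, hw, zero_smul, ← h3, ← h4, map_smul, smul_eq_mul, smul_sub,
        show S (go g * π y) = _ from lin_go_mul s g (π y)]
      abel
    have h5 := lin_map ψ κ (π y)
    simp only [κ, hψκ] at h5
    have h4 := lin_map (-AddMonoidHom.id (ZMod 2)) (fun h => c (m (g * h))) (π y)
    change - lin (fun h => c (m (g * h))) (π y) = lin (fun h => - c (m (g * h))) (π y) at h4
    rw [lin_add, lin_add, lin_const, hw, zero_smul, ← h4] at h5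
    rw [h1, map_add, h5, LinearMap.map_smul, smul_eq_mul, show X (go g * π y) = _ from lin_go_mul _ g (π y)]
    change _ + (X (π y) + _) + _ = _
    abel
  have hz : π p.1.1 = 0 := by rw [p.2, hp, go_one, sub_self]
  have h6 : Θ p.1.1 = 0 := by
    rw [pi_eq_sum_univ' p.1.1, map_sum]
    refine Finset.sum_eq_zero fun i _ => ?_
    rw [inv_semi Θ hinv, hmin _ hz, zero_mul]
  have h7 : Θ p.1.1 = c p := by
    rw [hΘ]
    have : (⟨p.1.1 - S (π p.1.1), hSπ _⟩ : LinearMap.ker π) = ⟨p.1.1, hz⟩ :=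
      Subtype.ext (by change _ - S (π p.1.1) = _; rw [hz, map_zero, sub_zero])
    rw [this, hz, map_zero, add_zero, hψ]
    congr 1
    exact Gam.ext' rfl hp.symm
  rw [h6] at h7
  have : e2 (χ p) = 1 := Multiplicative.toAdd.injective h7.symm
  simpa using this
theorem GSpack [Finite G] (hG : IsPGroup 2 G) : ∃ d : ℕ, Nat.card (G →* ℤˣ) ≤ 2 ^ d ∧ (2 ≤ d →
    ∃ (Γ : Type) (_ : Group Γ) (_ : Finite Γ) (ρ : Γ →* G), Function.Surjective ρ ∧
      (∀ χ : Γ →* ℤˣ, ∀ x, ρ x = 1 → χ x = 1) ∧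
      2 ^ (d * d) < (Nat.card {ψ : ρ.ker →* ℤˣ //
        ∀ (γ : Γ) (x y : ρ.ker), (y : Γ) = γ * x * γ⁻¹ → ψ y = ψ x}) ^ 4) := by
  have hNP := np_aug hG
  obtain ⟨d, -, hd, -⟩ := gens (M := RingHom.ker (aug (G := G))) hNP
  refine ⟨d, hd ▸ card_hom_le, fun h2 => ?_⟩
  obtain ⟨π, hr, hmin, hlt⟩ := GS hNP d h2 hd
  refine ⟨Gam π, inferInstance, inferInstance, Gam.pr, fun g => ?_, fun χ x hx => Gam.triv hr hmin χ x hx, ?_⟩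
  · have : go g - 1 ∈ LinearMap.range π := by rw [hr, RingHom.mem_ker]; simp
    obtain ⟨y, hy⟩ := this
    exact ⟨Gam.mk y g hy, rfl⟩
  · refine hlt.trans_le (Nat.pow_le_pow_left ?_ 4)
    have hk : ∀ x : (Gam.pr (π := π)).ker, x.1.1.2 = 1 := fun x => x.2
    have hk0 : ∀ x : (Gam.pr (π := π)).ker, π x.1.1.1 = 0 := fun x => by
      rw [x.1.2, hk, go_one, sub_self]
    haveI : Finite ((Gam.pr (π := π)).ker →* ℤˣ) :=
      Finite.of_injective (fun f => (f : (Gam.pr (π := π)).ker → ℤˣ)) DFunLike.coe_injective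
    have hfm : ∀ (f : LinearMap.ker π →ₛₗ[aug (G := G)] ZMod 2) (g : G) (y : LinearMap.ker π), f (go g • y) = f y := by
      intro f g y; rw [map_smulₛₗ, aug_go, one_smul]
    refine Nat.card_le_card_of_injective (fun f => ⟨
      { toFun := fun x => e2.symm (Multiplicative.ofAdd (f ⟨x.1.1.1, hk0 x⟩))
        map_one' := by
          have : (⟨_, hk0 1⟩ : LinearMap.ker π) = 0 := rfl
          rw [this, map_zero]; exact map_one _
        map_mul' := fun x y => by
          rw [← map_mul, ← ofAdd_add, ← map_add]
          congr 3
          apply Subtype.ext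
          change x.1.1.1 + go x.1.1.2 • y.1.1.1 = x.1.1.1 + y.1.1.1
          rw [hk, go_one, one_smul] }, ?_⟩) ?_
    · intro γ x y h
      change e2.symm (Multiplicative.ofAdd (f ⟨y.1.1.1, hk0 y⟩)) = e2.symm (Multiplicative.ofAdd (f ⟨x.1.1.1, hk0 x⟩))
      congr 2
      rw [← hfm f γ.1.2 ⟨x.1.1.1, hk0 x⟩]
      congr 1
      apply Subtype.ext
      have h1 : y.1 * γ = γ * x.1 := by rw [h]; group
      have h2 := congrArg (fun p => p.1.1) h1
      simp only [Gam.mul_fst] at h2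
      rw [hk, go_one, one_smul, add_comm] at h2
      exact add_left_cancel h2
    · intro f f' h
      ext y
      have h1 := DFunLike.congr_fun (Subtype.ext_iff.1 h) (⟨Gam.inK y.1 y.2, rfl⟩ : (Gam.pr (π := π)).ker)
      change e2.symm (Multiplicative.ofAdd (f y)) = e2.symm (Multiplicative.ofAdd (f' y)) at h1
      exact Multiplicative.ofAdd.injective (e2.symm.injective h1)
end GP
section CR
variable {Γ U : Type} [Group Γ] [CommGroup U] (A : Γ →* MulAut U) {Γ1 : Subgroup Γ} {f : Γ → U} {g : Γ}
lemma cr_one (hf : ∀ x ∈ Γ1, ∀ y ∈ Γ1, f (x * y) = f x * A x (f y)) : f 1 = 1 := by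
  have := hf 1 (one_mem _) 1 (one_mem _)
  rw [one_mul, map_one, MulAut.one_apply] at this
  exact left_eq_mul.1 this
lemma cr_ext (hf : ∀ x ∈ Γ1, ∀ y ∈ Γ1, f (x * y) = f x * A x (f y))
    (hg : g ∉ Γ1) (hco : ∀ x, x ∉ Γ1 → x * g⁻¹ ∈ Γ1) (hn : ∀ x ∈ Γ1, g * x * g⁻¹ ∈ Γ1) {b : U}
    (hb : b * A g b = f (g * g)) (hB : ∀ X ∈ Γ1, A g (f X) * b = f (g * X * g⁻¹) * A (g * X * g⁻¹) b) :
    ∃ F : Γ → U, (∀ x y, F (x * y) = F x * A x (F y)) ∧ ∀ x ∈ Γ1, F x = f x := by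
  classical
  have hmul : ∀ x y (u : U), A (x * y) u = A x (A y u) := fun x y u => by rw [map_mul]; rfl
  have hgg : g * g ∈ Γ1 := by
    by_contra h
    have := hco _ h
    rw [mul_inv_cancel_right] at this
    exact hg this
  let F : Γ → U := fun x => if x ∈ Γ1 then f x else f (x * g⁻¹) * A (x * g⁻¹) b
  have F1 : ∀ x ∈ Γ1, F x = f x := fun x hx => if_pos hx
  have hug : ∀ u ∈ Γ1, u * g ∉ Γ1 := fun u hu h => hg ((Subgroup.mul_mem_cancel_left _ hu).1 h)
  have F2 : ∀ u ∈ Γ1, F (u * g) = f u * A u b := fun u hu => by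
    simp only [F]; rw [if_neg (hug u hu), mul_inv_cancel_right]
  have hform : ∀ x, x ∉ Γ1 → ∃ u ∈ Γ1, x = u * g := fun x hx => ⟨_, hco x hx, by group⟩
  refine ⟨F, fun x y => ?_, F1⟩
  by_cases hx : x ∈ Γ1
  · by_cases hy : y ∈ Γ1
    · rw [F1 _ (mul_mem hx hy), F1 _ hx, F1 _ hy, hf _ hx _ hy]
    · obtain ⟨w, hw, rfl⟩ := hform y hy
      rw [← mul_assoc, F2 _ (mul_mem hx hw), F1 _ hx, F2 _ hw, hf _ hx _ hw, hmul, map_mul, mul_assoc]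
  · obtain ⟨u, hu, rfl⟩ := hform x hx
    by_cases hy : y ∈ Γ1
    · have e : u * g * y = u * (g * y * g⁻¹) * g := by group
      have hY := hn y hy
      rw [e, F2 _ (mul_mem hu hY), F2 _ hu, F1 _ hy, hf _ hu _ hY, hmul, mul_assoc, ← map_mul, ← hB y hy,
        map_mul, hmul]
      ac_rfl
    · obtain ⟨w, hw, rfl⟩ := hform y hy
      have e : u * g * (w * g) = u * ((g * w * g⁻¹) * (g * g)) := by group
      have hW := hn w hw
      have h3 : A (g * w * g⁻¹) (A g b) = A g (A w b) := by rw [← hmul, ← hmul]; congr 2; group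
      rw [e, F1 _ (mul_mem hu (mul_mem hW hgg)), F2 _ hu, F2 _ hw, hf _ hu _ (mul_mem hW hgg), hf _ hW _ hgg,
        ← hb, map_mul (A (g * w * g⁻¹)), ← mul_assoc (f (g * w * g⁻¹)), ← hB w hw, h3]
      simp only [map_mul, hmul]
      simp only [← map_mul, ← MulAut.mul_apply]
      simp only [map_mul, MulAut.mul_apply]
      ac_rfl
variable {a e : U}
lemma cr_fix_g (hgg : g * g ∈ Γ1) (he : e * (a * A g a) = f (g * g))
    (hA : ∀ X ∈ Γ1, A g (f X) * a = f (g * X * g⁻¹) * A (g * X * g⁻¹) a) : A g e = e := by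
  have h1 := hA _ hgg
  have h2 : g * (g * g) * g⁻¹ = g * g := by group
  rw [h2, ← he, map_mul, map_mul, map_mul, MulAut.mul_apply] at h1
  have : A g e * (A g a * A g (A g a) * a) = e * (A g a * A g (A g a) * a) := by
    calc _ = A g e * (A g a * A g (A g a)) * a := by ac_rfl
      _ = _ := h1
      _ = _ := by ac_rfl
  exact mul_right_cancel this
lemma cr_fix (hf : ∀ x ∈ Γ1, ∀ y ∈ Γ1, f (x * y) = f x * A x (f y))
    (hn' : ∀ x ∈ Γ1, g⁻¹ * x * g ∈ Γ1)
    (hgg : g * g ∈ Γ1) (he : e * (a * A g a) = f (g * g))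
    (hA : ∀ X ∈ Γ1, A g (f X) * a = f (g * X * g⁻¹) * A (g * X * g⁻¹) a)
    (X : Γ) (hX : X ∈ Γ1) : A X e = e := by
  have hmul : ∀ x y (u : U), A (x * y) u = A x (A y u) := fun x y u => by rw [map_mul]; rfl
  obtain ⟨Y, hY, rfl⟩ : ∃ Y ∈ Γ1, X = g * Y * g⁻¹ := ⟨_, hn' X hX, by group⟩
  obtain ⟨Z, hZ, rfl⟩ : ∃ Z ∈ Γ1, Y = g * Z * g⁻¹ := ⟨_, hn' Y hY, by group⟩
  set Y := g * Z * g⁻¹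
  have h1 := hA Y hY
  set X := g * Y * g⁻¹ with hXd
  have h2 := congrArg (A g) (hA Z hZ)
  change A g (A g (f Z) * a) = A g (f Y * A Y a) at h2
  have h3 : A g (A Y a) = A X (A g a) := by rw [← hmul, ← hmul]; congr 2; rw [hXd]; group
  rw [map_mul, map_mul, h3] at h2
  have h4 : X * (g * g) = (g * g) * Z := by simp only [X, Y]; group
  have h5 := hf X hX _ hgg
  rw [h4, hf _ hgg _ hZ, hmul] at h5
  rw [← he, map_mul (A X), map_mul (A X)] at h5
  have : A X e * (f X * A X a * A X (A g a) * a * A g a) = e * (f X * A X a * A X (A g a) * a * A g a) := by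
    calc _ = (f X * (A X e * (A X a * A X (A g a)))) * (a * A g a) := by ac_rfl
      _ = e * (a * A g a) * A g (A g (f Z)) * (a * A g a) := by rw [← h5]
      _ = e * (a * A g a) * (A g (A g (f Z)) * A g a) * a := by ac_rfl
      _ = e * (a * A g a) * (A g (f Y) * A X (A g a)) * a := by rw [h2]
      _ = e * (a * A g a) * (A g (f Y) * a) * A X (A g a) := by ac_rfl
      _ = e * (a * A g a) * (f X * A X a) * A X (A g a) := by rw [h1]
      _ = _ := by ac_rfl
  exact mul_right_cancel this
lemma cr_indep (hf : ∀ x ∈ Γ1, ∀ y ∈ Γ1, f (x * y) = f x * A x (f y))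
    (hn : ∀ x ∈ Γ1, g * x * g⁻¹ ∈ Γ1) (hn' : ∀ x ∈ Γ1, g⁻¹ * x * g ∈ Γ1)
    (hgg : g * g ∈ Γ1) (he : e * (a * A g a) = f (g * g))
    (hA : ∀ X ∈ Γ1, A g (f X) * a = f (g * X * g⁻¹) * A (g * X * g⁻¹) a)
    (x : Γ) (hx : x ∈ Γ1) :
    e * ((f x * A x a) * A (x * g) (f x * A x a)) = f ((x * g) * (x * g)) := by
  have hmul : ∀ x y (u : U), A (x * y) u = A x (A y u) := fun x y u => by rw [map_mul]; rfl
  have hfix := cr_fix A hf hn' hgg he hA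
  have hX := hn x hx
  have e1 : x * g * (x * g) = x * ((g * x * g⁻¹) * (g * g)) := by group
  have h3 : A (g * x * g⁻¹) (A g a) = A g (A x a) := by rw [← hmul, ← hmul]; congr 2; group
  rw [e1, hf _ hx _ (mul_mem hX hgg), hf _ hX _ hgg, ← he, map_mul (A (g * x * g⁻¹)), hfix _ hX,
    map_mul (A (g * x * g⁻¹)), h3]
  have h4 : f (g * x * g⁻¹) * (e * (A (g * x * g⁻¹) a * A g (A x a))) = e * (A g (f x) * a * A g (A x a)) := by
    rw [hA x hx]; ac_rfl
  rw [h4, map_mul (A x), hfix _ hx]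
  simp only [map_mul, MulAut.mul_apply]
  ac_rfl
end CR
section
variable {K : Type} [Field K] [NumberField K]
variable {L : Type} [Field L] [NumberField L] [Algebra K L]
def R2' (K : Type) [Field K] [NumberField K] : Prop := ∀ P : Pr K, ord P (2 : K) ≤ 1
lemma R2'.r2 (h : R2' K) : R2 K := by
  rintro x ⟨y, hy⟩
  by_cases hx : x = 0
  · rw [hx]; exact dvd_zero _
  have hx' : (x : K) ≠ 0 := RingOfIntegers.coe_ne_zero_iff.2 hx
  have hy0 : y ≠ 0 := by rintro rfl; rw [mul_zero] at hy; exact hx (pow_eq_zero_iff two_ne_zero |>.1 hy)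
  have hy0' : (y : K) ≠ 0 := RingOfIntegers.coe_ne_zero_iff.2 hy0
  have h2 : (x : K) ^ 2 = 2 * (y : K) := by
    have := congrArg (fun z : 𝓞 K => (z : K)) hy
    exact this
  obtain ⟨z, hz⟩ := int_of_ord (x := (x : K) / 2) (fun P => by
    rw [ord_div P hx' two_ne_zero]
    have h3 := congrArg (ord P) h2
    rw [ord_pow, ord_mul P two_ne_zero hy0'] at h3
    have h4 := ord_int_nonneg P y
    have h5 := ord_int_nonneg P x
    have h6 := h P
    push_cast at h3
    omega)
  refine ⟨z, RingOfIntegers.ext ?_⟩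
  change (x : K) = (2 : K) * (z : K)
  rw [hz]; field_simp
lemma R2'.up (hU : Unr K L) (h : R2' K) : R2' L := fun P => by
  have := ord_algebraMap (K := K) P 2
  rw [map_ofNat] at this
  rw [this, hU.ram, Nat.cast_one, one_mul]; exact h _
lemma Unr.bot {F : Type} [Field F] [NumberField F] [Algebra F K] [Algebra F L]
    [IsScalarTower F K L] (h : Unr F L) : Unr F K ∧ Unr K L := by
  constructor
  · intro p
    obtain ⟨P, hP⟩ := exists_over (L := L) p
    obtain ⟨x, hx, h1⟩ := h P
    refine ⟨x, hx, ?_⟩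
    rw [IsScalarTower.algebraMap_apply F K L, ord_algebraMap, hP] at h1
    have h2 := ram_pos (K := K) P
    rcases Int.eq_one_or_neg_one_of_mul_eq_one h1 with h3 | h3
    · rwa [h3, one_mul] at h1
    · omega
  · intro P
    obtain ⟨x, hx, h1⟩ := h P
    exact ⟨algebraMap F K x, by simpa using hx, by rwa [← IsScalarTower.algebraMap_apply]⟩
lemma Unr.trans {F : Type} [Field F] [NumberField F] [Algebra F K] [Algebra F L]
    [IsScalarTower F K L] (h : Unr F K) (h' : Unr K L) : Unr F L := fun P => by
  obtain ⟨x, hx, h1⟩ := h (under K P)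
  refine ⟨x, hx, ?_⟩
  rw [IsScalarTower.algebraMap_apply F K L, ord_algebraMap, h'.ram, h1]; rfl
variable {Γ : Type} [Group Γ] (ρ : Γ →* (L ≃+* L))
noncomputable def uA : Γ →* MulAut Lˣ where
  toFun x := Units.mapEquiv (ρ x).toMulEquiv
  map_one' := by ext u; simp
  map_mul' x y := by ext u; simp
@[simp] lemma uA_coe (x : Γ) (u : Lˣ) : ((uA ρ x u : Lˣ) : L) = ρ x (u : L) := rfl
lemma noether (h1 : ∀ γ (x : K), ρ γ (algebraMap K L x) = algebraMap K L x)
    (h2 : ∀ τ : L ≃ₐ[K] L, ∃ γ, ∀ x, ρ γ x = τ x) (c : Γ → Lˣ)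
    (hc : ∀ x y, c (x * y) = c x * uA ρ x (c y)) (ht : ∀ x, ρ x = 1 → c x = 1) :
    ∃ a : Lˣ, ∀ x, uA ρ x a = c x * a := by
  have key : ∀ x y, (∀ z, ρ x z = ρ y z) → c x = c y := fun x y hxy => by
    have e : x = y * (y⁻¹ * x) := by group
    rw [e, hc, ht (y⁻¹ * x), map_one, mul_one]
    have : ρ x = ρ y := RingEquiv.ext hxy
    rw [map_mul, this, ← map_mul, inv_mul_cancel, map_one]
  haveI : FiniteDimensional K L := inferInstance
  choose s hs using h2
  obtain ⟨a, ha⟩ := groupCohomology.isMulCoboundary₁_of_isMulCocycle₁_of_aut_to_units (K := K) (L := L)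
    (fun τ => c (s τ)) (by
      intro τ τ'
      change c (s (τ * τ')) = τ • c (s τ') * c (s τ)
      rw [key (s (τ * τ')) (s τ * s τ') (fun z => by rw [hs, map_mul]; change _ = ρ (s τ) (ρ (s τ') z); rw [hs, hs]; rfl), hc, mul_comm]
      congr 1
      ext; rw [uA_coe, hs]; rfl)
  refine ⟨a, fun x => ?_⟩
  let τ : L ≃ₐ[K] L := AlgEquiv.ofRingEquiv (f := ρ x) (h1 x)
  have h3 := ha τ
  rw [div_eq_iff_eq_mul] at h3
  rw [key x (s τ) (fun z => by rw [hs]; rfl), ← h3]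
  ext; rfl
lemma ord_uA (x : Γ) (P : Pr L) (hP : gact (ρ x) P = P) (u : Lˣ) : ord P ((uA ρ x u : Lˣ) : L) = ord P (u : L) := by
  have := ord_gact (ρ x) P u
  rwa [hP] at this
lemma gact_mul (x y : Γ) (P : Pr L) : gact (ρ (x * y)) P = gact (ρ x) (gact (ρ y) P) := by
  rw [gact_gact, map_mul]; rfl
lemma ord_cr [Finite Γ] {Γ1 : Subgroup Γ} {f : Γ → Lˣ}
    (hf : ∀ x ∈ Γ1, ∀ y ∈ Γ1, f (x * y) = f x * uA ρ x (f y)) {z : Γ} (hz : z ∈ Γ1) (P : Pr L)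
    (hP : gact (ρ z) P = P) : ord P (f z : L) = 0 := by
  have h1 : ∀ n : ℕ, ord P (f (z ^ n) : L) = n * ord P (f z : L) := by
    intro n
    induction n with
    | zero => rw [pow_zero, cr_one _ hf]; simp [ord_one]
    | succ n ih =>
      rw [pow_succ', hf _ hz _ (pow_mem hz n), Units.val_mul, ord_mul P (Units.ne_zero _) (Units.ne_zero _),
        ord_uA ρ z P hP, ih]
      push_cast; ring
  have h2 := h1 (orderOf z)
  rw [pow_orderOf_eq_one, cr_one _ hf, Units.val_one, ord_one] at h2
  have h3 := orderOf_pos z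
  rcases mul_eq_zero.1 h2.symm with h4 | h4
  · exact absurd h4 (by exact_mod_cast h3.ne')
  · exact h4
def Fx (k1 : Type) [Field k1] [Algebra k1 L] : Subgroup Γ where
  carrier := {γ | ∀ x : k1, ρ γ (algebraMap k1 L x) = algebraMap k1 L x}
  one_mem' x := by simp
  mul_mem' {a b} ha hb x := by
    rw [map_mul]; change ρ a (ρ b _) = _; rw [hb, ha]
  inv_mem' {a} ha x := by
    rw [map_inv]
    change (ρ a).symm _ = _
    rw [RingEquiv.symm_apply_eq, ha]
lemma ker_le_Fx {k1 : Type} [Field k1] [Algebra k1 L] {γ : Γ} (h : ρ γ = 1) : γ ∈ Fx ρ k1 := fun x => by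
  rw [h]; rfl
end
section
variable {k : Type} [Field k] [NumberField k]
variable {k1 : Type} [Field k1] [NumberField k1] [Algebra k k1]
variable {L : Type} [Field L] [NumberField L] [Algebra k L] [Algebra k1 L] [IsScalarTower k k1 L]
variable {σ : k1 ≃ₐ[k] k1}
variable {Γ : Type} [Group Γ] [Finite Γ] (ρ : Γ →* (L ≃+* L))
lemma fixed_in [IsGalois k L] (h2 : ∀ τ : L ≃ₐ[k] L, ∃ γ, ∀ x, ρ γ x = τ x) (e : Lˣ) (he : ∀ γ, uA ρ γ e = e) :
    ∃ e0 : kˣ, aK k L e0 = e := by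
  have h3 := (IsGalois.mem_bot_iff_fixed (F := k) (e : L)).2 (fun τ => by
    obtain ⟨γ, hγ⟩ := h2 τ
    rw [← hγ]
    exact congrArg Units.val (he γ))
  obtain ⟨y, hy⟩ := IntermediateField.mem_bot.1 h3
  have hy0 : y ≠ 0 := by rintro rfl; rw [map_zero] at hy; exact e.ne_zero hy.symm
  exact ⟨Units.mk0 y hy0, Units.ext hy⟩
lemma under_lift (g : Γ) (hg : ∀ x : k1, ρ g (algebraMap k1 L x) = algebraMap k1 L (σ x)) (P : Pr L) :
    under k1 (gact (ρ g) P) = pact σ (under k1 P) := by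
  ext x
  rw [mem_under, mem_gact, pact, mem_gact, mem_under]
  have : (RingOfIntegers.mapRingEquiv (ρ g)).symm (algebraMap (𝓞 k1) (𝓞 L) x) =
      algebraMap (𝓞 k1) (𝓞 L) ((RingOfIntegers.mapRingEquiv σ.toRingEquiv).symm x) := by
    apply RingOfIntegers.ext
    change (ρ g).symm (algebraMap k1 L (x : k1)) = algebraMap k1 L (σ.symm (x : k1))
    rw [RingEquiv.symm_apply_eq, hg, AlgEquiv.apply_symm_apply]
  rw [this]
theorem HP_step [IsGalois k L] [IsGalois k1 L] [IsTotallyReal k1] (hq : Quad σ) (hU : Unr k k1) (hU1 : Unr k1 L)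
    (hR : R2 k) (h1 : ∀ γ (x : k), ρ γ (algebraMap k L x) = algebraMap k L x)
    (h2 : ∀ τ : L ≃ₐ[k] L, ∃ γ, ∀ x, ρ γ x = τ x) (ψ : Γ → Lˣ)
    (hψ2 : ∀ γ x, ρ x = 1 → ψ (γ * x * γ⁻¹) = ψ x) (hψ3 : ∀ γ x, uA ρ γ (ψ x) = ψ x)
    (f : Γ → Lˣ) (hf : ∀ x ∈ Fx ρ k1, ∀ y ∈ Fx ρ k1, f (x * y) = f x * uA ρ x (f y))
    (hfψ : ∀ x, ρ x = 1 → f x = ψ x) :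
    ∃ F : Γ → Lˣ, (∀ x y, F (x * y) = F x * uA ρ x (F y)) ∧ ∀ x, ρ x = 1 → F x = ψ x := by
  have hmul : ∀ x y (u : Lˣ), uA ρ (x * y) u = uA ρ x (uA ρ y u) := fun x y u => by rw [map_mul]; rfl
  have hmulL : ∀ x y (u : L), ρ (x * y) u = ρ x (ρ y u) := fun x y u => by rw [map_mul]; rfl
  haveI := quad_galois hq.deg
  haveI : Normal k L := inferInstance
  have hdich : ∀ γ, γ ∉ Fx ρ k1 → ∀ x : k1, ρ γ (algebraMap k1 L x) = algebraMap k1 L (σ x) := by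
    intro γ hγ
    let τ : L ≃ₐ[k] L := AlgEquiv.ofRingEquiv (f := ρ γ) (h1 γ)
    have h3 : ∀ x : k1, algebraMap k1 L (τ.restrictNormal k1 x) = ρ γ (algebraMap k1 L x) :=
      fun x => AlgEquiv.restrictNormal_commutes τ k1 x
    rcases hq.all (τ.restrictNormal k1) with h | h
    · exact absurd (fun x => by rw [← h3, h]; rfl) hγ
    · intro x; rw [← h3, h]
  obtain ⟨g, hg⟩ : ∃ g, ∀ x : k1, ρ g (algebraMap k1 L x) = algebraMap k1 L (σ x) := by
    obtain ⟨g, hg⟩ := h2 (σ.liftNormal L)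
    exact ⟨g, fun x => by rw [hg]; exact AlgEquiv.liftNormal_commutes σ L x⟩
  have hgi : ∀ x : k1, ρ g⁻¹ (algebraMap k1 L x) = algebraMap k1 L (σ x) := fun x => by
    rw [map_inv]; change (ρ g).symm _ = _; rw [RingEquiv.symm_apply_eq, hg, hq.invol]
  have hg1 : g ∉ Fx ρ k1 := fun h => by
    obtain ⟨c, hc⟩ := hq.ne
    have := h c
    rw [hg] at this
    exact hc ((algebraMap k1 L).injective this)
  have hco : ∀ x, x ∉ Fx ρ k1 → x * g⁻¹ ∈ Fx ρ k1 := fun x hx y => by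
    rw [hmulL, hgi, hdich x hx, hq.invol]
  have hn : ∀ x ∈ Fx ρ k1, g * x * g⁻¹ ∈ Fx ρ k1 := fun x hx y => by
    rw [hmulL, hmulL, hgi, hx, hg, hq.invol]
  have hn' : ∀ x ∈ Fx ρ k1, g⁻¹ * x * g ∈ Fx ρ k1 := fun x hx y => by
    rw [hmulL, hmulL, hg, hx, hgi, hq.invol]
  have hgg : g * g ∈ Fx ρ k1 := fun y => by rw [hmulL, hg, hg, hq.invol]
  have hA : ∃ a : Lˣ, ∀ X ∈ Fx ρ k1, uA ρ g (f X) * a = f (g * X * g⁻¹) * uA ρ (g * X * g⁻¹) a := by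
    obtain ⟨a, ha⟩ := noether (K := k1) (ρ.comp (Fx ρ k1).subtype) (fun γ x => γ.2 x)
      (fun τ => by
        obtain ⟨γ, hγ⟩ := h2 (τ.restrictScalars k)
        exact ⟨⟨γ, fun x => by rw [hγ]; exact τ.commutes x⟩, hγ⟩)
      (fun X => uA ρ g (f (g⁻¹ * X * g)) / f X)
      (fun X Y => by
        have e1 : g⁻¹ * (X * Y : Γ) * g = (g⁻¹ * X * g) * (g⁻¹ * Y * g) := by group
        change uA ρ g (f (g⁻¹ * (X * Y : Γ) * g)) / f (X * Y : Γ) =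
          uA ρ g (f (g⁻¹ * X * g)) / f X * uA ρ X (uA ρ g (f (g⁻¹ * Y * g)) / f Y)
        rw [e1, hf _ (hn' X X.2) _ (hn' Y Y.2), hf _ X.2 _ Y.2, map_mul (uA ρ g), ← hmul, map_div, ← hmul]
        have e2 : g * (g⁻¹ * X * g) = (X : Γ) * g := by group
        rw [e2, mul_div_mul_comm])
      (fun X hX => by
        have hX' : ρ X = 1 := hX
        change uA ρ g (f (g⁻¹ * X * g)) / f X = 1
        have e1 : ρ (g⁻¹ * X * g) = 1 := by rw [map_mul, map_mul, hX', mul_one, ← map_mul, inv_mul_cancel, map_one]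
        have e2 := hψ2 g⁻¹ X hX'
        rw [inv_inv] at e2
        rw [hfψ _ e1, hfψ _ hX', hψ3, e2, div_self'])
    refine ⟨a, fun X hX => ?_⟩
    have h3 := ha ⟨_, hn X hX⟩
    change uA ρ (g * X * g⁻¹) a = uA ρ g (f (g⁻¹ * (g * X * g⁻¹) * g)) / f (g * X * g⁻¹) * a at h3
    have e1 : g⁻¹ * (g * X * g⁻¹) * g = X := by group
    rw [h3, e1, ← mul_assoc, mul_div_cancel]
  obtain ⟨a, hA⟩ := hA
  obtain ⟨e, he⟩ : ∃ e, e * (a * uA ρ g a) = f (g * g) := ⟨f (g * g) / (a * uA ρ g a), div_mul_cancel _ _⟩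
  have efix1 := cr_fix (uA ρ) hf hn' hgg he hA
  have efixg := cr_fix_g (uA ρ) hgg he hA
  obtain ⟨e0, he0⟩ := fixed_in (k := k) ρ h2 e (fun γ => by
    by_cases hγ : γ ∈ Fx ρ k1
    · exact efix1 γ hγ
    · have e3 : γ = γ * g⁻¹ * g := by group
      rw [e3, hmul, efixg, efix1 _ (hco γ hγ)])
  obtain ⟨y, hy⟩ := HN hq hU hR e0 (fun P1 hP1 => by
    obtain ⟨P, hP⟩ := exists_over (L := L) P1
    have h3 : under k1 (gact (ρ g) P) = under k1 P := by
      rw [under_lift ρ g hg, hP, hP1]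
    obtain ⟨τ, hτ⟩ := exists_gact _ _ h3
    obtain ⟨x, hx⟩ := h2 (τ.restrictScalars k)
    have hx1 : x ∈ Fx ρ k1 := fun y => by rw [hx]; exact τ.commutes y
    have hρx : ρ x = τ.toRingEquiv := RingEquiv.ext hx
    have hP' : gact (ρ (x * g)) P = P := by rw [gact_mul, hρx, hτ]
    have hh : x * g * (x * g) ∈ Fx ρ k1 := by
      have e1 : x * g * (x * g) = x * ((g * x * g⁻¹) * (g * g)) := by group
      rw [e1]
      exact mul_mem hx1 (mul_mem (hn x hx1) hgg)
    have h4 := cr_indep (uA ρ) hf hn hn' hgg he hA x hx1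
    set b := f x * uA ρ x a
    have h5 := congrArg (fun u : Lˣ => ord P (u : L)) h4
    simp only [Units.val_mul] at h5
    rw [ord_cr ρ hf hh P (by rw [gact_mul, hP', hP']), ord_mul P (Units.ne_zero _) (mul_ne_zero (Units.ne_zero _) (Units.ne_zero _)),
      ord_mul P (Units.ne_zero _) (Units.ne_zero _), ord_uA ρ _ P hP'] at h5
    have h6 : ord P (e : L) = ord P1 (algebraMap k k1 e0) := by
      rw [← he0, aK_coe, IsScalarTower.algebraMap_apply k k1 L, ord_algebraMap, hU1.ram, hP]; simp
    rw [← h6]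
    exact ⟨-ord P (b : L), by omega⟩)
  have hκ1 : ∀ X ∈ Fx ρ k1, uA ρ X (aK k1 L y) = aK k1 L y := fun X hX => Units.ext (hX y)
  have hκg : aK k1 L y * uA ρ g (aK k1 L y) = e := by
    rw [← he0]
    have h3 : uA ρ g (aK k1 L y) = aK k1 L (sA σ y) := Units.ext (hg y)
    rw [h3, ← map_mul, hy]
    ext
    exact (IsScalarTower.algebraMap_apply k k1 L _).symm
  obtain ⟨F, hF1, hF2⟩ := cr_ext (uA ρ) hf hg1 hco hn (b := a * aK k1 L y)
    (by rw [← he, ← hκg, map_mul]; ac_rfl)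
    (fun X hX => by rw [map_mul, hκ1 _ (hn X hX), ← mul_assoc, hA X hX]; ac_rfl)
  exact ⟨F, hF1, fun x hx => by rw [hF2 x (ker_le_Fx ρ hx), hfψ x hx]⟩
end
theorem HP (n : ℕ) : ∀ (k L : Type) [Field k] [NumberField k] [Field L] [NumberField L] [Algebra k L]
    [IsGalois k L] [IsTotallyReal L], Module.finrank k L = 2 ^ n → Unr k L → R2' k →
    ∀ (Γ : Type) [Group Γ] [Finite Γ] (ρ : Γ →* (L ≃+* L)),
    (∀ γ (x : k), ρ γ (algebraMap k L x) = algebraMap k L x) →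
    (∀ τ : L ≃ₐ[k] L, ∃ γ, ∀ x, ρ γ x = τ x) → ∀ (ψ : Γ → Lˣ),
    (∀ x y, ρ x = 1 → ρ y = 1 → ψ (x * y) = ψ x * ψ y) →
    (∀ γ x, ρ x = 1 → ψ (γ * x * γ⁻¹) = ψ x) → (∀ γ x, uA ρ γ (ψ x) = ψ x) →
    ∃ F : Γ → Lˣ, (∀ x y, F (x * y) = F x * uA ρ x (F y)) ∧ ∀ x, ρ x = 1 → F x = ψ x := by
  induction n with
  | zero =>
    intro k L _ _ _ _ _ _ _ hn hU hR Γ _ _ ρ h1 h2 ψ hψ1 hψ2 hψ3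
    have hs : Function.Surjective (algebraMap k L) := fun w => by
      obtain ⟨c, hc⟩ := (finrank_eq_one_iff_of_nonzero' (1 : L) one_ne_zero).1 hn w
      exact ⟨c, by rw [Algebra.algebraMap_eq_smul_one, hc]⟩
    have ht : ∀ γ, ρ γ = 1 := fun γ => RingEquiv.ext fun x => by
      obtain ⟨y, rfl⟩ := hs x; exact h1 γ y
    exact ⟨ψ, fun x y => by rw [hψ1 x y (ht x) (ht y), hψ3], fun _ _ => rfl⟩
  | succ n ih =>
    intro k L _ _ _ _ _ _ _ hn hU hR Γ _ _ ρ h1 h2 ψ hψ1 hψ2 hψ3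
    classical
    haveI : FiniteDimensional k L := inferInstance
    haveI : Fact (Nat.Prime 2) := ⟨Nat.prime_two⟩
    have hcard : Nat.card (L ≃ₐ[k] L) = 2 ^ (n + 1) := by rw [IsGalois.card_aut_eq_finrank, hn]
    obtain ⟨H, hH⟩ := Sylow.exists_subgroup_card_pow_prime (G := L ≃ₐ[k] L) 2 (n := n) (by
      rw [hcard]; exact pow_dvd_pow 2 (Nat.le_succ n))
    let k1 := IntermediateField.fixedField H
    have hd1 : Module.finrank k1 L = 2 ^ n := by rw [IntermediateField.finrank_fixedField_eq_card, hH]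
    have hd : Module.finrank k k1 = 2 := by
      have := Module.finrank_mul_finrank k k1 L
      rw [hd1, hn, pow_succ'] at this
      exact Nat.eq_of_mul_eq_mul_right (by positivity) this
    haveI : NumberField k1 := inferInstance
    haveI : IsTotallyReal k1 := IsTotallyReal.of_algebra k1 L
    obtain ⟨σ, hσ⟩ := exists_quad hd
    obtain ⟨hU0, hU1⟩ := Unr.bot (F := k) (K := k1) (L := L) hU
    obtain ⟨f, hf1, hf2⟩ := ih k1 L hd1 hU1 (hR.up hU0) (Fx ρ k1) (ρ.comp (Fx ρ k1).subtype)
      (fun γ x => γ.2 x)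
      (fun τ => by
        obtain ⟨γ, hγ⟩ := h2 (τ.restrictScalars k)
        exact ⟨⟨γ, fun x => by rw [hγ]; exact τ.commutes x⟩, hγ⟩)
      (fun x => ψ x) (fun x y hx hy => hψ1 x y hx hy) (fun γ x hx => hψ2 γ x hx) (fun γ x => hψ3 γ x)
    refine HP_step (k1 := k1) ρ hσ hU0 hU1 hR.r2 h1 h2 ψ hψ2 hψ3
      (fun x => if h : x ∈ Fx ρ k1 then f ⟨x, h⟩ else 1) (fun x hx y hy => ?_) (fun x hx => ?_)
    · rw [dif_pos hx, dif_pos hy, dif_pos (mul_mem hx hy)]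
      exact hf1 ⟨x, hx⟩ ⟨y, hy⟩
    · rw [dif_pos (ker_le_Fx ρ hx)]
      exact hf2 ⟨x, ker_le_Fx ρ hx⟩ hx
section
variable {K : Type} [Field K] [NumberField K]
variable {L : Type} [Field L] [NumberField L] [Algebra K L]
noncomputable def sg (L : Type) [Field L] : ℤˣ →* Lˣ := Units.map (Int.castRingHom L).toMonoidHom
lemma sg_coe (e : ℤˣ) : ((sg L e : Lˣ) : L) = ((e : ℤ) : L) := rfl
lemma sg_inj : Function.Injective (sg L) := fun a b h => by
  have := congrArg (fun u : Lˣ => (u : L)) h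
  simp only [sg_coe] at this
  exact Units.ext (Int.cast_injective this)
lemma sg_of_sq {u : Lˣ} (h : u ^ 2 = 1) : ∃ e, sg L e = u := by
  have h1 : (u : L) ^ 2 = 1 := by
    rw [← Units.val_pow_eq_pow_val, h, Units.val_one]
  rcases sq_eq_sq_iff_eq_or_eq_neg.1 (h1.trans (one_pow 2).symm) with h | h
  · exact ⟨1, Units.ext (by rw [map_one]; exact h.symm)⟩
  · exact ⟨-1, Units.ext (by rw [sg_coe, h]; simp)⟩
lemma sg_sq (e : ℤˣ) : (sg L e) ^ 2 = 1 := by rw [← map_pow]; simp [Int.units_sq]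
variable {Γ : Type} [Group Γ] (ρ : Γ →* (L ≃+* L))
lemma uA_sg (x : Γ) (e : ℤˣ) : uA ρ x (sg L e) = sg L e := Units.ext (by
  rw [uA_coe, sg_coe]; simp)
/-- A crossed homomorphism with values of square one is a sign character. -/
lemma sgnhom {c : Γ → Lˣ} (hc : ∀ x y, c (x * y) = c x * uA ρ x (c y)) (h2 : ∀ x, c x ^ 2 = 1) :
    ∃ χ : Γ →* ℤˣ, ∀ x, sg L (χ x) = c x := by
  choose e he using fun x => sg_of_sq (h2 x)
  refine ⟨MonoidHom.mk' e fun x y => sg_inj (L := L) ?_, he⟩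
  rw [map_mul, he, he, he, hc, ← he y, uA_sg]
lemma cr_cob (y : Lˣ) (a b : Γ) : uA ρ (a * b) y / y = uA ρ a y / y * uA ρ a (uA ρ b y / y) := by
  rw [map_div, map_mul, MulAut.mul_apply]
  rw [div_mul_div_comm, mul_comm y, mul_div_mul_left_eq_div]
noncomputable def rG (K L : Type) [Field K] [Field L] [Algebra K L] : (L ≃ₐ[K] L) →* (L ≃+* L) where
  toFun g := g.toRingEquiv
  map_one' := rfl
  map_mul' _ _ := rfl
lemma rG_apply (g : L ≃ₐ[K] L) (x : L) : rG K L g x = g x := rfl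
lemma rG_one {g : L ≃ₐ[K] L} (h : rG K L g = 1) : g = 1 := AlgEquiv.ext fun x => by
  rw [← rG_apply, h]; rfl
lemma aK_WT {w : Kˣ} (h : w ∈ WT ∅) : aK K L w ∈ WT ∅ := by
  obtain ⟨h1, h2, h3⟩ := h
  refine ⟨fun P hP => ?_, fun φ => ?_, ?_⟩
  · change Even (ord P ((aK K L w : Lˣ) : L))
    rw [aK_coe, ord_algebraMap]
    exact (mem_VT.1 h1 _ (Finset.notMem_empty _)).mul_left _
  · exact h2 (φ.comp (algebraMap K L))
  · obtain ⟨x, w', hx⟩ := h3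
    refine ⟨aK K L x, algebraMap (𝓞 K) (𝓞 L) w', ?_⟩
    have := congrArg (algebraMap K L) hx
    rw [map_mul, map_pow, map_add, map_mul, map_one, map_ofNat] at this
    exact this
variable (K L) in
/-- Units whose class modulo squares is Galois invariant. -/
noncomputable def X0 : Subgroup Lˣ where
  carrier := {β | ∀ g, uA (rG K L) g β / β ∈ Sqr L}
  mul_mem' {a b} ha hb g := by
    rw [map_mul, mul_div_mul_comm]; exact (Sqr L).mul_mem (ha g) (hb g)
  one_mem' g := by rw [map_one, div_one]; exact (Sqr L).one_mem
  inv_mem' {a} ha g := by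
    rw [map_inv, ← inv_div']
    exact (Sqr L).inv_mem (ha g)
lemma uG_aK (g : L ≃ₐ[K] L) (w : Kˣ) : uA (rG K L) g (aK K L w) = aK K L w :=
  Units.ext (by rw [uA_coe, aK_coe, rG_apply]; exact g.commutes _)
lemma aK_X0 (w : Kˣ) : aK K L w ∈ X0 K L := fun g => by
  rw [uG_aK, div_self']; exact (Sqr L).one_mem
lemma Sqr_le_X0 : Sqr L ≤ X0 K L := by
  rintro _ ⟨x, rfl⟩ g
  exact ⟨uA (rG K L) g x / x, by simp [powMonoidHom_apply, div_pow]⟩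
variable (K L) in
noncomputable def Y0 : Subgroup Lˣ := (aK K L).range ⊔ Sqr L
lemma Y0_le : Y0 K L ≤ X0 K L := sup_le (by rintro _ ⟨w, rfl⟩; exact aK_X0 w) Sqr_le_X0
instance finChar [Finite Γ] : Finite (Γ →* ℤˣ) := DFunLike.finite _
lemma partA [IsGalois K L] (hno : ∀ β ∈ X0 K L, β ∈ WT ∅ → β ∈ Sqr L) :
    (Sqr K).relIndex (WT ∅) ≠ 0 ∧ (Sqr K).relIndex (WT ∅) ≤ Nat.card ((L ≃ₐ[K] L) →* ℤˣ) := by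
  classical
  have key : ∀ w : Kˣ, ∃ χ : (L ≃ₐ[K] L) →* ℤˣ, w ∈ WT ∅ → ∃ y : Lˣ, y ^ 2 = aK K L w ∧
      ∀ g, uA (rG K L) g y = sg L (χ g) * y := fun w => by
    by_cases hw : w ∈ WT ∅
    · obtain ⟨y, hy⟩ := hno _ (aK_X0 (L := L) w) (aK_WT hw)
      obtain ⟨χ, hχ⟩ := sgnhom (rG K L) (c := fun g => uA (rG K L) g y / y) (cr_cob _ y) (fun g => by
        change y ^ 2 = _ at hy
        rw [div_pow, ← map_pow, hy, uG_aK, div_self'])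
      exact ⟨χ, fun _ => ⟨y, hy, fun g => by rw [hχ, div_mul_cancel]⟩⟩
    · exact ⟨1, fun h => absurd h hw⟩
  choose χ hχ using key
  refine relIndex_le_card (Sqr K) (WT ∅) χ fun x hx y hy h => ?_
  obtain ⟨a, ha, ha'⟩ := hχ x hx
  obtain ⟨b, hb, hb'⟩ := hχ y hy
  obtain ⟨e, he⟩ := fixed_in (k := K) (rG K L) (fun τ => ⟨τ, fun _ => rfl⟩) (a / b) (fun g => by
    rw [map_div, ha', hb', h, mul_div_mul_left_eq_div])
  refine ⟨e, aK_inj (L := L) ?_⟩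
  change aK K L (e ^ 2) = _
  rw [map_pow, he, map_div, div_pow, ha, hb]
lemma partB [IsGalois K L] [IsTotallyReal L] {n : ℕ} (hn : Module.finrank K L = 2 ^ n) (hU : Unr K L)
    (hR : R2' K) [Finite Γ] (τ : Γ →* (L ≃ₐ[K] L)) (hτ : Function.Surjective τ)
    (hχ : ∀ χ : Γ →* ℤˣ, ∀ x, τ x = 1 → χ x = 1) (hfin : (Y0 K L).relIndex (X0 K L) ≠ 0) :
    Nat.card {ψ : τ.ker →* ℤˣ // ∀ (γ : Γ) (x y : τ.ker), (y : Γ) = γ * x * γ⁻¹ → ψ y = ψ x} ≤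
      (Y0 K L).relIndex (X0 K L) := by
  classical
  set S := {ψ : τ.ker →* ℤˣ // ∀ (γ : Γ) (x y : τ.ker), (y : Γ) = γ * x * γ⁻¹ → ψ y = ψ x}
  set ρ := (rG K L).comp τ with hρ
  have hk : ∀ x, ρ x = 1 → x ∈ τ.ker := fun x hx => rG_one hx
  have hk' : ∀ x : τ.ker, ρ x = 1 := fun x => by
    rw [hρ, MonoidHom.comp_apply, MonoidHom.mem_ker.1 x.2, map_one]
  have h1 : ∀ γ (x : K), ρ γ (algebraMap K L x) = algebraMap K L x := fun γ x => (τ γ).commutes x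
  have h2 : ∀ g : L ≃ₐ[K] L, ∃ γ, ∀ x, ρ γ x = g x := fun g => by
    obtain ⟨γ, rfl⟩ := hτ g; exact ⟨γ, fun _ => rfl⟩
  have key : ∀ ψ : S, ∃ F : Γ → Lˣ, (∀ x y, F (x * y) = F x * uA ρ x (F y)) ∧
      ∀ x : τ.ker, F x = sg L (ψ.1 x) := fun ψ => by
    obtain ⟨F, hF, hF'⟩ := HP n K L hn hU hR Γ ρ h1 h2
      (fun x => if h : x ∈ τ.ker then sg L (ψ.1 ⟨x, h⟩) else 1)
      (fun x y hx hy => by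
        rw [dif_pos (hk x hx), dif_pos (hk y hy), dif_pos (mul_mem (hk x hx) (hk y hy)), ← map_mul,
          ← map_mul]; rfl)
      (fun γ x hx => by
        rw [dif_pos (hk x hx), dif_pos (τ.normal_ker.conj_mem _ (hk x hx) _)]
        exact congrArg _ (ψ.2 γ _ _ rfl))
      (fun γ x => by
        split_ifs
        · exact uA_sg _ _ _
        · exact map_one _)
    exact ⟨F, hF, fun x => by rw [hF' x (hk' x), dif_pos x.2]⟩
  choose F hF hF' using key
  have key2 : ∀ ψ : S, ∃ b : Lˣ, ∀ x, uA ρ x b = F ψ x ^ 2 * b := fun ψ =>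
    noether (K := K) ρ h1 h2 (fun x => F ψ x ^ 2) (fun x y => by rw [hF, mul_pow, map_pow])
      (fun x hx => by rw [hF' ψ ⟨x, hk x hx⟩, sg_sq])
  choose b hb using key2
  have hX : ∀ ψ, b ψ ∈ X0 K L := fun ψ g => by
    obtain ⟨γ, rfl⟩ := hτ g
    have : uA (rG K L) (τ γ) (b ψ) = _ := hb ψ γ
    rw [this, mul_div_cancel_right]
    exact ⟨F ψ γ, rfl⟩
  haveI : Finite (X0 K L ⧸ (Y0 K L).subgroupOf (X0 K L)) :=
    Nat.finite_of_card_ne_zero hfin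
  change _ ≤ Nat.card (X0 K L ⧸ (Y0 K L).subgroupOf (X0 K L))
  refine Nat.card_le_card_of_injective
    (fun ψ : S => (QuotientGroup.mk (⟨b ψ, hX ψ⟩ : X0 K L) : X0 K L ⧸ (Y0 K L).subgroupOf (X0 K L))) ?_
  intro ψ ψ' h
  have h3 : b ψ' / b ψ ∈ Y0 K L := by
    have := QuotientGroup.eq.1 h
    rw [mem_subgroupOf] at this
    rw [div_eq_inv_mul]; exact this
  obtain ⟨_, ⟨w, rfl⟩, _, ⟨z, rfl⟩, hz⟩ := mem_sup.1 h3
  change aK K L w * z ^ 2 = _ at hz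
  have hfix : ∀ x, uA ρ x (b ψ' / b ψ) = (uA ρ x z) ^ 2 / z ^ 2 * (b ψ' / b ψ) := fun x => by
    have : uA ρ x (aK K L w) = aK K L w := uG_aK (τ x) w
    rw [← hz, map_mul, this, map_pow, mul_comm (aK K L w) (z ^ 2), ← mul_assoc, div_mul_cancel, mul_comm]
  obtain ⟨χ, hχ1⟩ := sgnhom ρ (c := fun x => F ψ' x / F ψ x / (uA ρ x z / z))
    (fun x y => by
      rw [cr_cob ρ z x y, hF, hF, map_div (uA ρ x) (F ψ' y / F ψ y), map_div (uA ρ x) (F ψ' y)]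
      rw [mul_div_mul_comm, mul_div_mul_comm])
    (fun x => by
      have h5 := hfix x
      rw [map_div, hb, hb, mul_div_mul_comm] at h5
      have h6 := mul_right_cancel h5
      rw [div_pow, div_pow, div_pow, h6, div_self'])
  refine Subtype.ext (MonoidHom.ext fun x => (sg_inj (L := L) ?_).symm)
  have h7 := hχ1 (x : Γ)
  rw [hχ χ x (MonoidHom.mem_ker.1 x.2), map_one] at h7
  have h8 : uA ρ x z = z := Units.ext (by rw [uA_coe, hk' x]; rfl)
  rw [h8, div_self', div_one, hF', hF'] at h7
  exact div_eq_one.1 h7.symm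
end
section
variable {K : Type} [Field K] [NumberField K]
variable {L : Type} [Field L] [NumberField L] [Algebra K L]
lemma even_sqr {a : Lˣ} (h : a ∈ Sqr L) (P : Pr L) : Even (ord P (a : L)) :=
  mem_VT.1 (Sqr_le_VT ∅ h) P (Finset.notMem_empty _)
lemma X0_even [IsGalois K L] {β : Lˣ} (h : β ∈ X0 K L) {P Q : Pr L} (hPQ : under K P = under K Q)
    (hP : Even (ord P (β : L))) : Even (ord Q (β : L)) := by
  obtain ⟨g, hg⟩ := exists_gact Q P hPQ.symm
  have h1 : ord P (g (β : L)) = ord Q (β : L) := by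
    rw [← hg]; exact ord_gact g.toRingEquiv Q _
  have h2 := even_sqr (h g) P
  rw [Units.val_div_eq_div_val, ord_div P (Units.ne_zero _) (Units.ne_zero _), uA_coe, rG_apply, h1] at h2
  exact (by simpa using h2.add hP)
lemma partC1 [IsGalois K L] (hU : Unr K L) :
    (Y0 K L ⊔ (X0 K L ⊓ VT ∅)).relIndex (X0 K L) ≠ 0 ∧
      (Y0 K L ⊔ (X0 K L ⊓ VT ∅)).relIndex (X0 K L) ≤ cK K := by
  choose O hO using fun p : Pr K => exists_over (L := L) p
  have hOi : Function.Injective O := fun p q h => by rw [← hO p, ← hO q, h]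
  haveI : Finite (DivM K ⧸ (RT (∅ : Finset (Pr K)) ⊔ (dv (K := K)).range)) :=
    Nat.finite_of_card_ne_zero (cK_ne (K := K))
  change _ ∧ _ ≤ Nat.card (DivM K ⧸ (RT (∅ : Finset (Pr K)) ⊔ (dv (K := K)).range))
  refine relIndex_le_card _ _ (fun β : Lˣ => QuotientGroup.mk
    (mkD (fun p => ord (O p) (β : L)) ((ord_finite β.ne_zero).preimage hOi.injOn))) ?_
  intro x hx y hy h
  have h3 := QuotientGroup.eq.1 h.symm
  obtain ⟨R, hR, _, ⟨w, rfl⟩, hw⟩ := mem_sup.1 h3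
  have hz : x / y / aK K L w ∈ X0 K L := (X0 K L).div_mem ((X0 K L).div_mem hx hy) (aK_X0 w)
  rw [← div_mul_cancel (x / y) (aK K L w)]
  refine mul_mem (mem_sup_right ⟨hz, ?_⟩) (mem_sup_left (mem_sup_left ⟨w, rfl⟩))
  refine mem_VT.2 fun P _ => X0_even hz (hO (under K P)) ?_
  have h4 := congrArg (ev (under K P)) hw
  simp only [ev_mul, ev_inv, ev_mkD, ev_dv] at h4
  have h5 := mem_RT.1 hR (under K P) (Finset.notMem_empty _)
  rw [Units.val_div_eq_div_val, Units.val_div_eq_div_val, ord_div _ (div_ne_zero x.ne_zero y.ne_zero)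
    (Units.ne_zero _), ord_div _ x.ne_zero y.ne_zero, aK_coe, ord_algebraMap, hU.ram, hO]
  have : ord (O (under K P)) (x : L) - ord (O (under K P)) (y : L) - (1 : ℕ) * ord (under K P) (w : K) =
    ev (under K P) R := by push_cast; linarith
  rw [this]; exact h5
lemma X0_sign [IsGalois K L] {β : Lˣ} (h : β ∈ X0 K L) {φ ψ : L →+* ℝ}
    (hφ : φ.comp (algebraMap K L) = ψ.comp (algebraMap K L)) (h0 : 0 < φ (β : L)) : 0 < ψ (β : L) := by
  obtain ⟨g, hg⟩ := ComplexEmbedding.exists_comp_symm_eq_of_comp_eq (k := K) (Complex.ofRealHom.comp φ)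
    (Complex.ofRealHom.comp ψ) (by rw [RingHom.comp_assoc, hφ, RingHom.comp_assoc])
  have h1 : ψ (β : L) = φ (g.symm (β : L)) := by
    have := congrArg (fun f : L →+* ℂ => f (β : L)) hg
    exact (Complex.ofReal_injective this).symm
  obtain ⟨s, hs⟩ := h g.symm
  have h2 : g.symm (β : L) = (s : L) ^ 2 * (β : L) := by
    have := congrArg (fun u : Lˣ => (u : L)) (eq_div_iff_mul_eq'.1 hs)
    exact this.symm
  rw [h1, h2, map_mul, map_pow]
  have : φ (s : L) ≠ 0 := by simp
  positivity
/-- local computation at primes above 2 -/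
lemma two_dvd (hR : R2' L) {u : L} {a b : 𝓞 L} (h : u ^ 2 * (1 + 2 * (a : L)) = 1 + 2 * (b : L)) :
    ∃ m : 𝓞 L, (b : L) - a = 2 * m := by
  by_cases hab : (b : L) - a = 0
  · exact ⟨0, by rw [hab]; simp⟩
  have h2 : (2 : L) ≠ 0 := two_ne_zero
  obtain ⟨m, hm⟩ := int_of_ord (x := ((b : L) - a) / 2) (fun P => by
    rw [ord_div P hab h2]
    have hn : 0 ≤ ord P ((b : L) - a) := ord_int_nonneg P (b - a)
    have h20 : 0 ≤ ord P (2 : L) := ord_int_nonneg P 2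
    by_contra hlt
    have h21 : ord P (2 : L) = 1 := by have := hR P; omega
    have hn0 : ord P ((b : L) - a) = 0 := by omega
    have h2a : ord P (1 + 2 * (a : L)) = 0 := by
      by_cases ha : (a : L) = 0
      · rw [ha, mul_zero, add_zero, ord_one]
      · refine ord_one_add P (mul_ne_zero h2 ha) ?_
        rw [ord_mul P h2 ha, h21]; have := ord_int_nonneg P a; omega
    have h1a : 1 + 2 * (a : L) ≠ 0 := fun h0 => by
      rw [h0, mul_zero] at h
      have h3 : 2 * (a : L) = -1 := by linear_combination h0
      have h4 : 2 * (b : L) = -1 := by linear_combination -h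
      exact hab (mul_left_cancel₀ h2 (by rw [mul_sub, h3, h4]; ring))
    have hf : (u - 1) * (u + 1) * (1 + 2 * (a : L)) = 2 * ((b : L) - a) := by linear_combination h
    have hne : (u - 1) * (u + 1) * (1 + 2 * (a : L)) ≠ 0 := by rw [hf]; exact mul_ne_zero h2 hab
    have hu1 : u - 1 ≠ 0 := left_ne_zero_of_mul (left_ne_zero_of_mul hne)
    have hu2 : u + 1 ≠ 0 := right_ne_zero_of_mul (left_ne_zero_of_mul hne)
    have ho := congrArg (ord P) hf
    rw [ord_mul P (mul_ne_zero hu1 hu2) h1a, ord_mul P hu1 hu2, ord_mul P h2 hab, h2a, h21, hn0] at ho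
    rcases le_or_gt (ord P (u - 1)) 0 with hle | hgt
    · have h5 : u + 1 = (u - 1) * (1 + 2 / (u - 1)) := by field_simp; ring
      have h6 := ord_one_add P (z := 2 / (u - 1)) (div_ne_zero h2 hu1) (by
        rw [ord_div P h2 hu1, h21]; omega)
      have h7 : 1 + 2 / (u - 1) ≠ 0 := fun h0 => hu2 (by rw [h5, h0, mul_zero])
      rw [h5, ord_mul P hu1 h7, h6] at ho
      omega
    · have h8 : ord P (u + 1) ≤ 0 := by omega
      have h5 : u - 1 = (u + 1) * (1 + -(2 / (u + 1))) := by field_simp; ring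
      have h6 := ord_one_add P (z := -(2 / (u + 1))) (neg_ne_zero.2 (div_ne_zero h2 hu2)) (by
        rw [ord_neg, ord_div P h2 hu2, h21]; omega)
      have h7 : 1 + -(2 / (u + 1)) ≠ 0 := fun h0 => hu1 (by rw [h5, h0, mul_zero])
      rw [h5, ord_mul P hu2 h7, h6] at hgt
      omega)
  exact ⟨m, by rw [hm]; field_simp⟩
lemma rep_inv [IsGalois K L] (hR : R2' L) {θ : 𝓞 L} (hθ : Algebra.trace K L (θ : L) = 1) {β : Lˣ}
    (hβ : β ∈ X0 K L ⊓ VT ∅) : ∃ b : 𝓞 K, ∃ x : Lˣ, ∃ a : 𝓞 L, (β : L) * (x : L) ^ 2 = 1 + 2 * (a : L) ∧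
      (2 : 𝓞 L) ∣ a - algebraMap (𝓞 K) (𝓞 L) b := by
  obtain ⟨x, a, hx⟩ := rep2 hR.r2 β (fun P _ => mem_VT.1 hβ.2 P (Finset.notMem_empty _))
  have key : ∀ g : L ≃ₐ[K] L, ∃ m : 𝓞 L, g (a : L) - a = 2 * m := fun g => by
    obtain ⟨s, hs⟩ := hβ.1 g
    have h2 : g (β : L) = (s : L) ^ 2 * (β : L) := by
      have := congrArg (fun u : Lˣ => (u : L)) (eq_div_iff_mul_eq'.1 hs)
      exact this.symm
    refine two_dvd hR (u := (s : L) * g (x : L) / (x : L)) (b := sO g a) ?_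
    have h3 := congrArg g hx
    rw [map_mul, map_pow, h2, map_add, map_mul, map_one, map_ofNat] at h3
    rw [sO_coe, ← h3, ← hx]
    have := x.ne_zero
    field_simp
  choose m hm using key
  obtain ⟨b, hb⟩ : ∃ b : 𝓞 K, (b : K) = Algebra.trace K L ((θ : L) * a) :=
    ⟨⟨_, Algebra.isIntegral_trace (RingOfIntegers.isIntegral_coe (θ * a))⟩, rfl⟩
  have hi : IsIntegral ℤ (∑ g : L ≃ₐ[K] L, g (θ : L) * (m g : L)) := IsIntegral.sum _ fun g _ =>
    (RingOfIntegers.isIntegral_coe (sO g θ)).mul (RingOfIntegers.isIntegral_coe (m g))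
  refine ⟨b, x, a, hx, -⟨_, hi⟩, RingOfIntegers.ext ?_⟩
  change (a : L) - algebraMap K L (b : K) = 2 * -∑ g : L ≃ₐ[K] L, g (θ : L) * (m g : L)
  have h1 : ∑ g : L ≃ₐ[K] L, g (θ : L) = 1 := by rw [← trace_eq_sum_automorphisms, hθ, map_one]
  have h4 : ∑ g : L ≃ₐ[K] L, g (θ : L) * (g (a : L) - a) = algebraMap K L (b : K) - a := by
    simp only [mul_sub, Finset.sum_sub_distrib, ← Finset.sum_mul, h1, one_mul, hb,
      trace_eq_sum_automorphisms, map_mul]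
  simp only [hm] at h4
  rw [← neg_sub, ← h4, mul_neg, Finset.mul_sum]
  congr 1
  exact Finset.sum_congr rfl fun g _ => by ring
lemma partC2 [IsGalois K L] (hR : R2' L) {θ : 𝓞 L} (hθ : Algebra.trace K L (θ : L) = 1)
    (hno : ∀ β ∈ X0 K L, β ∈ WT ∅ → β ∈ Sqr L) :
    (Y0 K L).relIndex (X0 K L ⊓ VT ∅) ≠ 0 ∧
      (Y0 K L).relIndex (X0 K L ⊓ VT ∅) ≤ 2 ^ (2 * Module.finrank ℚ K) := by
  classical
  have hrep : ∀ β : Lˣ, ∃ b : 𝓞 K, β ∈ X0 K L ⊓ VT ∅ → ∃ x : Lˣ, ∃ a : 𝓞 L,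
      (β : L) * (x : L) ^ 2 = 1 + 2 * (a : L) ∧ (2 : 𝓞 L) ∣ a - algebraMap (𝓞 K) (𝓞 L) b := fun β => by
    by_cases h : β ∈ X0 K L ⊓ VT ∅
    · obtain ⟨b, hb⟩ := rep_inv hR hθ h
      exact ⟨b, fun _ => hb⟩
    · exact ⟨0, fun h' => absurd h' h⟩
  choose b hb using hrep
  have := relIndex_le_card (Y0 K L) (X0 K L ⊓ VT ∅)
    (α := ((K →+* ℝ) → Bool) × (𝓞 K ⧸ Ideal.span {(2 : 𝓞 K)}))
    (fun β => (fun φ => decide (∃ ψ : L →+* ℝ, ψ.comp (algebraMap K L) = φ ∧ 0 < ψ (β : L)),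
      Ideal.Quotient.mk _ (b β))) ?_
  · refine ⟨this.1, this.2.trans ?_⟩
    rw [Nat.card_prod, card_two, Nat.card_fun, two_mul, pow_add]
    rw [Nat.card_eq_fintype_card (α := Bool), Fintype.card_bool]
    exact Nat.mul_le_mul_right _ (Nat.pow_le_pow_right two_pos card_real)
  · intro α hα β hβ hab
    obtain ⟨h1, h2⟩ := Prod.ext_iff.1 hab
    refine mem_sup_right (hno _ ((X0 K L).div_mem hα.1 hβ.1)
      ⟨(VT ∅).div_mem hα.2 hβ.2, fun φ => ?_, ?_⟩)
    · have h3 := congrFun h1 (φ.comp (algebraMap K L))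
      simp only [decide_eq_decide] at h3
      have h3' : 0 < φ (α : L) ↔ 0 < φ (β : L) :=
        ⟨fun h => by obtain ⟨ψ, e, h⟩ := h3.1 ⟨φ, rfl, h⟩; exact X0_sign hβ.1 e h,
          fun h => by obtain ⟨ψ, e, h⟩ := h3.2 ⟨φ, rfl, h⟩; exact X0_sign hα.1 e h⟩
      rw [Units.val_div_eq_div_val, map_div₀]
      have hn1 : φ (α : L) ≠ 0 := by simp
      have hn2 : φ (β : L) ≠ 0 := by simp
      rcases lt_or_gt_of_ne hn1 with h | h
      · refine div_pos_of_neg_of_neg h ?_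
        exact lt_of_le_of_ne (not_lt.1 fun h' => absurd (h3'.2 h') (not_lt.2 h.le)) hn2
      · exact div_pos h (h3'.1 h)
    · obtain ⟨x, a, hx, hxa⟩ := hb α hα
      obtain ⟨y, c, hy, hyc⟩ := hb β hβ
      refine S4_of_cong hx hy ?_
      have h4 : (2 : 𝓞 K) ∣ b α - b β := by
        rw [← Ideal.mem_span_singleton, ← Ideal.Quotient.eq]
        exact h2
      have h5 := map_dvd (algebraMap (𝓞 K) (𝓞 L)) h4
      rw [map_ofNat, map_sub] at h5
      have := dvd_sub (dvd_add hxa h5) hyc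
      convert this using 1; ring
/-- Main counting argument: a Galois-stable new quadratic unramified extension exists. -/
theorem exists_beta [IsGalois K L] [IsTotallyReal L] {n : ℕ} (hn : Module.finrank K L = 2 ^ n)
    (hU : Unr K L) (hR : R2' K) {θ : 𝓞 L} (hθ : Algebra.trace K L (θ : L) = 1)
    (hd2 : Module.finrank ℚ K = 2) (hW : 2 ^ 8 ≤ (Sqr K).relIndex (WT ∅)) :
    ∃ β ∈ X0 K L, β ∈ WT ∅ ∧ β ∉ Sqr L := by
  by_contra hcon
  push Not at hcon
  haveI : IsTotallyReal K := IsTotallyReal.of_algebra K L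
  haveI : Fact (Nat.Prime 2) := ⟨Nat.prime_two⟩
  have hG : IsPGroup 2 (L ≃ₐ[K] L) := IsPGroup.of_card (n := n) (by rw [IsGalois.card_aut_eq_finrank, hn])
  obtain ⟨d, hd, hgs⟩ := GSpack hG
  obtain ⟨hA0, hA⟩ := partA hcon
  have hd8 : 8 ≤ d := (Nat.pow_le_pow_iff_right one_lt_two).1 (hW.trans (hA.trans hd))
  obtain ⟨Γ, _, _, τ, hτ, hχ, hlt⟩ := hgs (by omega)
  obtain ⟨hC0, hC⟩ := partC1 hU
  obtain ⟨hD0, hD⟩ := partC2 (hR.up hU) hθ hcon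
  rw [hd2] at hD
  have hXY : (Y0 K L).relIndex (X0 K L) =
      (Y0 K L).relIndex (X0 K L ⊓ VT ∅) * (Y0 K L ⊔ (X0 K L ⊓ VT ∅)).relIndex (X0 K L) := by
    rw [← relIndex_mul_relIndex (Y0 K L) (Y0 K L ⊔ (X0 K L ⊓ VT ∅)) (X0 K L) le_sup_left
      (sup_le Y0_le inf_le_left), relIndex_sup_left]
  have hB := partB hn hU hR τ hτ hχ (by rw [hXY]; exact mul_ne_zero hD0 hC0)
  have hv := v_eq (K := K)
  obtain ⟨hw0, hw⟩ := WT_index hR.r2 (∅ : Finset (Pr K)) (by simp)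
  rw [← relIndex_mul_relIndex (Sqr K) (WT ∅) (VT ∅) (Sqr_le_WT _) inf_le_left, hd2] at hv
  rw [hd2] at hw
  have hc : cK K ≤ 2 ^ (d + 2) := by
    have := Nat.mul_le_mul (hA.trans hd) hw
    rw [hv] at this
    have e : 2 ^ d * 2 ^ (2 * 2) = 2 ^ 2 * 2 ^ (d + 2) := by ring
    rw [e] at this
    exact Nat.le_of_mul_le_mul_left this (by norm_num)
  have hfin : Nat.card {ψ : τ.ker →* ℤˣ // ∀ (γ : Γ) (x y : τ.ker), (y : Γ) = γ * x * γ⁻¹ → ψ y = ψ x} ≤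
      2 ^ (d + 6) := by
    refine hB.trans (hXY.le.trans ((Nat.mul_le_mul hD (hC.trans hc)).trans (le_of_eq (by ring))))
  have := hlt.trans_le (Nat.pow_le_pow_left hfin 4)
  rw [← pow_mul] at this
  have h9 := (Nat.pow_lt_pow_iff_right one_lt_two).1 this
  nlinarith
end
section
variable {K : Type} [Field K] [NumberField K]
variable {L : Type} [Field L] [NumberField L] [Algebra K L]
variable {M : Type} [Field M] [NumberField M] [Algebra L M] {σ : M ≃ₐ[L] M}
lemma sg_ne {γ : M} {β : Lˣ} (hγ : γ ^ 2 = algebraMap L M β) (hs : σ γ = -γ) : σ γ ≠ γ := fun h => by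
  rw [hs] at h
  have h0 : γ = 0 := by linear_combination (-1 / 2 : M) * h
  rw [h0, zero_pow two_ne_zero] at hγ
  exact β.ne_zero ((map_eq_zero (algebraMap L M)).1 hγ.symm)
lemma gal_ext [IsGalois K L] [Algebra K M] [IsScalarTower K L M] (h : Quad σ) {γ : M} {β : Lˣ}
    (hγ : γ ^ 2 = algebraMap L M β) (hs : σ γ = -γ) (hβ : β ∈ X0 K L) : IsGalois K M := by
  let Ω := AlgebraicClosure M
  let j : M →ₐ[K] Ω := IsScalarTower.toAlgHom K M Ω
  have key : ∀ (φ : M →ₐ[K] Ω) (x : M), φ x ∈ j.fieldRange := fun φ x => by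
    have hg : ∀ y : L, φ (algebraMap L M y) = j (algebraMap L M (φ.restrictNormal' L y)) := fun y => by
      have := AlgHom.restrictNormal_commutes φ L y
      rw [← this, IsScalarTower.algebraMap_apply L M Ω]; rfl
    obtain ⟨s, hs'⟩ := hβ (φ.restrictNormal' L)
    have h2 : (φ.restrictNormal' L) (β : L) = (s : L) ^ 2 * (β : L) := by
      have := congrArg (fun u : Lˣ => (u : L)) (eq_div_iff_mul_eq'.1 hs')
      exact this.symm
    have h3 : (φ γ) ^ 2 = (j (algebraMap L M s * γ)) ^ 2 := by
      rw [← map_pow, hγ, hg, h2, ← map_pow, mul_pow, hγ, map_mul, map_pow]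
    obtain ⟨a, b, rfl⟩ := h.basis (sg_ne hγ hs) x
    rw [map_add, map_mul, hg, hg]
    refine add_mem ⟨_, rfl⟩ (mul_mem ⟨_, rfl⟩ ?_)
    rcases sq_eq_sq_iff_eq_or_eq_neg.1 h3 with h4 | h4 <;> rw [h4]
    · exact ⟨_, rfl⟩
    · exact neg_mem ⟨_, rfl⟩
  let e : M ≃ₐ[K] j.fieldRange := AlgEquiv.ofInjectiveField j
  haveI : Algebra.IsAlgebraic K Ω := Algebra.IsAlgebraic.trans K M Ω
  haveI : Normal K Ω := normal_iff.2 fun x =>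
    ⟨(Algebra.IsAlgebraic.isAlgebraic x).isIntegral, IsAlgClosed.splits _⟩
  haveI : Normal K j.fieldRange := IntermediateField.normal_iff_forall_fieldRange_le.2 fun τ => by
    rintro _ ⟨y, rfl⟩
    have := key (τ.comp e.toAlgHom) (e.symm y)
    simpa using this
  haveI : Normal K M := Normal.of_algEquiv e.symm
  exact IsGalois.mk
lemma discr_quad (h : Quad σ) : (discr M).natAbs =
    Ideal.absNorm (differentIdeal (𝓞 L) (𝓞 M)) * (discr L).natAbs ^ 2 := by
  rw [natAbs_discr_eq_absNorm_differentIdeal_mul_natAbs_discr_pow L (𝓞 L) M (𝓞 M), h.deg]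
lemma discr_unr (h : Quad σ) (hd : ∀ P : Pr M, ∃ δ : 𝓞 M, δ - sO σ δ ∉ P.asIdeal) :
    (discr M).natAbs = (discr L).natAbs ^ 2 := by
  have : differentIdeal (𝓞 L) (𝓞 M) = ⊤ := by
    by_contra hne
    obtain ⟨m, hm, hle⟩ := Ideal.exists_le_maximal _ hne
    have hb : m ≠ ⊥ := fun hb => by
      rw [hb, le_bot_iff] at hle
      exact differentIdeal_ne_bot hle
    obtain ⟨δ, hδ⟩ := hd ⟨m, hm.isPrime, hb⟩
    exact hδ (hle (diff_mem h δ))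
  rw [discr_quad h, this, Ideal.absNorm_top, one_mul]
def Tow (K : Type) [Field K] [NumberField K] (n : ℕ) : Prop :=
  ∃ (L : Type) (_ : Field L) (_ : NumberField L) (_ : Algebra K L), IsGalois K L ∧ IsTotallyReal L ∧
    Module.finrank K L = 2 ^ n ∧ Unr K L ∧ (∃ θ : 𝓞 L, Algebra.trace K L (θ : L) = 1) ∧
    (discr L).natAbs = (discr K).natAbs ^ 2 ^ n
lemma Quad.trace (h : Quad σ) (x : M) : algebraMap L M (Algebra.trace L M x) = x + σ x := by
  classical
  haveI := quad_galois h.deg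
  have hne : (1 : M ≃ₐ[L] M) ≠ σ := fun h1 => by
    obtain ⟨c, hc⟩ := h.ne; rw [← h1] at hc; exact hc rfl
  have hu : (Finset.univ : Finset (M ≃ₐ[L] M)) = {1, σ} := by
    symm
    apply Finset.eq_univ_of_card
    rw [Finset.card_pair hne, ← Nat.card_eq_fintype_card, IsGalois.card_aut_eq_finrank, h.deg]
  rw [trace_eq_sum_automorphisms, hu, Finset.sum_pair hne]; rfl
theorem tow_succ (hR : R2' K) (hd2 : Module.finrank ℚ K = 2) (hW : 2 ^ 8 ≤ (Sqr K).relIndex (WT ∅))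
    {n : ℕ} (hT : Tow K n) : Tow K (n + 1) := by
  obtain ⟨L, _, _, _, _, _, hn, hU, ⟨θ, hθ⟩, hD⟩ := hT
  obtain ⟨β, hX, hβ, hns⟩ := exists_beta hn hU hR hθ hd2 hW
  obtain ⟨M, _, _, _, γ, σ, hσ, hγ, hs⟩ := exists_ext (β : L) (fun h => hns (mem_Sqr'.2 h))
  letI : Algebra K M := ((algebraMap L M).comp (algebraMap K L)).toAlgebra
  haveI : IsScalarTower K L M := IsScalarTower.of_algebraMap_eq fun _ => rfl
  have hdel : ∀ P : Pr M, ∃ δ : 𝓞 M, δ - sO σ δ ∉ P.asIdeal := fun P =>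
    kummer_delta hγ hs P (mem_VT.1 hβ.1 _ (Finset.notMem_empty _)) hβ.2.2
  refine ⟨M, inferInstance, inferInstance, inferInstance, gal_ext hσ hγ hs hX, TR_ext hσ hγ hs hβ.2.1,
    ?_, hU.trans (unr_of_ram fun P => ?_), ?_, ?_⟩
  · rw [← Module.finrank_mul_finrank K L M, hn, hσ.deg, pow_succ]
  · obtain ⟨δ, hδ⟩ := hdel P
    exact ram_one hσ P δ hδ
  · obtain ⟨x, w, hx⟩ := hβ.2.2
    have e1 : (algebraMap L M x * γ) ^ 2 = 1 + 4 * algebraMap L M (w : L) := by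
      rw [mul_pow, hγ, ← map_pow, ← map_mul, mul_comm, hx, map_add, map_one, map_mul, map_ofNat]
    have hint : IsIntegral ℤ ((1 + algebraMap L M x * γ) / 2) := by
      have e2 : ((1 + algebraMap L M x * γ) / 2) * ((1 + algebraMap L M x * γ) / 2 - 1) =
          algebraMap L M (w : L) := by linear_combination e1 / 4
      have hw : IsIntegral ℤ (algebraMap L M (w : L)) := (RingOfIntegers.isIntegral_coe w).algebraMap
      rw [← e2] at hw
      exact int_of_mul_sub hw
    refine ⟨algebraMap (𝓞 L) (𝓞 M) θ * ⟨_, hint⟩, ?_⟩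
    change Algebra.trace K M (algebraMap L M (θ : L) * ((1 + algebraMap L M x * γ) / 2)) = 1
    have h1 : Algebra.trace L M ((1 + algebraMap L M x * γ) / 2) = 1 := by
      apply (algebraMap L M).injective
      rw [hσ.trace, map_div₀, map_add, map_mul, hs, map_one, map_ofNat, AlgEquiv.commutes, map_one]; ring
    rw [← Algebra.trace_trace (S := L), ← Algebra.smul_def, map_smul, h1, smul_eq_mul, mul_one, hθ]
  · rw [discr_unr hσ hdel, hD, ← pow_mul, pow_succ]
theorem tow_all [IsTotallyReal K] (hR : R2' K) (hd2 : Module.finrank ℚ K = 2)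
    (hW : 2 ^ 8 ≤ (Sqr K).relIndex (WT ∅)) (n : ℕ) : Tow K n := by
  induction n with
  | zero =>
    refine ⟨K, inferInstance, inferInstance, inferInstance, inferInstance, inferInstance, by simp,
      fun P => ?_, ⟨1, ?_⟩, by simp⟩
    · obtain ⟨x, h0, h1⟩ := exists_unif P
      exact ⟨x, h0, h1⟩
    · change Algebra.trace K K 1 = 1
      rw [Algebra.trace_self_apply]
  | succ n ih => exact tow_succ hR hd2 hW ih
end
section
variable {K : Type} [Field K] [NumberField K]
lemma R2'_rat : R2' ℚ := fun P => by
  by_contra hlt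
  have h2 : ((2 : ℕ) : ℤ) ≤ ord P (((2 : ℕ) : 𝓞 ℚ) : ℚ) := by
    change _ ≤ ord P (2 : ℚ); push_cast; omega
  rw [ord_ge_iff P (by norm_num)] at h2
  have h3 := Ideal.absNorm_dvd_absNorm_of_le ((Ideal.span_singleton_le_iff_mem _).2 h2)
  rw [Ideal.absNorm_span_natCast, RingOfIntegers.rank, Module.finrank_self, pow_one, map_pow, pow_two] at h3
  have h4 := Nat.prime_two.prime.squarefree _ h3
  rw [Nat.isUnit_iff, Ideal.absNorm_eq_one_iff] at h4
  exact P.isPrime.ne_top h4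
noncomputable def nU (K : Type) [Field K] [NumberField K] (e : ℕ) (he : e ≠ 0) : Kˣ :=
  Units.mk0 (e : K) (Nat.cast_ne_zero.2 he)
lemma nU_TP {e : ℕ} (he : e ≠ 0) : nU K e he ∈ TP K := fun φ => by
  change 0 < φ (e : K)
  rw [map_natCast]; exact Nat.cast_pos.2 (Nat.pos_of_ne_zero he)
lemma nU_S4 {e : ℕ} (he : e ≠ 0) (h4 : e % 4 = 1) : nU K e he ∈ S4 K := by
  refine ⟨1, ((e / 4 : ℕ) : 𝓞 K), ?_⟩
  change (e : K) * (1 : K) ^ 2 = 1 + 4 * ((e / 4 : ℕ) : K)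
  have h : e = 1 + 4 * (e / 4) := by omega
  calc (e : K) * (1 : K) ^ 2 = ((1 + 4 * (e / 4) : ℕ) : K) := by rw [← h]; simp
    _ = _ := by push_cast; ring
lemma cop_ord {a b : ℕ} (h : a.Coprime b) (P : Pr K) (ha : (a : 𝓞 K) ∈ P.asIdeal) : ord P (b : K) = 0 := by
  refine ord_int_zero P (x := (b : 𝓞 K)) fun hb => P.isPrime.ne_top ?_
  obtain ⟨u, v, huv⟩ := Nat.isCoprime_iff_coprime.2 h
  rw [Ideal.eq_top_iff_one]
  have := P.asIdeal.add_mem (P.asIdeal.mul_mem_left (u : 𝓞 K) ha) (P.asIdeal.mul_mem_left (v : 𝓞 K) hb)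
  have e : ((u : 𝓞 K)) * (a : 𝓞 K) + v * b = ((u * a + v * b : ℤ) : 𝓞 K) := by push_cast; rfl
  rwa [e, huv, Int.cast_one] at this
lemma nU_WT {γ : K} {e m : ℕ} (he : e ≠ 0) (hm : m ≠ 0) (hγ : γ ^ 2 = ((e * m : ℕ) : K)) (hc : e.Coprime m)
    (h4 : e % 4 = 1) : nU K e he ∈ WT ∅ := by
  refine ⟨fun P _ => ?_, nU_TP he, nU_S4 he h4⟩
  change Even (ord P (e : K))
  by_cases h : (e : 𝓞 K) ∈ P.asIdeal
  · have h1 := congrArg (ord P) hγ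
    rw [ord_pow, Nat.cast_mul, ord_mul P (Nat.cast_ne_zero.2 he) (Nat.cast_ne_zero.2 hm),
      cop_ord hc P h, add_zero] at h1
    exact ⟨ord P γ, by rw [← h1]; push_cast; ring⟩
  · have := ord_int_zero P h
    change ord P (e : K) = 0 at this
    rw [this]; exact Even.zero
variable {p : Fin 9 → ℕ} (hp : ∀ i, (p i).Prime) (hi : Function.Injective p) (h4 : ∀ i, p i % 4 = 1)
include hp
lemma pr_ne (S : Finset (Fin 9)) : ∏ i ∈ S, p i ≠ 0 := Finset.prod_ne_zero_iff.2 fun i _ => (hp i).ne_zero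
include hi in
lemma pr_fac (S : Finset (Fin 9)) (j : Fin 9) : (∏ i ∈ S, p i).factorization (p j) = if j ∈ S then 1 else 0 := by
  rw [Nat.factorization_prod (fun i _ => (hp i).ne_zero), Finsupp.finsetSum_apply]
  simp only [(hp _).factorization, Finsupp.single_apply, hi.eq_iff]
  rw [Finset.sum_ite_eq']
include hi in
lemma pr_cop (S : Finset (Fin 9)) : (∏ i ∈ S, p i).Coprime (∏ i ∈ Sᶜ, p i) :=
  Nat.Coprime.prod_left fun i hS => Nat.Coprime.prod_right fun j hj =>
    (Nat.coprime_primes (hp i) (hp j)).2 fun h => (Finset.mem_compl.1 hj) (hi h ▸ hS)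
include h4 in
omit hp in
lemma pr_mod (S : Finset (Fin 9)) : (∏ i ∈ S, p i) % 4 = 1 :=
  Finset.prod_induction _ (fun n => n % 4 = 1) (fun a b ha hb => by rw [Nat.mul_mod, ha, hb]) rfl
    fun i _ => h4 i
omit hp in
lemma fac_even {n q : ℕ} (h : IsSquare n) : Even (n.factorization q) := by
  obtain ⟨r, rfl⟩ := h
  rw [← pow_two, Nat.factorization_pow]
  exact ⟨r.factorization q, by simp [two_mul]⟩
include hi h4 in
theorem base_field : ∃ (K : Type) (_ : Field K) (_ : NumberField K), IsTotallyReal K ∧ R2' K ∧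
    Module.finrank ℚ K = 2 ∧ 2 ^ 8 ≤ (Sqr K).relIndex (WT ∅) := by
  classical
  set D := ∏ i, p i with hD
  have hD0 : D ≠ 0 := pr_ne hp _
  have hD4 : D % 4 = 1 := pr_mod h4 _
  have hns : ¬ IsSquare ((nU ℚ D hD0 : ℚˣ) : ℚ) := fun h => by
    have h1 := fac_even (q := p 0) (Rat.isSquare_natCast_iff.1 h)
    rw [pr_fac hp hi, if_pos (Finset.mem_univ _)] at h1
    exact absurd h1 (by decide)
  obtain ⟨K, _, _, alg, γ, σ, hσ, hγ, hs⟩ := exists_ext _ hns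
  have halg : alg = DivisionRing.toRatAlgebra := Subsingleton.elim _ _
  subst halg
  have hγ' : γ ^ 2 = (D : K) := by
    rw [hγ]; exact map_natCast (algebraMap ℚ K) D
  haveI : IsTotallyReal K := TR_ext hσ hγ hs (nU_TP hD0)
  refine ⟨K, inferInstance, inferInstance, inferInstance, fun P => ?_, hσ.deg, ?_⟩
  · have h1 := ord_algebraMap (K := ℚ) P 2
    rw [map_ofNat] at h1
    rw [h1]
    by_cases h2 : (2 : 𝓞 ℚ) ∈ (under ℚ P).asIdeal
    · have h3 : ord (under ℚ P) (D : ℚ) = 0 := cop_ord (a := 2) (b := D)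
        (by rw [Nat.coprime_two_left, Nat.odd_iff]; omega) _ h2
      rw [ram_one_kummer hσ hγ hs P (by change Even (ord (under ℚ P) (D : ℚ)); rw [h3]; exact Even.zero)
        (nU_S4 hD0 hD4), Nat.cast_one, one_mul]
      exact R2'_rat _
    · have := ord_int_zero _ h2
      change ord (under ℚ P) (2 : ℚ) = 0 at this
      rw [this]; norm_num
  · have hfin : (Sqr K).relIndex (WT ∅) ≠ 0 := by
      have hv := v_eq (K := K)
      rw [← relIndex_mul_relIndex (Sqr K) (WT ∅) (VT ∅) (Sqr_le_WT _) inf_le_left] at hv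
      refine left_ne_zero_of_mul (b := (WT (∅ : Finset (Pr K))).relIndex (VT ∅)) ?_
      rw [hv]; exact mul_ne_zero (by positivity) cK_ne
    haveI : Finite ((WT (∅ : Finset (Pr K))) ⧸ (Sqr K).subgroupOf (WT ∅)) :=
      Nat.finite_of_card_ne_zero hfin
    let i8 : Finset (Fin 8) → Finset (Fin 9) := fun S => S.map Fin.castSuccEmb
    let u : Finset (Fin 8) → Kˣ := fun S => nU K _ (pr_ne hp (i8 S))
    have hu : ∀ S, u S ∈ WT ∅ := fun S => nU_WT (γ := γ) _ (pr_ne hp (i8 S)ᶜ)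
      (by rw [Finset.prod_mul_prod_compl, hγ']) (pr_cop hp hi _) (pr_mod h4 _)
    have hc : Nat.card (Finset (Fin 8)) = 2 ^ 8 := by rw [Nat.card_eq_fintype_card]; simp
    rw [← hc]
    change _ ≤ Nat.card ((WT (∅ : Finset (Pr K))) ⧸ (Sqr K).subgroupOf (WT ∅))
    refine Nat.card_le_card_of_injective (fun S => (QuotientGroup.mk (⟨u S, hu S⟩ : WT (∅ : Finset (Pr K))) :
      (WT (∅ : Finset (Pr K))) ⧸ (Sqr K).subgroupOf (WT ∅))) fun S T h => ?_
    have h1 : (u S)⁻¹ * u T ∈ Sqr K := mem_subgroupOf.1 (QuotientGroup.eq.1 h)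
    have h2 : u S * u T ∈ Sqr K := by
      have : u S * u T = (u S) ^ 2 * ((u S)⁻¹ * u T) := by rw [pow_two, mul_assoc, mul_inv_cancel_left]
      rw [this]; exact mul_mem ⟨u S, rfl⟩ h1
    have hS := pr_ne hp (i8 S)
    have hT := pr_ne hp (i8 T)
    have h3 : IsSquare ((aK ℚ K (nU ℚ _ hS * nU ℚ _ hT) : Kˣ) : K) := by
      have e : aK ℚ K (nU ℚ _ hS * nU ℚ _ hT) = u S * u T := Units.ext (by
        rw [aK_coe, Units.val_mul, Units.val_mul, map_mul]
        exact congrArg₂ _ (map_natCast (algebraMap ℚ K) _) (map_natCast (algebraMap ℚ K) _))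
      rw [e]; exact mem_Sqr'.1 h2
    have hl : ∀ S : Finset (Fin 8), Fin.last 8 ∉ i8 S := fun S hm => by
      obtain ⟨x, _, hx⟩ := Finset.mem_map.1 hm
      exact (Fin.castSucc_lt_last x).ne hx
    rcases sq_up hσ hγ hs _ h3 with h5 | h5
    · have h6 : IsSquare (((∏ i ∈ i8 S, p i) * ∏ i ∈ i8 T, p i : ℕ) : ℚ) := by
        rw [Nat.cast_mul]; exact mem_Sqr'.1 h5
      ext x
      have h7 := fac_even (q := p (Fin.castSuccEmb x)) (Rat.isSquare_natCast_iff.1 h6)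
      rw [Nat.factorization_mul hS hT, Finsupp.add_apply, pr_fac hp hi, pr_fac hp hi] at h7
      simp only [i8, Finset.mem_map'] at h7
      by_cases hx : x ∈ S <;> by_cases hx' : x ∈ T <;> simp [hx, hx'] at h7 ⊢
    · have h6 : IsSquare (((∏ i ∈ i8 S, p i) * (∏ i ∈ i8 T, p i) * D : ℕ) : ℚ) := by
        rw [Nat.cast_mul, Nat.cast_mul]; exact mem_Sqr'.1 h5
      have h7 := fac_even (q := p (Fin.last 8)) (Rat.isSquare_natCast_iff.1 h6)
      rw [Nat.factorization_mul (mul_ne_zero hS hT) hD0, Nat.factorization_mul hS hT, Finsupp.add_apply,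
        Finsupp.add_apply, pr_fac hp hi, pr_fac hp hi, hD, pr_fac hp hi, if_neg (hl S), if_neg (hl T),
        if_pos (Finset.mem_univ _)] at h7
      exact absurd h7 (by decide)
end
/-- Totally real towers with bounded root discriminant. -/
theorem towers : ∃ C : ℕ, ∀ n : ℕ, ∃ (L : Type) (_ : Field L) (_ : NumberField L), IsTotallyReal L ∧
    Module.finrank ℚ L = 2 * 2 ^ n ∧ (discr L).natAbs = C ^ 2 ^ n := by
  obtain ⟨K, _, _, _, hR, hd, hW⟩ := base_field (p := ![5, 13, 17, 29, 37, 41, 53, 61, 73])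
    (by intro i; fin_cases i <;> norm_num) (by decide) (by decide)
  refine ⟨(discr K).natAbs, fun n => ?_⟩
  obtain ⟨L, _, _, _, _, hT, hn, _, _, hD⟩ := tow_all hR hd hW n
  exact ⟨L, inferInstance, inferInstance, hT, by rw [← Module.finrank_mul_finrank ℚ K L, hn, hd], hD⟩
section
variable {K : Type} [Field K] [NumberField K]
variable {L : Type} [Field L] [NumberField L] [Algebra K L] {σ : L ≃ₐ[K] L}
open MeasureTheory mixedEmbedding in
lemma exists_small [IsTotallyReal K] (w0 : InfinitePlace K) : ∃ b : 𝓞 K, (∀ w : InfinitePlace K, w ≠ w0 → w (b : K) < 1) ∧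
    2 ≤ w0 (b : K) ∧ w0 (b : K) ≤ 2 * 4 ^ Module.finrank ℚ K * (discr K).natAbs := by
  classical
  set N := Module.finrank ℚ K with hN
  set D := (discr K).natAbs with hD
  have hD1 : 1 ≤ D := Nat.one_le_iff_ne_zero.2 (Int.natAbs_ne_zero.2 (discr_ne_zero K))
  let f : InfinitePlace K → NNReal := fun w => if w = w0 then 4 ^ N * D else 4⁻¹
  have hcard : Fintype.card (InfinitePlace K) = N := by
    have h1 := IsTotallyReal.finrank (K := K)
    have h2 := InfinitePlace.card_eq_nrRealPlaces_add_nrComplexPlaces K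
    rw [IsTotallyReal.nrComplexPlaces_eq_zero] at h2
    omega
  have hprod : ∏ w, f w ^ w.mult = 4 * D := by
    simp only [IsTotallyReal.mult_eq, pow_one]
    rw [← Finset.mul_prod_erase _ _ (Finset.mem_univ w0)]
    have : ∏ x ∈ Finset.univ.erase w0, f x = 4⁻¹ ^ (N - 1) := by
      rw [Finset.prod_congr rfl (g := fun _ => (4⁻¹ : NNReal)) (fun x hx => by simp [f, Finset.ne_of_mem_erase hx]),
        Finset.prod_const, Finset.card_erase_of_mem (Finset.mem_univ _), Finset.card_univ, hcard]
    rw [this]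
    obtain ⟨m, hm⟩ : ∃ m, N = m + 1 := ⟨N - 1, by have : 0 < N := Module.finrank_pos; omega⟩
    simp only [f, if_true, hm, Nat.add_sub_cancel, pow_succ, inv_pow]
    field_simp
  have hlt : minkowskiBound K ↑1 < volume (convexBodyLT K f) := by
    rw [convexBodyLT_volume, hprod, minkowskiBound, volume_fundamentalDomain_fractionalIdealLatticeBasis,
      Units.val_one, FractionalIdeal.absNorm_one, Rat.cast_one, ENNReal.ofReal_one, one_mul, mixedEmbedding.finrank,
      volume_fundamentalDomain_latticeBasis, IsTotallyReal.nrComplexPlaces_eq_zero, pow_zero, one_mul,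
      convexBodyLTFactor, IsTotallyReal.nrComplexPlaces_eq_zero, ← IsTotallyReal.finrank, pow_zero, mul_one, ← hN]
    norm_cast
    rw [mul_comm]
    have h3 : NNReal.sqrt ‖discr K‖₊ < 4 * D := by
      have : ‖discr K‖₊ = (D : NNReal) := by
        rw [hD]; ext; simp [Int.norm_eq_abs, Nat.cast_natAbs]
      rw [this, ← NNReal.sqrt_sq (4 * (D : NNReal)), NNReal.sqrt_lt_sqrt]
      have h1 : (1 : NNReal) ≤ D := by exact_mod_cast hD1
      norm_cast
      nlinarith
    push_cast
    gcongr
  obtain ⟨a, ha0, ha⟩ := exists_ne_zero_mem_ringOfIntegers_lt K hlt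
  have ho : ∀ w : InfinitePlace K, w ≠ w0 → w (a : K) < 1 / 4 := fun w hw => by
    have := ha w; simp only [f, if_neg hw] at this; push_cast at this; linarith
  have h1 : 1 ≤ w0 (a : K) := InfinitePlace.one_le_of_lt_one ha0 (fun z hz => by linarith [ho z hz])
  have h0 := ha w0
  simp only [f, if_true] at h0
  push_cast at h0
  have h2 : ∀ w : InfinitePlace K, w ((2 * a : 𝓞 K) : K) = 2 * w (a : K) := fun w => by
    rw [show ((2 * a : 𝓞 K) : K) = 2 * (a : K) from (map_mul (algebraMap (𝓞 K) K) 2 a).trans (by rw [map_ofNat]), map_mul]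
    have : w (2 : K) = 2 := by rw [← InfinitePlace.norm_embedding_eq, map_ofNat]; simp
    rw [this]
  refine ⟨2 * a, fun w hw => ?_, ?_, ?_⟩ <;> rw [h2]
  · linarith [ho w hw]
  · linarith
  · rw [mul_assoc]; linarith
noncomputable def rw' [IsTotallyReal K] (w : InfinitePlace K) : K →+* ℝ :=
  InfinitePlace.embedding_of_isReal (IsTotallyReal.isReal w)
lemma rw_abs [IsTotallyReal K] (w : InfinitePlace K) (x : K) : |rw' w x| = w x := by
  rw [← Real.norm_eq_abs]; exact InfinitePlace.norm_embedding_of_isReal _ _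
lemma exists_bet [IsTotallyReal K] (S : Finset (InfinitePlace K)) : ∃ β : 𝓞 K,
    (∀ w ∈ S, rw' w (β : K) < 0 ∧ w (β : K) ≤ (2 * 4 ^ Module.finrank ℚ K * (discr K).natAbs) ^ 2) ∧
    (∀ w ∉ S, 0 < rw' w (β : K) ∧ w (β : K) ≤ 1) := by
  classical
  set M : ℝ := (2 * 4 ^ Module.finrank ℚ K * (discr K).natAbs) with hM
  choose b h1 h2 h3 using fun w0 : InfinitePlace K => exists_small w0
  have hM1 : 2 ≤ M := by
    obtain ⟨w⟩ : Nonempty (InfinitePlace K) := inferInstance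
    linarith [h2 w, h3 w]
  have key : ∀ w v : InfinitePlace K, w ≠ v → 0 < rw' w ((1 - b v ^ 2 : 𝓞 K) : K) ∧ rw' w ((1 - b v ^ 2 : 𝓞 K) : K) ≤ 1 := by
    intro w v hwv
    have := h1 v w hwv
    rw [← rw_abs] at this
    have h4 := sq_lt_one_iff_abs_lt_one (rw' w (b v : K)) |>.2 this
    simp only [map_sub, map_one, map_pow]
    constructor <;> nlinarith [sq_nonneg (rw' w (b v : K))]
  have key2 : ∀ w : InfinitePlace K, rw' w ((1 - b w ^ 2 : 𝓞 K) : K) < 0 ∧ -M^2 ≤ rw' w ((1 - b w ^ 2 : 𝓞 K) : K) := by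
    intro w
    have h4 := h2 w
    have h5 := h3 w
    rw [← rw_abs] at h4 h5
    have h6 := sq_abs (rw' w (b w : K))
    simp only [map_sub, map_one, map_pow]
    constructor <;> nlinarith
  refine ⟨∏ v ∈ S, (1 - b v ^ 2), fun w hw => ?_, fun w hw => ?_⟩ <;> rw [← rw_abs] <;> simp only [map_prod]
  · rw [← Finset.mul_prod_erase _ _ hw]
    have h7 : 0 < ∏ v ∈ S.erase w, rw' w ((1 - b v ^ 2 : 𝓞 K) : K) :=
      Finset.prod_pos fun v hv => (key w v (Finset.ne_of_mem_erase hv).symm).1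
    have h8 : ∏ v ∈ S.erase w, rw' w ((1 - b v ^ 2 : 𝓞 K) : K) ≤ 1 :=
      Finset.prod_le_one (fun v hv => (key w v (Finset.ne_of_mem_erase hv).symm).1.le)
        fun v hv => (key w v (Finset.ne_of_mem_erase hv).symm).2
    obtain ⟨k1, k2⟩ := key2 w
    refine ⟨mul_neg_of_neg_of_pos k1 h7, ?_⟩
    rw [abs_le]
    constructor <;> nlinarith
  · have hh : ∀ v ∈ S, w ≠ v := fun v hv h => hw (h ▸ hv)
    have h7 : 0 < ∏ v ∈ S, rw' w ((1 - b v ^ 2 : 𝓞 K) : K) := Finset.prod_pos fun v hv => (key w v (hh v hv)).1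
    refine ⟨h7, ?_⟩
    rw [abs_of_pos h7]
    exact Finset.prod_le_one (fun v hv => (key w v (hh v hv)).1.le) fun v hv => (key w v (hh v hv)).2
end
section
variable {K : Type} [Field K] [NumberField K]
variable {L : Type} [Field L] [NumberField L] [Algebra K L] {σ : L ≃ₐ[K] L}
lemma rw_place [IsTotallyReal K] (v : InfinitePlace L) (a : K) :
    v.embedding (algebraMap K L a) = ((rw' (v.comap (algebraMap K L)) a : ℝ) : ℂ) := by
  rw [rw', InfinitePlace.embedding_of_isReal_apply,
    InfinitePlace.comap_embedding_of_isReal _ (IsTotallyReal.isReal _)]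
  rfl
lemma place_real [IsTotallyReal K] (h : Quad σ) {α : Kˣ} {γ : L} (hγ : γ ^ 2 = algebraMap K L α) (hs : σ γ = -γ)
    (v : InfinitePlace L) : v.IsReal ↔ 0 < rw' (v.comap (algebraMap K L)) (α : K) := by
  constructor
  · intro hv
    have h1 : (InfinitePlace.embedding_of_isReal hv γ) ^ 2 = rw' (v.comap (algebraMap K L)) (α : K) := by
      have := rw_place v (α : K)
      rw [← hγ, map_pow, ← InfinitePlace.embedding_of_isReal_apply hv] at this
      exact_mod_cast this
    rw [← h1]
    have : γ ≠ 0 := fun h0 => by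
      rw [h0, zero_pow two_ne_zero] at hγ
      exact α.ne_zero ((map_eq_zero _).1 hγ.symm)
    have : InfinitePlace.embedding_of_isReal hv γ ≠ 0 := by simpa using this
    positivity
  · intro hp
    rw [InfinitePlace.isReal_iff]
    set φ := v.embedding with hφ
    have hc := rw_place (K := K) v
    rw [← hφ] at hc
    have h1 : (φ γ) ^ 2 = ((Real.sqrt (rw' (v.comap (algebraMap K L)) (α : K)) : ℝ) : ℂ) ^ 2 := by
      rw [← map_pow, hγ, hc, ← Complex.ofReal_pow, Real.sq_sqrt hp.le]
    have h2 : starRingEnd ℂ (φ γ) = φ γ := by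
      rcases sq_eq_sq_iff_eq_or_eq_neg.1 h1 with h3 | h3 <;> rw [h3] <;> simp
    rw [ComplexEmbedding.isReal_iff]
    ext x
    obtain ⟨a, b, rfl⟩ := h.basis (gam_ne hγ hs) x
    simp only [ComplexEmbedding.conjugate_coe_eq, map_add, map_mul, h2, hc, Complex.conj_ofReal]
lemma ncp [IsTotallyReal K] (h : Quad σ) {α : Kˣ} {γ : L} (hγ : γ ^ 2 = algebraMap K L α) (hs : σ γ = -γ)
    (S : Finset (InfinitePlace K)) (hS : ∀ w, w ∈ S ↔ rw' w (α : K) < 0) :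
    InfinitePlace.nrComplexPlaces L = S.card := by
  classical
  haveI := quad_galois h.deg
  have hr : ∀ v : InfinitePlace L, v.IsUnramified K ↔ v.comap (algebraMap K L) ∉ S := fun v => by
    rw [InfinitePlace.isUnramified_iff, place_real h hγ hs, or_iff_left
      (InfinitePlace.not_isComplex_iff_isReal.2 (IsTotallyReal.isReal _)), hS, not_lt]
    have : rw' (v.comap (algebraMap K L)) (α : K) ≠ 0 := by simp
    exact ⟨le_of_lt, fun h => lt_of_le_of_ne h this.symm⟩
  have h1 := InfinitePlace.card_isUnramified_compl K L
  rw [h.deg, Nat.div_self two_pos, mul_one] at h1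
  have h2 : ({w : InfinitePlace K | w.IsUnramifiedIn L} : Finset _)ᶜ = S := by
    ext w
    obtain ⟨v, rfl⟩ := InfinitePlace.comap_surjective (K := L) w
    simp [InfinitePlace.isUnramifiedIn_comap, hr]
  rw [h2] at h1
  rw [← h1, InfinitePlace.nrComplexPlaces, Fintype.card_subtype]
  congr 1
  ext v
  simp only [Finset.mem_filter, Finset.mem_univ, true_and, Finset.mem_compl, InfinitePlace.isUnramified_iff]
  rw [or_iff_left (InfinitePlace.not_isComplex_iff_isReal.2 (IsTotallyReal.isReal _)), InfinitePlace.not_isReal_iff_isComplex]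
lemma norm_le [IsTotallyReal K] (S : Finset (InfinitePlace K)) (β : 𝓞 K) {M : ℝ} (hM : 0 ≤ M) (h1 : ∀ w ∈ S, w (β : K) ≤ M)
    (h2 : ∀ w ∉ S, w (β : K) ≤ 1) : (Ideal.absNorm (Ideal.span {β}) : ℝ) ≤ M ^ S.card := by
  classical
  have e : (Ideal.absNorm (Ideal.span {β}) : ℝ) = ∏ w : InfinitePlace K, w (β : K) := by
    have := InfinitePlace.prod_eq_abs_norm (β : K)
    simp only [IsTotallyReal.mult_eq, pow_one] at this
    rw [this, Ideal.absNorm_span_singleton, ← Algebra.coe_norm_int β]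
    simp [Nat.cast_natAbs]
  rw [e, ← Finset.prod_mul_prod_compl S, ← Finset.prod_const, ← mul_one (∏ i ∈ S, M)]
  refine mul_le_mul (Finset.prod_le_prod (fun _ _ => apply_nonneg _ _) h1)
    (Finset.prod_le_one (fun _ _ => apply_nonneg _ _) fun w hw => h2 w (Finset.mem_compl.1 hw))
    (Finset.prod_nonneg fun _ _ => apply_nonneg _ _) (Finset.prod_nonneg fun _ _ => hM)
lemma disc_le (h : Quad σ) {β : 𝓞 K} (hb : β ≠ 0) {γ : L} (hγ : γ ^ 2 = algebraMap K L β) (hs : σ γ = -γ) :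
    (discr L).natAbs ≤ 4 ^ Module.finrank ℚ K * Ideal.absNorm (Ideal.span {β}) * (discr K).natAbs ^ 2 := by
  rw [discr_quad h]
  gcongr
  have hi : IsIntegral ℤ γ := by
    refine IsIntegral.of_pow two_pos ?_
    rw [hγ]
    exact (β.isIntegral_coe).algebraMap
  set g : 𝓞 L := ⟨γ, hi⟩ with hg
  have hgc : algebraMap (𝓞 L) L g = γ := rfl
  have hm := diff_mem h g
  have e1 : g - sO σ g = 2 * g := by
    apply FaithfulSMul.algebraMap_injective (𝓞 L) L
    rw [map_sub, map_mul, map_ofNat]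
    have := sO_coe σ g
    change γ - σ γ = 2 * γ
    rw [hs]; ring
  rw [e1] at hm
  have e2 : (2 * g) ^ 2 = algebraMap (𝓞 K) (𝓞 L) (4 * β) := by
    apply FaithfulSMul.algebraMap_injective (𝓞 L) L
    rw [map_pow, map_mul, map_ofNat, hgc, mul_pow, hγ,
      ← IsScalarTower.algebraMap_apply (𝓞 K) (𝓞 L) L, IsScalarTower.algebraMap_apply (𝓞 K) K L, map_mul, map_mul,
      map_ofNat, map_ofNat]
    norm_num
  have h4b : (4 * β) ≠ 0 := mul_ne_zero (by norm_num) hb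
  have e3 : Ideal.absNorm (Ideal.span {2 * g}) ^ 2 = Ideal.absNorm (Ideal.span {4 * β}) ^ 2 := by
    rw [← map_pow, Ideal.span_singleton_pow, e2, ← Set.image_singleton, ← Ideal.map_span,
      Ideal.absNorm_algebraMap]
    rw [← IsFractionRing.finrank_eq (𝓞 K) K (𝓞 L) L, h.deg]
  have e4 := (pow_left_inj₀ (Nat.zero_le _) (Nat.zero_le _) two_ne_zero).1 e3
  have e5 : Ideal.absNorm (Ideal.span {4 * β}) = 4 ^ Module.finrank ℚ K * Ideal.absNorm (Ideal.span {β}) := by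
    rw [← Ideal.span_singleton_mul_span_singleton, map_mul]
    congr 1
    rw [Ideal.absNorm_span_singleton, show (4 : 𝓞 K) = algebraMap ℤ (𝓞 K) 4 by simp, Algebra.norm_algebraMap,
      RingOfIntegers.rank]
    simp [Int.natAbs_pow]
  rw [← e5, ← e4]
  refine Nat.le_of_dvd ?_ (Ideal.absNorm_dvd_absNorm_of_le ((Ideal.span_singleton_le_iff_mem _).2 hm))
  rw [e4]
  exact Nat.pos_of_ne_zero (by rwa [Ne, Ideal.absNorm_eq_zero_iff, Ideal.span_singleton_eq_bot])
end
theorem final (t : ℕ) (ht : 1 ≤ t) :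
    ∃ c₀ : ℝ, 0 < c₀ ∧
      ∀ n : ℕ, ∃ (l : Type) (_ : Field l) (_ : NumberField l),
        InfinitePlace.nrComplexPlaces l = t ∧ n ≤ Module.finrank ℚ l ∧
        |(NumberField.discr l : ℝ)| ^ ((Module.finrank ℚ l : ℝ)⁻¹) ≤ c₀ := by
  classical
  obtain ⟨C, hC⟩ := towers
  have hC1 : 1 ≤ C := by
    obtain ⟨L, _, _, _, _, hD⟩ := hC 0
    have := Int.natAbs_ne_zero.2 (discr_ne_zero L)
    rw [hD] at this
    exact Nat.one_le_iff_ne_zero.2 (by simpa using this)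
  have hC1' : (1 : ℝ) ≤ C := by exact_mod_cast hC1
  set E : ℝ := 16 * (32 * C) ^ (2 * t) * C ^ 2 with hE
  have hE1 : 1 ≤ E := by
    have h1 : (1 : ℝ) ≤ (32 * C) ^ (2 * t) := one_le_pow₀ (by linarith)
    have h2 : (1 : ℝ) ≤ (C : ℝ) ^ 2 := one_le_pow₀ hC1'
    have h3 : (1 : ℝ) ≤ 16 * (32 * C) ^ (2 * t) := by linarith
    exact one_le_mul_of_one_le_of_one_le h3 h2
  refine ⟨E, by linarith, fun n => ?_⟩
  obtain ⟨L, _, _, hT, hN, hD⟩ := hC (n + t)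
  set q := 2 ^ (n + t) with hq
  have hqn : n + t < q := Nat.lt_two_pow_self
  have hcard : Fintype.card (InfinitePlace L) = Module.finrank ℚ L := by
    have h1 := IsTotallyReal.finrank (K := L)
    have h2 := InfinitePlace.card_eq_nrRealPlaces_add_nrComplexPlaces L
    rw [IsTotallyReal.nrComplexPlaces_eq_zero] at h2
    omega
  obtain ⟨S, -, hS⟩ := Finset.exists_subset_card_eq (s := (Finset.univ : Finset (InfinitePlace L))) (n := t)
    (by rw [Finset.card_univ, hcard, hN]; omega)
  obtain ⟨β, h1, h2⟩ := exists_bet S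
  have hSn : ∀ w, w ∈ S ↔ rw' w (β : L) < 0 := fun w =>
    ⟨fun h => (h1 w h).1, fun h => by_contra fun hw => absurd (h2 w hw).1 (not_lt.2 h.le)⟩
  obtain ⟨w0, hw0⟩ : S.Nonempty := Finset.card_pos.1 (by omega)
  have hb : (β : L) ≠ 0 := fun h0 => by
    have := (h1 w0 hw0).1
    rw [h0, map_zero] at this
    exact lt_irrefl _ this
  have hsq : ¬ IsSquare (β : L) := by
    rintro ⟨r, hr⟩
    have := (h1 w0 hw0).1
    rw [hr, map_mul] at this
    nlinarith [mul_self_nonneg (rw' w0 r)]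
  obtain ⟨l, _, _, _, γ, σ, hQ, hγ, hs⟩ := exists_ext (β : L) hsq
  have hdeg : Module.finrank ℚ l = 4 * q := by
    rw [← Module.finrank_mul_finrank ℚ L l, hQ.deg, hN]; ring
  refine ⟨l, inferInstance, inferInstance, ?_, by rw [hdeg]; omega, ?_⟩
  · rw [← hS]
    exact ncp (α := Units.mk0 _ hb) hQ hγ hs S hSn
  · have hd := disc_le hQ (β := β) (fun h0 => hb (by rw [h0]; exact map_zero _)) hγ hs
    have hn := norm_le S β (by positivity) (fun w hw => (h1 w hw).2) (fun w hw => (h2 w hw).2)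
    rw [hS, hD, hN] at hn
    rw [hD, hN] at hd
    have hd' : |(discr l : ℝ)| ≤ E ^ q := by
      have e : |(discr l : ℝ)| = ((discr l).natAbs : ℝ) := by rw [Nat.cast_natAbs]; push_cast; rfl
      rw [e]
      have hd2 : ((discr l).natAbs : ℝ) ≤ 4 ^ (2 * q) * Ideal.absNorm (Ideal.span {β}) * ((C : ℝ) ^ q) ^ 2 := by
        exact_mod_cast hd
      refine hd2.trans ?_
      have h2q : (2 : ℝ) ≤ 2 ^ q := by
        calc (2 : ℝ) = 2 ^ 1 := by norm_num
          _ ≤ 2 ^ q := pow_le_pow_right₀ (by norm_num) (by omega)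
      have hB : (2 * 4 ^ (2 * q) * ((C ^ q : ℕ) : ℝ)) ≤ (32 * C) ^ q := by
        push_cast
        rw [mul_pow, show (32 : ℝ) = 2 * 4 ^ 2 by norm_num, mul_pow, ← pow_mul]
        gcongr
      have hn2 : (Ideal.absNorm (Ideal.span {β}) : ℝ) ≤ ((32 * C) ^ (2 * t)) ^ q := by
        refine hn.trans ?_
        rw [← pow_mul, ← pow_mul, mul_comm (2 * t) q, pow_mul _ q]
        exact pow_le_pow_left₀ (by positivity) hB _
      calc _ ≤ 4 ^ (2 * q) * ((32 * (C : ℝ)) ^ (2 * t)) ^ q * ((C : ℝ) ^ q) ^ 2 := by gcongr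
        _ = E ^ q := by
          rw [hE, mul_pow _ _ q, mul_pow _ _ q, pow_mul (4 : ℝ) 2 q, ← pow_mul (C : ℝ) q 2, mul_comm q 2,
            pow_mul (C : ℝ) 2 q, show (4 : ℝ) ^ 2 = 16 by norm_num]
    have hd4 : |(discr l : ℝ)| ≤ E ^ (4 * q) := hd'.trans (pow_le_pow_right₀ hE1 (by omega))
    rw [hdeg]
    calc _ ≤ (E ^ (4 * q)) ^ (((4 * q : ℕ) : ℝ)⁻¹) := Real.rpow_le_rpow (abs_nonneg _) hd4 (by positivity)
      _ = E := Real.pow_rpow_inv_natCast (by linarith) (by omega)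
end T10
open NumberField

/-- For each `t ≥ 1` there is a constant `c₀ > 0` and number fields of arbitrarily large
degree with exactly `t` complex places and root discriminant at most `c₀`. -/
theorem stmt_10 (t : ℕ) (ht : 1 ≤ t) :
    ∃ c₀ : ℝ, 0 < c₀ ∧
      ∀ n : ℕ, ∃ (l : Type) (_ : Field l) (_ : NumberField l),
        InfinitePlace.nrComplexPlaces l = t ∧
        n ≤ Module.finrank ℚ l ∧
        |(NumberField.discr l : ℝ)| ^ ((Module.finrank ℚ l : ℝ)⁻¹) ≤ c₀ := by
  exact T10.final t ht
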